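/- arXiv:1404.7703 — 3 statements merged into one kernel-verified Lean document; each statement's English description precedes it below -/
import Mathlib

section
/- There exists a universal constant C > 0 such that every connected weighted graph G on n ≥ 16 vertices admits a subgraph H that is a (C·(log n)²/log log n)-spanner of G and satisfies w(H) ≤ C · w(MST(G)). -/
open SimpleGraph

/-- The weight of a walk: the sum of the weights of its edges. -/
noncomputable def walkWeight {V : Type} {G : SimpleGraph V} (w : Sym2 V → NNReal)
    {u v : V} (p : G.Walk u v) : ENNReal :=
  (p.edges.map (fun e => (w e : ENNReal))).sum

/-- The weighted shortest-path distance: the infimum over all `u`–`v` walks of their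
weight (`∞` if no walk exists). -/
noncomputable def wdist {V : Type} (G : SimpleGraph V) (w : Sym2 V → NNReal)
    (u v : V) : ENNReal :=
  ⨅ p : G.Walk u v, walkWeight w p

/-- `H` is a `t`-spanner of `G` (with the inherited weights `w`):
`d_H(u,v) ≤ t · d_G(u,v)` for all vertices `u, v`. -/
def IsTSpanner {V : Type} (G H : SimpleGraph V) (w : Sym2 V → NNReal) (t : ℝ) : Prop :=
  ∀ u v : V, wdist H w u v ≤ ENNReal.ofReal t * wdist G w u v

/-- The total weight of a graph: the sum of the weights of all its edges. -/
noncomputable def totalWeight {V : Type} [Fintype V] (G : SimpleGraph V)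
    (w : Sym2 V → NNReal) : ℝ :=
  ∑ e ∈ G.edgeSet.toFinite.toFinset, (w e : ℝ)

/-- The weight of a minimum spanning tree of a connected graph `G`. -/
noncomputable def mstWeight {V : Type} [Fintype V] (G : SimpleGraph V)
    (w : Sym2 V → NNReal) : ℝ :=
  sInf {x | ∃ T : SimpleGraph V, T ≤ G ∧ T.IsTree ∧ x = totalWeight T w}

namespace LightSpanner

variable {V : Type}

/-- The source of an oriented pair. -/
def src (h : (V × V) × Bool) : V := if h.2 then h.1.1 else h.1.2

/-- The target of an oriented pair. -/
def tgt (h : (V × V) × Bool) : V := if h.2 then h.1.2 else h.1.1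

/-- The oriented pair with opposite orientation. -/
def flip (h : (V × V) × Bool) : (V × V) × Bool := (h.1, !h.2)

@[simp] lemma src_flip (h : (V × V) × Bool) : src (flip h) = tgt h := by
  rcases h with ⟨e, _ | _⟩ <;> rfl

@[simp] lemma tgt_flip (h : (V × V) × Bool) : tgt (flip h) = src h := by
  rcases h with ⟨e, _ | _⟩ <;> rfl

@[simp] lemma flip_fst (h : (V × V) × Bool) : (flip h).1 = h.1 := rfl

@[simp] lemma flip_flip (h : (V × V) × Bool) : flip (flip h) = h := by
  rcases h with ⟨e, _ | _⟩ <;> rfl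

lemma eq_or_eq_flip {h h' : (V × V) × Bool} (hh : h.1 = h'.1) : h = h' ∨ h' = flip h := by
  rcases h with ⟨e, _ | _⟩ <;> rcases h' with ⟨e', _ | _⟩ <;> simp_all [flip]

/-- The length of the route from `u` to `v` that crosses the given oriented pairs in order, at
cost `c` each, and moves along the metric `D` in between. -/
def routeLen (D : V → V → ℝ) (c : V × V → ℝ) : V → List ((V × V) × Bool) → V → ℝ
  | u, [], v => D u v
  | u, h :: l, v => D u (src h) + c h.1 + routeLen D c (tgt h) l v

/-- The axioms of a pseudometric, for a real-valued function. -/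
structure IsPseudoDist (D : V → V → ℝ) : Prop where
  self : ∀ u, D u u = 0
  symm : ∀ u v, D u v = D v u
  triangle : ∀ u v x, D u x ≤ D u v + D v x

section Route

variable {D : V → V → ℝ} {c : V × V → ℝ}

lemma IsPseudoDist.nonneg (hD : IsPseudoDist D) (u v : V) : 0 ≤ D u v := by
  have h1 := hD.triangle u v u
  have h2 := hD.symm u v
  have h3 := hD.self u
  linarith

lemma routeLen_append_cons (u : V) (l₁ : List ((V × V) × Bool)) (h : (V × V) × Bool)
    (l₂ : List ((V × V) × Bool)) (v : V) :
    routeLen D c u (l₁ ++ h :: l₂) v =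
      routeLen D c u l₁ (src h) + c h.1 + routeLen D c (tgt h) l₂ v := by
  induction l₁ generalizing u with
  | nil => rfl
  | cons a l ih => simp only [List.cons_append, routeLen, ih]; ring

lemma routeLen_le_dist_add (hD : IsPseudoDist D) (u x : V) (l : List ((V × V) × Bool)) (v : V) :
    routeLen D c u l v ≤ D u x + routeLen D c x l v := by
  cases l with
  | nil => exact hD.triangle u x v
  | cons a l =>
    simp only [routeLen]
    linarith [hD.triangle u x (src a)]

lemma routeLen_append_le (hD : IsPseudoDist D) (u : V) (l₁ : List ((V × V) × Bool)) (x : V)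
    (l₂ : List ((V × V) × Bool)) (v : V) :
    routeLen D c u (l₁ ++ l₂) v ≤ routeLen D c u l₁ x + routeLen D c x l₂ v := by
  induction l₁ generalizing u with
  | nil => exact routeLen_le_dist_add hD u x l₂ v
  | cons a l ih =>
    simp only [List.cons_append, routeLen]
    linarith [ih (tgt a)]

lemma routeLen_nonneg (hD : IsPseudoDist D) (u : V) (l : List ((V × V) × Bool)) (v : V)
    (hc : ∀ h ∈ l, 0 ≤ c h.1) : 0 ≤ routeLen D c u l v := by
  induction l generalizing u with
  | nil => exact hD.nonneg u v
  | cons a l ih =>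
    simp only [List.mem_cons, forall_eq_or_imp] at hc
    have := ih (tgt a) hc.2
    simp only [routeLen]
    linarith [hD.nonneg u (src a), hc.1]

lemma routeLen_reverse (hD : IsPseudoDist D) (u : V) (l : List ((V × V) × Bool)) (v : V) :
    routeLen D c v (l.reverse.map flip) u = routeLen D c u l v := by
  induction l generalizing u with
  | nil => exact hD.symm v u
  | cons a l ih =>
    rw [List.reverse_cons, List.map_append, List.map_cons, List.map_nil, routeLen_append_cons]
    simp only [routeLen, src_flip, tgt_flip, flip_fst, ih, hD.symm (src a) u]
    ring

/-- Every nonempty subset of `S` has a costliest member whose endpoints are at distance more than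
`t` times its cost when only the other members of the subset may be crossed. -/
def IsSparse (D : V → V → ℝ) (c : V × V → ℝ) (t : ℝ) (S : Finset (V × V)) : Prop :=
  ∀ F ⊆ S, F.Nonempty → ∃ g ∈ F, (∀ f ∈ F, c f ≤ c g) ∧
    ∀ l : List ((V × V) × Bool), (∀ h ∈ l, h.1 ∈ F ∧ h.1 ≠ g) → t * c g < routeLen D c g.2 l g.1

lemma IsSparse.mono {t : ℝ} {S S' : Finset (V × V)} (hS : IsSparse D c t S) (h : S' ⊆ S) :
    IsSparse D c t S' :=
  fun F hF hne => hS F (hF.trans h) hne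

lemma IsSparse.lt_dist {t : ℝ} {S : Finset (V × V)} (hD : IsPseudoDist D) (hS : IsSparse D c t S)
    {h : (V × V) × Bool} (hh : h.1 ∈ S) : t * c h.1 < D (src h) (tgt h) := by
  obtain ⟨g, hg, -, hl⟩ := hS {h.1} (by simpa using hh) (by simp)
  have := hl [] (by simp)
  simp only [Finset.mem_singleton] at hg
  subst hg
  rcases h with ⟨e, _ | _⟩
  · simpa [routeLen, src, tgt] using this
  · simpa [routeLen, src, tgt, hD.symm e.1 e.2] using this

/-- The greedy spanner: a sparse subset of `P` that spans `P` with stretch `t`. -/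
lemma exists_isSparse_spanning (D : V → V → ℝ) (c : V × V → ℝ) (t : ℝ) (P : Finset (V × V)) :
    ∃ S ⊆ P, IsSparse D c t S ∧ ∀ p ∈ P, p ∈ S ∨
      ∃ l : List ((V × V) × Bool), (∀ h ∈ l, h.1 ∈ S) ∧ routeLen D c p.2 l p.1 ≤ t * c p := by
  classical
  induction P using Finset.induction_on_max_value c with
  | empty =>
    refine ⟨∅, le_rfl, fun F hF hne => ?_, by simp⟩
    simp [Finset.subset_empty.1 hF] at hne
  | insert a s ha hmax ih =>
    obtain ⟨S, hSs, hS, hspan⟩ := ih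
    by_cases hex : ∃ l : List ((V × V) × Bool),
        (∀ h ∈ l, h.1 ∈ S) ∧ routeLen D c a.2 l a.1 ≤ t * c a
    · refine ⟨S, hSs.trans (Finset.subset_insert _ _), hS, fun p hp => ?_⟩
      rcases Finset.mem_insert.1 hp with rfl | hp
      · exact Or.inr hex
      · exact hspan p hp
    · refine ⟨insert a S, Finset.insert_subset_insert _ hSs, fun F hF hne => ?_, fun p hp => ?_⟩
      · by_cases haF : a ∈ F
        · refine ⟨a, haF, fun f hf => ?_, fun l hl => ?_⟩
          · rcases Finset.mem_insert.1 (hF hf) with rfl | hf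
            · exact le_rfl
            · exact hmax f (hSs hf)
          · by_contra! hle
            exact hex ⟨l, fun h hh => Finset.mem_of_mem_insert_of_ne (hF (hl h hh).1) (hl h hh).2,
              hle⟩
        · exact hS F ((Finset.subset_insert_iff_of_notMem haF).1 hF) hne
      · rcases Finset.mem_insert.1 hp with rfl | hp
        · exact Or.inl (Finset.mem_insert_self _ _)
        · rcases hspan p hp with h | ⟨l, hl, hle⟩
          · exact Or.inl (Finset.mem_insert_of_mem h)
          · exact Or.inr ⟨l, fun h hh => Finset.mem_insert_of_mem (hl h hh), hle⟩

/-- A closed route is long if its costly crossings are consecutive and never repeat at once. -/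
lemma IsSparse.lt_routeLen_closed {t : ℝ} {S : Finset (V × V)} (hD : IsPseudoDist D)
    (hS : IsSparse D c t S) (hc : ∀ e ∈ S, 0 ≤ c e) {R : ℝ} (B₁ A B₂ : List ((V × V) × Bool))
    (v : V) (hA : A ≠ []) (hAS : ∀ h ∈ A, h.1 ∈ S) (hBS : ∀ h ∈ B₁ ++ B₂, h.1 ∈ S)
    (hchain : (A.map Prod.fst).IsChain (· ≠ ·))
    (hlt : ∀ a ∈ A, ∀ b ∈ B₁ ++ B₂, c b.1 < c a.1) (hR : ∀ a ∈ A, R ≤ t * c a.1) :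
    R < routeLen D c v (B₁ ++ A ++ B₂) v := by
  classical
  induction hn : A.length using Nat.strong_induction_on generalizing A B₁ B₂ v with
  | _ n ih =>
  have hnn : ∀ (l : List ((V × V) × Bool)) (x y : V), (∀ h ∈ l, h.1 ∈ S) →
      0 ≤ routeLen D c x l y :=
    fun l x y hl => routeLen_nonneg hD x l y fun h hh => hc _ (hl h hh)
  by_cases hnd : (A.map Prod.fst).Nodup
  · obtain ⟨g, hg, hmax, hl⟩ := hS ((B₁ ++ A ++ B₂).map Prod.fst).toFinset (by
      intro e he
      simp only [List.mem_toFinset, List.mem_map, List.mem_append] at he hBS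
      grind) (by
      obtain ⟨a, ha⟩ := List.exists_mem_of_ne_nil A hA
      exact ⟨a.1, by simp only [List.mem_toFinset, List.mem_map]; exact ⟨a, by simp [ha], rfl⟩⟩)
    have hgA : ∃ h ∈ A, h.1 = g := by
      obtain ⟨a, ha⟩ := List.exists_mem_of_ne_nil A hA
      simp only [List.mem_toFinset, List.mem_map, List.mem_append] at hg hmax hlt
      obtain ⟨h, hh, rfl⟩ := hg
      have h1 := hmax a.1 ⟨a, by simp [ha], rfl⟩
      rcases hh with (hh | hh) | hh
      · exact absurd (hlt a ha h (Or.inl hh)) (not_lt.2 h1)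
      · exact ⟨h, hh, rfl⟩
      · exact absurd (hlt a ha h (Or.inr hh)) (not_lt.2 h1)
    obtain ⟨h, hhA, rfl⟩ := hgA
    obtain ⟨A₁, A₂, rfl⟩ := List.append_of_mem hhA
    have hrot : t * c h.1 < routeLen D c (tgt h) (A₂ ++ B₂ ++ (B₁ ++ A₁)) (src h) := by
      have hmem : ∀ x ∈ A₂ ++ B₂ ++ (B₁ ++ A₁),
          x.1 ∈ ((B₁ ++ (A₁ ++ h :: A₂) ++ B₂).map Prod.fst).toFinset ∧ x.1 ≠ h.1 := by
        intro x hx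
        constructor
        · simp only [List.mem_toFinset, List.mem_map]
          exact ⟨x, by simp at hx ⊢; tauto, rfl⟩
        · intro hxh
          simp only [List.map_append, List.map_cons, List.nodup_append, List.nodup_cons] at hnd
          have h3 : ∀ b ∈ B₁ ++ B₂, c b.1 < c h.1 := hlt h (by simp)
          simp only [List.mem_append] at hx h3
          rcases hx with (hx | hx) | (hx | hx)
          · exact hnd.2.1.1 (hxh ▸ List.mem_map_of_mem hx)
          · exact absurd (h3 x (Or.inr hx)) (by rw [hxh]; exact lt_irrefl _)
          · exact absurd (h3 x (Or.inl hx)) (by rw [hxh]; exact lt_irrefl _)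
          · exact hnd.2.2 x.1 (List.mem_map_of_mem hx) h.1 (by simp) hxh
      rcases h with ⟨e, _ | _⟩
      · have := hl ((A₂ ++ B₂ ++ (B₁ ++ A₁)).reverse.map flip) (by
          intro x hx
          simp only [List.mem_map, List.mem_reverse] at hx
          obtain ⟨y, hy, rfl⟩ := hx
          exact hmem y hy)
        rwa [routeLen_reverse hD] at this
      · exact hl _ hmem
    have hsplit : routeLen D c v (B₁ ++ (A₁ ++ h :: A₂) ++ B₂) v =
        routeLen D c v (B₁ ++ A₁) (src h) + c h.1 + routeLen D c (tgt h) (A₂ ++ B₂) v := by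
      rw [← routeLen_append_cons]; simp
    have := routeLen_append_le (c := c) hD (tgt h) (A₂ ++ B₂) v (B₁ ++ A₁) (src h)
    linarith [hR h hhA, hc h.1 (hAS h hhA)]
  · obtain ⟨A₁, f, A₂, f', A₃, rfl, hff⟩ : ∃ A₁ f A₂ f' A₃,
        A = A₁ ++ f :: (A₂ ++ f' :: A₃) ∧ f.1 = f'.1 := by
      have : ¬ A.Pairwise (fun a b => a.1 ≠ b.1) := by rwa [List.Nodup, List.pairwise_map] at hnd
      clear * - this
      induction A with
      | nil => simp at this
      | cons a A ih =>
        rw [List.pairwise_cons, not_and_or] at this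
        rcases this with h | h
        · push Not at h
          obtain ⟨b, hb, hab⟩ := h
          obtain ⟨A₂, A₃, rfl⟩ := List.append_of_mem hb
          exact ⟨[], a, A₂, b, A₃, rfl, hab⟩
        · obtain ⟨A₁, f, A₂, f', A₃, rfl, hff⟩ := ih h
          exact ⟨a :: A₁, f, A₂, f', A₃, rfl, hff⟩
    have hsplit : routeLen D c v (B₁ ++ (A₁ ++ f :: (A₂ ++ f' :: A₃)) ++ B₂) v =
        routeLen D c v (B₁ ++ A₁) (src f) + c f.1 + (routeLen D c (tgt f) A₂ (src f') + c f'.1 +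
          routeLen D c (tgt f') (A₃ ++ B₂) v) := by
      rw [← routeLen_append_cons, ← routeLen_append_cons]; simp
    have h1 := hnn (B₁ ++ A₁) v (src f) (by
      intro h hh
      simp only [List.mem_append] at hh
      rcases hh with hh | hh
      · exact hBS h (by simp [hh])
      · exact hAS h (by simp [hh]))
    have h2 := hnn (A₃ ++ B₂) (tgt f') v (by
      intro h hh
      simp only [List.mem_append] at hh
      rcases hh with hh | hh
      · exact hAS h (by simp [hh])
      · exact hBS h (by simp [hh]))
    have hcf := hc f.1 (hAS f (by simp))
    have hcf' := hc f'.1 (hAS f' (by simp))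
    have hch : ((f :: A₂ ++ [f']).map Prod.fst).IsChain (· ≠ ·) :=
      hchain.infix ⟨A₁.map Prod.fst, A₃.map Prod.fst, by simp⟩
    rw [hsplit]
    rcases eq_or_eq_flip hff with rfl | rfl
    · have := ih (f :: A₂).length (by simp at hn ⊢; omega) [] (f :: A₂) [] (src f) (by simp)
        (fun h hh => hAS h (by simp at hh ⊢; tauto)) (by simp)
        (hch.infix ⟨[], [f.1], by simp⟩) (by simp)
        (fun a ha => hR a (by simp at ha ⊢; tauto)) rfl
      simp only [List.nil_append, List.append_nil, routeLen, hD.self] at this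
      linarith
    · have hne : A₂ ≠ [] := by
        rintro rfl
        simp at hch
      have := ih A₂.length (by simp at hn ⊢; omega) [] A₂ [] (tgt f) hne
        (fun h hh => hAS h (by simp; tauto)) (by simp)
        (hch.infix ⟨[f.1], [f.1], by simp⟩) (by simp)
        (fun a ha => hR a (by simp; tauto)) rfl
      simp only [List.nil_append, List.append_nil, src_flip] at this ⊢
      linarith

end Route

lemma IsPseudoDist.dist_pow_le {V X : Type} {D : V → V → ℝ} (hD : IsPseudoDist D) {u : ℝ}
    {rot : Equiv.Perm X} {loc : X → V} {off : X → ℝ}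
    (h : ∀ x, D (loc x) (loc (rot x)) + off (rot x) ≤ off x + u) (x : X) (k : ℕ) :
    D (loc x) (loc ((rot ^ k) x)) + off ((rot ^ k) x) ≤ off x + k * u := by
  induction k with
  | zero => simp [hD.self]
  | succ k ih =>
    rw [pow_succ', Equiv.Perm.mul_apply]
    have := h ((rot ^ k) x)
    have := hD.triangle (loc x) (loc ((rot ^ k) x)) (loc (rot ((rot ^ k) x)))
    rw [Nat.cast_succ]
    linarith

/-- A finite set `X` of sites with a rotation, a location in `V` for every site (up to an offset)
and a tag on some sites: tagged sites are paired by `swap`, which crosses the tagging pair. -/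
structure Rotation (D : V → V → ℝ) (c : V × V → ℝ) (u : ℝ) (cl : V × V → ℕ) (q : ℕ)
    (S : Finset (V × V)) (X : Type) where
  rot : Equiv.Perm X
  swap : X → X
  loc : X → V
  off : X → ℝ
  tag : X → Option ((V × V) × Bool)
  swap_swap : ∀ x, swap (swap x) = x
  dist_rot : ∀ x, D (loc x) (loc (rot x)) + off (rot x) ≤ off x + u
  off_nonneg : ∀ x, 0 ≤ off x
  mem_of_tag : ∀ {x h}, tag x = some h → h.1 ∈ S
  loc_of_tag : ∀ {x h}, tag x = some h → loc x = src h
  off_of_tag : ∀ {x h}, tag x = some h → off x = 0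
  tag_swap : ∀ {x h}, tag x = some h → tag (swap x) = some (flip h)
  no_return : ∀ {x h h' k}, tag x = some h → 1 ≤ k → k ≤ q →
    tag ((rot ^ (k * 2 ^ cl h.1)) x) = some h' → h.1 ≠ h'.1

namespace Rotation

variable {D : V → V → ℝ} {c : V × V → ℝ} {u : ℝ} {cl : V × V → ℕ} {q : ℕ}
  {S : Finset (V × V)} {X : Type} (r : Rotation D c u cl q S X)

lemma dist_rot_pow (hD : IsPseudoDist D) (x : X) (k : ℕ) :
    D (r.loc x) (r.loc ((r.rot ^ k) x)) + r.off ((r.rot ^ k) x) ≤ r.off x + k * u :=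
  hD.dist_pow_le r.dist_rot x k

/-- The site `x` carries a tag of class `j`. -/
def Occ (j : ℕ) (x : X) : Prop := ∃ h, r.tag x = some h ∧ cl h.1 = j

lemma Occ.swap {r : Rotation D c u cl q S X} {j : ℕ} {x : X} (h : r.Occ j x) :
    r.Occ j (r.swap x) := by
  obtain ⟨h, hx, hj⟩ := h
  exact ⟨flip h, r.tag_swap hx, hj⟩

open Classical in
/-- The sites reachable from `x` by processing the classes in the list in order: at class `j`, an
optional swap (if the tag has class `j`), then a rotation by `2 ^ j`. -/
noncomputable def reach : List ℕ → X → Finset X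
  | [], x => {x}
  | j :: L, x => reach L ((r.rot ^ 2 ^ j) x) ∪
      if r.Occ j x then reach L ((r.rot ^ 2 ^ j) (r.swap x)) else ∅

lemma reach_nonempty (L : List ℕ) (x : X) : (r.reach L x).Nonempty := by
  classical
  induction L generalizing x with
  | nil => simp [reach]
  | cons j L ih => exact (ih _).mono Finset.subset_union_left

lemma mem_reach_cons {j : ℕ} {L : List ℕ} {x y : X} (hy : y ∈ r.reach (j :: L) x) :
    y ∈ r.reach L ((r.rot ^ 2 ^ j) x) ∨
      ∃ h, r.tag x = some h ∧ cl h.1 = j ∧ y ∈ r.reach L ((r.rot ^ 2 ^ j) (r.swap x)) := by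
  simp only [reach, Finset.mem_union] at hy
  rcases hy with hy | hy
  · exact Or.inl hy
  · split_ifs at hy with hocc
    · obtain ⟨h, hx, hj⟩ := hocc
      exact Or.inr ⟨h, hx, hj, hy⟩
    · simp at hy

lemma routeLen_rot (hD : IsPseudoDist D) {j : ℕ} {x y : X} {l : List ((V × V) × Bool)} {b : ℝ}
    (hl : routeLen D c (r.loc ((r.rot ^ 2 ^ j) x)) l (r.loc y) + r.off y ≤
      r.off ((r.rot ^ 2 ^ j) x) + b) :
    routeLen D c (r.loc x) l (r.loc y) + r.off y ≤ r.off x + 2 ^ j * u + b := by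
  have h1 := r.dist_rot_pow hD x (2 ^ j)
  have h2 := routeLen_le_dist_add (c := c) hD (r.loc x) (r.loc ((r.rot ^ 2 ^ j) x)) l (r.loc y)
  rw [Nat.cast_pow, Nat.cast_ofNat] at h1
  linarith

lemma routeLen_swap_rot (hD : IsPseudoDist D) {j : ℕ} {x y : X} {h : (V × V) × Bool}
    {l : List ((V × V) × Bool)} {b : ℝ} (hx : r.tag x = some h)
    (hl : routeLen D c (r.loc ((r.rot ^ 2 ^ j) (r.swap x))) l (r.loc y) + r.off y ≤
      r.off ((r.rot ^ 2 ^ j) (r.swap x)) + b) :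
    routeLen D c (r.loc x) (h :: l) (r.loc y) + r.off y ≤
      r.off x + c h.1 + 2 ^ j * u + b := by
  have h1 := r.routeLen_rot hD hl
  have hs := r.tag_swap hx
  rw [r.off_of_tag hs, r.loc_of_tag hs, src_flip] at h1
  simp only [routeLen]
  rw [r.loc_of_tag hx, hD.self, r.off_of_tag hx]
  linarith

lemma exists_route (hD : IsPseudoDist D) (hcl : ∀ e ∈ S, c e ≤ 2 * (2 ^ cl e * u)) (hu : 0 ≤ u)
    {L : List ℕ} {x y : X} (hy : y ∈ r.reach L x) :
    ∃ B : List ((V × V) × Bool), (∀ h ∈ B, h.1 ∈ S ∧ cl h.1 ∈ L) ∧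
      routeLen D c (r.loc x) B (r.loc y) + r.off y ≤
        r.off x + 3 * u * (L.map (fun i => (2 : ℝ) ^ i)).sum := by
  induction L generalizing x with
  | nil =>
    simp only [reach, Finset.mem_singleton] at hy
    exact ⟨[], by simp, by simp [routeLen, hy, hD.self]⟩
  | cons j L ih =>
    have hp : 0 ≤ 2 ^ j * u := by positivity
    rcases r.mem_reach_cons hy with hy | ⟨h, hx, hj, hy⟩
    · obtain ⟨B, hB, hlen⟩ := ih hy
      refine ⟨B, fun h hh => ⟨(hB h hh).1, List.mem_cons_of_mem _ (hB h hh).2⟩, ?_⟩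
      have := r.routeLen_rot hD hlen
      simp only [List.map_cons, List.sum_cons]
      linarith
    · obtain ⟨B, hB, hlen⟩ := ih hy
      refine ⟨h :: B, fun h' hh => ?_, ?_⟩
      · rcases List.mem_cons.1 hh with rfl | hh
        · exact ⟨r.mem_of_tag hx, by simp [hj]⟩
        · exact ⟨(hB h' hh).1, List.mem_cons_of_mem _ (hB h' hh).2⟩
      · have := r.routeLen_swap_rot hD hx hlen
        have := hcl _ (r.mem_of_tag hx)
        rw [hj] at this
        simp only [List.map_cons, List.sum_cons]
        linarith

lemma exists_route_of_antitone (hD : IsPseudoDist D) (hcl : ∀ e ∈ S, c e ≤ 2 * (2 ^ cl e * u))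
    (hu : 0 ≤ u) {j : ℕ} {L : List ℕ} (hL : L.Pairwise (· ≥ ·)) (hj : ∀ i ∈ L, i ≤ j) {x₀ y : X}
    {h₀ : (V × V) × Bool} (hx₀ : r.tag x₀ = some h₀) (hh₀ : cl h₀.1 = j) {k : ℕ} (hk : 1 ≤ k)
    (hkL : k + L.count j ≤ q) (hy : y ∈ r.reach L ((r.rot ^ (k * 2 ^ j)) x₀)) :
    ∃ A B : List ((V × V) × Bool), (∀ h ∈ A, h.1 ∈ S ∧ cl h.1 = j) ∧
      (∀ h ∈ B, h.1 ∈ S ∧ cl h.1 < j) ∧ (h₀.1 :: A.map Prod.fst).IsChain (· ≠ ·) ∧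
      routeLen D c (r.loc ((r.rot ^ (k * 2 ^ j)) x₀)) (A ++ B) (r.loc y) + r.off y ≤
        r.off ((r.rot ^ (k * 2 ^ j)) x₀) + 3 * u * (L.map (fun i => (2 : ℝ) ^ i)).sum := by
  induction L generalizing x₀ h₀ k with
  | nil =>
    simp only [reach, Finset.mem_singleton] at hy
    exact ⟨[], [], by simp, by simp, by simp, by simp [routeLen, hy, hD.self]⟩
  | cons i L ih =>
    rw [List.pairwise_cons] at hL
    rcases (hj i (by simp)).lt_or_eq with hij | rfl
    · obtain ⟨B, hB, hlen⟩ := r.exists_route hD hcl hu hy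
      refine ⟨[], B, by simp, fun h hh => ⟨(hB h hh).1, ?_⟩, by simp, hlen⟩
      rcases List.mem_cons.1 (hB h hh).2 with he | he
      · omega
      · have := hL.1 _ he
        omega
    · have hp : 0 ≤ 2 ^ i * u := by positivity
      rw [List.count_cons_self] at hkL
      have hj' : ∀ i' ∈ L, i' ≤ i := fun i' hi' => hj i' (by simp [hi'])
      rcases r.mem_reach_cons hy with hy | ⟨h, hx, hhi, hy⟩
      · have he : (r.rot ^ 2 ^ i) ((r.rot ^ (k * 2 ^ i)) x₀) = (r.rot ^ ((k + 1) * 2 ^ i)) x₀ := by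
          rw [← Equiv.Perm.mul_apply, ← pow_add]; congr 2; ring
        rw [he] at hy
        obtain ⟨A, B, hA, hB, hch, hlen⟩ := ih hL.2 hj' hx₀ hh₀ (k := k + 1) (by omega) (by omega) hy
        refine ⟨A, B, hA, hB, hch, ?_⟩
        rw [← he] at hlen
        have := r.routeLen_rot hD hlen
        simp only [List.map_cons, List.sum_cons]
        linarith
      · have hs := r.tag_swap hx
        have he : ∀ z, (r.rot ^ 2 ^ i) z = (r.rot ^ (1 * 2 ^ i)) z := by simp
        rw [he] at hy
        obtain ⟨A, B, hA, hB, hch, hlen⟩ :=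
          ih hL.2 hj' hs (by simpa using hhi) le_rfl (by omega) hy
        refine ⟨h :: A, B, ?_, hB, ?_, ?_⟩
        · intro h' hh
          rcases List.mem_cons.1 hh with rfl | hh
          · exact ⟨r.mem_of_tag hx, hhi⟩
          · exact hA h' hh
        · rw [List.map_cons, List.isChain_cons_cons]
          refine ⟨?_, by simpa using hch⟩
          exact r.no_return hx₀ hk (by omega) (by rw [hh₀]; exact hx)
        · rw [← he] at hlen
          have := r.routeLen_swap_rot hD hx hlen
          have := hcl _ (r.mem_of_tag hx)
          rw [hhi] at this
          simp only [List.map_cons, List.sum_cons, List.cons_append]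
          linarith

lemma sum_two_pow_le {q j : ℕ} {L : List ℕ} (hj : ∀ i ∈ L, i ≤ j) (hq : ∀ i, L.count i ≤ q) :
    (L.map (fun i => (2 : ℝ) ^ i)).sum ≤ q * 2 ^ (j + 1) := by
  rw [Finset.sum_list_map_count]
  calc ∑ i ∈ L.toFinset, L.count i • (2 : ℝ) ^ i
      ≤ ∑ i ∈ L.toFinset, (q : ℝ) * 2 ^ i := by
        refine Finset.sum_le_sum fun i _ => ?_
        rw [nsmul_eq_mul]
        gcongr
        exact hq i
    _ ≤ ∑ i ∈ Finset.range (j + 1), (q : ℝ) * 2 ^ i := by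
        refine Finset.sum_le_sum_of_subset_of_nonneg (fun i hi => ?_) fun _ _ _ => by positivity
        have := hj i (by simpa using hi)
        simp only [Finset.mem_range]
        omega
    _ ≤ q * 2 ^ (j + 1) := by
        rw [← Finset.mul_sum, geom_sum_eq (by norm_num)]
        gcongr
        norm_num

/-- Taking a swap and declining it lead to disjoint sets of sites. -/
lemma disjoint_reach (hD : IsPseudoDist D) (hcl : ∀ e ∈ S, c e < 2 * (2 ^ cl e * u))
    (hcl' : ∀ e ∈ S, 2 ^ cl e * u ≤ c e) (hu : 0 < u) {t : ℝ} (hS : IsSparse D c t S)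
    (ht : 12 * q + 2 ≤ t) {j : ℕ} {L : List ℕ} (hL : (j :: L).Pairwise (· ≥ ·))
    (hq : ∀ i, (j :: L).count i ≤ q) {x : X} (hx : r.Occ j x) :
    Disjoint (r.reach L ((r.rot ^ 2 ^ j) x)) (r.reach L ((r.rot ^ 2 ^ j) (r.swap x))) := by
  rw [Finset.disjoint_left]
  intro y hy₂ hy₁
  obtain ⟨h, hx, hhj⟩ := hx
  have hs := r.tag_swap hx
  have hle : ∀ e ∈ S, c e ≤ 2 * (2 ^ cl e * u) := fun e he => (hcl e he).le
  have hpos : ∀ i : ℕ, 0 < 2 ^ i * u := fun i => by positivity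
  have he : ∀ z, (r.rot ^ 2 ^ j) z = (r.rot ^ (1 * 2 ^ j)) z := by simp
  rw [he] at hy₁ hy₂
  have hcount := hq j
  rw [List.count_cons_self] at hcount
  have hj : ∀ i ∈ L, i ≤ j := fun i hi => (List.pairwise_cons.1 hL).1 i hi
  have hL' := (List.pairwise_cons.1 hL).2
  obtain ⟨A₂, B₂, hA₂, hB₂, hch₂, hlen₂⟩ := r.exists_route_of_antitone hD hle hu.le hL' hj hx hhj
    le_rfl (by omega) hy₂
  obtain ⟨A₁, B₁, hA₁, hB₁, hch₁, hlen₁⟩ := r.exists_route_of_antitone hD hle hu.le hL' hj hs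
    (by simpa using hhj) le_rfl (by omega) hy₁
  rw [← he] at hlen₁ hlen₂
  have hlen₁' := r.routeLen_swap_rot hD hx hlen₁
  have hlen₂' := r.routeLen_rot hD hlen₂
  rw [r.off_of_tag hx] at hlen₁' hlen₂'
  have hsum := sum_two_pow_le (L := j :: L) (j := j) (by simpa using hj) hq
  simp only [List.map_cons, List.sum_cons] at hsum
  rw [← routeLen_reverse hD] at hlen₂'
  have happ := routeLen_append_le (c := c) hD (r.loc y) ((A₂ ++ B₂).reverse.map flip) (r.loc x)
    (h :: (A₁ ++ B₁)) (r.loc y)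
  have hmem : ∀ a ∈ A₂.reverse.map flip ++ h :: A₁, a.1 ∈ S ∧ cl a.1 = j := by
    intro a ha
    simp only [List.mem_append, List.mem_map, List.mem_reverse, List.mem_cons] at ha
    rcases ha with ⟨b, hb, rfl⟩ | rfl | ha
    · exact hA₂ b hb
    · exact ⟨r.mem_of_tag hx, hhj⟩
    · exact hA₁ a ha
  have hmemB : ∀ b ∈ B₂.reverse.map flip ++ B₁, b.1 ∈ S ∧ cl b.1 < j := by
    intro b hb
    simp only [List.mem_append, List.mem_map, List.mem_reverse] at hb
    rcases hb with ⟨b, hb, rfl⟩ | hb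
    · exact hB₂ b hb
    · exact hB₁ b hb
  have key := hS.lt_routeLen_closed hD (fun e he => (hpos _).le.trans (hcl' e he))
    (R := (12 * q + 2) * (2 ^ j * u)) (B₂.reverse.map flip) (A₂.reverse.map flip ++ h :: A₁) B₁
    (r.loc y) (by simp) (fun a ha => (hmem a ha).1) (fun b hb => (hmemB b hb).1) (by
      have hmap : (A₂.reverse.map flip ++ h :: A₁).map Prod.fst =
          (A₂.map Prod.fst).reverse ++ h.1 :: A₁.map Prod.fst := by
        simp [Function.comp_def]
      rw [hmap, List.isChain_split]
      refine ⟨?_, by simpa using hch₁⟩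
      rw [← List.reverse_cons, List.isChain_reverse]
      exact hch₂.imp fun _ _ h => h.symm) (by
      intro a ha b hb
      obtain ⟨haS, haj⟩ := hmem a ha
      obtain ⟨hbS, hbj⟩ := hmemB b hb
      have h1 := hcl _ hbS
      have h2 := hcl' _ haS
      rw [haj] at h2
      have h3 : (2 : ℝ) * 2 ^ cl b.1 ≤ 2 ^ j := by
        rw [← pow_succ']
        exact pow_le_pow_right₀ (by norm_num) hbj
      nlinarith) (by
      intro a ha
      obtain ⟨haS, haj⟩ := hmem a ha
      have h2 := hcl' _ haS
      rw [haj] at h2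
      have := hpos j
      have hq0 : (0 : ℝ) ≤ q := q.cast_nonneg
      nlinarith)
  have hch := hcl _ (r.mem_of_tag hx)
  rw [hhj] at hch
  have hy0 := r.off_nonneg y
  have hassoc : B₂.reverse.map flip ++ (A₂.reverse.map flip ++ h :: A₁) ++ B₁ =
      (A₂ ++ B₂).reverse.map flip ++ h :: (A₁ ++ B₁) := by simp
  rw [hassoc] at key
  have hsum' := mul_le_mul_of_nonneg_left hsum (by positivity : (0 : ℝ) ≤ 6 * u)
  rw [pow_succ] at hsum'
  have := hpos j
  nlinarith

lemma sum_logb_card_reach [Fintype X] (hD : IsPseudoDist D)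
    (hcl : ∀ e ∈ S, c e < 2 * (2 ^ cl e * u)) (hcl' : ∀ e ∈ S, 2 ^ cl e * u ≤ c e) (hu : 0 < u)
    {t : ℝ} (hS : IsSparse D c t S) (ht : 12 * q + 2 ≤ t) {L : List ℕ} (hL : L.Pairwise (· ≥ ·))
    (hq : ∀ i, L.count i ≤ q) :
    (L.map fun j => (Nat.card {x // r.Occ j x} : ℝ)).sum ≤
      ∑ x, Real.logb 2 (r.reach L x).card := by
  classical
  induction L with
  | nil => simp [reach]
  | cons j L ih =>
    have ih := ih (List.pairwise_cons.1 hL).2 fun i => (List.count_le_count_cons).trans (hq i)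
    set f : X → ℝ := fun x => Real.logb 2 (r.reach L ((r.rot ^ 2 ^ j) x)).card with hf
    have hrot : ∑ x, f x = ∑ x, Real.logb 2 (r.reach L x).card :=
      Equiv.sum_comp (r.rot ^ 2 ^ j) fun x => Real.logb 2 (r.reach L x).card
    set O := Finset.univ.filter (r.Occ j) with hO
    have hcard : (Nat.card {x // r.Occ j x} : ℝ) = ∑ x ∈ O, 1 := by
      rw [Nat.card_eq_fintype_card, Fintype.card_subtype]; simp [hO]
    have hswap : ∑ x ∈ O, f (r.swap x) = ∑ x ∈ O, f x := by
      refine Finset.sum_nbij' r.swap r.swap ?_ ?_ ?_ ?_ ?_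
      · intro x hx
        simp only [hO, Finset.mem_filter, Finset.mem_univ, true_and] at hx ⊢
        exact hx.swap
      · intro x hx
        simp only [hO, Finset.mem_filter, Finset.mem_univ, true_and] at hx ⊢
        exact hx.swap
      · exact fun x _ => r.swap_swap x
      · exact fun x _ => r.swap_swap x
      · exact fun x _ => rfl
    have hstep : ∀ x, f x + (if r.Occ j x then 1 + (f (r.swap x) - f x) / 2 else 0) ≤
        Real.logb 2 (r.reach (j :: L) x).card := by
      intro x
      by_cases hx : r.Occ j x
      · have hdis := r.disjoint_reach hD hcl hcl' hu hS ht hL hq hx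
        simp only [hx, if_true, reach, Finset.card_union_of_disjoint hdis, hf]
        have ha : (0 : ℝ) < (r.reach L ((r.rot ^ 2 ^ j) x)).card := by
          exact_mod_cast (r.reach_nonempty _ _).card_pos
        have hb : (0 : ℝ) < (r.reach L ((r.rot ^ 2 ^ j) (r.swap x))).card := by
          exact_mod_cast (r.reach_nonempty _ _).card_pos
        generalize ((r.reach L ((r.rot ^ 2 ^ j) x)).card : ℕ) = a at *
        generalize ((r.reach L ((r.rot ^ 2 ^ j) (r.swap x))).card : ℕ) = b at *
        push_cast
        have h4 : Real.logb 2 (2 ^ 2 * (a * b : ℝ)) ≤ Real.logb 2 ((a + b : ℝ) ^ 2) :=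
          Real.logb_le_logb_of_le (by norm_num) (by positivity)
            (by nlinarith [sq_nonneg (a - b : ℝ)])
        rw [Real.logb_mul (by norm_num) (by positivity), Real.logb_mul ha.ne' hb.ne',
          Real.logb_pow, Real.logb_pow, Real.logb_self_eq_one (by norm_num)] at h4
        push_cast at h4
        linarith
      · simp [hx, reach, hf]
    have hsum := Finset.sum_le_sum fun x (_ : x ∈ Finset.univ) => hstep x
    rw [Finset.sum_add_distrib, ← Finset.sum_filter, Finset.sum_add_distrib, ← Finset.sum_div,
      Finset.sum_sub_distrib, hswap, ← hcard] at hsum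
    simp only [List.map_cons, List.sum_cons]
    linarith

/-- The entropy bound: there are few tagged sites. -/
lemma mul_card_tag_le [Fintype X] (hD : IsPseudoDist D)
    (hcl : ∀ e ∈ S, c e < 2 * (2 ^ cl e * u)) (hcl' : ∀ e ∈ S, 2 ^ cl e * u ≤ c e) (hu : 0 < u)
    {t : ℝ} (hS : IsSparse D c t S) (ht : 12 * q + 2 ≤ t) :
    (q : ℝ) * Nat.card {x // (r.tag x).isSome} ≤
      Fintype.card X * Real.logb 2 (Fintype.card X) := by
  classical
  set J := S.sup cl + 1 with hJ
  set L := (List.range J).reverse.flatMap (List.replicate q) with hLdef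
  have hL : L.Pairwise (· ≥ ·) := by
    rw [hLdef, List.pairwise_flatMap]
    refine ⟨fun a _ => List.pairwise_replicate.2 (Or.inr le_rfl), ?_⟩
    rw [List.pairwise_reverse]
    refine List.pairwise_lt_range.imp fun {a b} hab x hx y hy => ?_
    rw [List.mem_replicate] at hx hy
    omega
  have hq : ∀ i, L.count i ≤ q := by
    intro i
    have : ∀ M : List ℕ, M.Nodup → (M.flatMap (List.replicate q)).count i ≤ q ∧
        (i ∉ M → (M.flatMap (List.replicate q)).count i = 0) := by
      intro M hM
      induction M with
      | nil => simp
      | cons a M ih =>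
        rw [List.nodup_cons] at hM
        have := ih hM.2
        simp only [List.flatMap_cons, List.count_append, List.count_replicate, List.mem_cons]
        by_cases hai : a = i
        · subst hai
          simp [this.2 hM.1]
        · simp only [beq_iff_eq, hai, if_false, zero_add]
          exact ⟨this.1, fun h => this.2 fun h' => h (Or.inr h')⟩
    exact (this _ (List.nodup_reverse.2 List.nodup_range)).1
  have h1 := r.sum_logb_card_reach hD hcl hcl' hu hS ht hL hq
  have h2 : ∑ x, Real.logb 2 (r.reach L x).card ≤
      Fintype.card X * Real.logb 2 (Fintype.card X) := by
    rw [← nsmul_eq_mul, ← Finset.card_univ]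
    refine Finset.sum_le_card_nsmul _ _ _ fun x _ => ?_
    refine Real.logb_le_logb_of_le (by norm_num) ?_ ?_
    · exact_mod_cast (r.reach_nonempty _ _).card_pos
    · exact_mod_cast Finset.card_le_univ _
  have h3 : (L.map fun j => (Nat.card {x // r.Occ j x} : ℝ)).sum =
      ∑ j ∈ Finset.range J, (q : ℝ) * Nat.card {x // r.Occ j x} := by
    have : ∀ (M : List ℕ) (f : ℕ → ℝ),
        ((M.flatMap (List.replicate q)).map f).sum = (M.map fun j => q * f j).sum := by
      intro M f
      induction M with
      | nil => simp
      | cons a M ih => simp [ih]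
    rw [hLdef, this, List.map_reverse, List.sum_reverse, ← List.sum_toFinset _ List.nodup_range,
      List.toFinset_range]
  have h4 : (Nat.card {x // (r.tag x).isSome} : ℝ) ≤
      ∑ j ∈ Finset.range J, (Nat.card {x // r.Occ j x} : ℝ) := by
    simp only [Nat.card_eq_fintype_card, Fintype.card_subtype]
    rw [← Nat.cast_sum, Nat.cast_le]
    refine le_trans (Finset.card_le_card ?_) Finset.card_biUnion_le
    intro x hx
    simp only [Finset.mem_filter, Finset.mem_univ, true_and, Option.isSome_iff_exists] at hx
    obtain ⟨h, hx⟩ := hx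
    simp only [Finset.mem_biUnion, Finset.mem_filter, Finset.mem_univ, true_and, Finset.mem_range]
    exact ⟨cl h.1, Nat.lt_succ_of_le (Finset.le_sup (f := cl) (r.mem_of_tag hx)), h, hx, rfl⟩
  rw [← Finset.mul_sum] at h3
  calc (q : ℝ) * Nat.card {x // (r.tag x).isSome}
      ≤ q * ∑ j ∈ Finset.range J, (Nat.card {x // r.Occ j x} : ℝ) := by gcongr
    _ ≤ _ := h3 ▸ h1.trans h2

end Rotation

/-- A site of a tour: a location, an offset, and optionally an oriented pair with an index. -/
abbrev Site (V : Type) : Type := V × ℝ × Option (((V × V) × Bool) × ℕ)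

/-- The site `b` may follow the site `a` on a tour. -/
def Linked (D : V → V → ℝ) (u : ℝ) (cl : V × V → ℕ) (a b : Site V) : Prop :=
  D a.1 b.1 + b.2.1 ≤ a.2.1 + u ∧
    ∀ h i, a.2.2 = some (h, i) → i + 1 < 2 ^ cl h.1 → b.2.2 = some (h, i + 1)

/-- Offsets are nonnegative, and tagged sites lie at the source of their tag, with offset `0`. -/
def Site.Valid (a : Site V) : Prop :=
  0 ≤ a.2.1 ∧ ∀ h i, a.2.2 = some (h, i) → a.1 = src h ∧ a.2.1 = 0

/-- The tags on a list of sites. -/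
def tags (L : List (Site V)) : List (((V × V) × Bool) × ℕ) := L.filterMap fun a => a.2.2

lemma exists_rotation_of_tour {D : V → V → ℝ} {c : V × V → ℝ} {u : ℝ} {cl : V × V → ℕ} {q : ℕ}
    {S : Finset (V × V)} (hD : IsPseudoDist D) (hcl' : ∀ e ∈ S, 2 ^ cl e * u ≤ c e) (hu : 0 < u)
    {t : ℝ} (hS : IsSparse D c t S) (ht : q + 1 ≤ t) {L : List (Site V)} {a₀ : Site V}
    (hhead : L.head? = some a₀) (hchain : (L ++ [a₀]).IsChain (Linked D u cl))
    (hvalid : ∀ a ∈ L, a.Valid) (hnd : (tags L).Nodup)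
    (hmem : ∀ h i, (h, i) ∈ tags L ↔ h.1 ∈ S ∧ i < 2 ^ cl h.1) [NeZero L.length] :
    ∃ r : Rotation D c u cl q S (ZMod L.length),
      Nat.card {x // (r.tag x).isSome} = (tags L).length := by
  classical
  set m := L.length with hm
  set f : ZMod m → Site V := fun x => L[x.val]'(ZMod.val_lt x) with hf
  have hfL : ∀ x, f x ∈ L := fun x => List.getElem_mem _
  have hlink : ∀ x, Linked D u cl (f x) (f (x + 1)) := by
    intro x
    have hx := ZMod.val_lt x
    have h1 := List.isChain_iff_getElem.1 hchain x.val (by simp; omega)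
    rw [List.getElem_append_left hx] at h1
    rcases Nat.lt_or_ge (x.val + 1) m with hlt | hge
    · rw [List.getElem_append_left hlt] at h1
      have : (x + 1).val = x.val + 1 := by
        rw [← Nat.cast_one, ← ZMod.natCast_zmod_val x, ← Nat.cast_add, ZMod.val_natCast_of_lt hlt,
          ZMod.natCast_zmod_val]
      simpa only [hf, this] using h1
    · have hxm : x.val + 1 = m := by omega
      rw [List.getElem_append_right (by omega)] at h1
      have h0 : x + 1 = 0 := by
        rw [← Nat.cast_one, ← ZMod.natCast_zmod_val x, ← Nat.cast_add, hxm, ZMod.natCast_self]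
      have h00 : f 0 = a₀ := by
        have : L[0]? = some a₀ := by rw [← hhead]; cases L <;> rfl
        simp only [hf, ZMod.val_zero]
        exact List.getElem_eq_iff _ |>.2 this
      rw [h0, h00]
      simpa using h1
  have huniq : ∀ x y p, (f x).2.2 = some p → (f y).2.2 = some p → x = y := by
    intro x y p hx hy
    rw [tags, List.Nodup, List.pairwise_filterMap, List.pairwise_iff_getElem] at hnd
    rcases lt_trichotomy x.val y.val with hlt | heq | hlt
    · exact absurd rfl (hnd _ _ (ZMod.val_lt x) (ZMod.val_lt y) hlt p hx p hy)
    · exact ZMod.val_injective _ heq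
    · exact absurd rfl (hnd _ _ (ZMod.val_lt y) (ZMod.val_lt x) hlt p hy p hx)
  have hex : ∀ p : ((V × V) × Bool) × ℕ, ∃ x, p ∈ tags L → (f x).2.2 = some p := by
    intro p
    by_cases hp : p ∈ tags L
    · obtain ⟨a, ha, hap⟩ := List.mem_filterMap.1 hp
      obtain ⟨i, hi, rfl⟩ := List.getElem_of_mem ha
      exact ⟨(i : ZMod m), fun _ => by simpa only [hf, ZMod.val_natCast_of_lt hi] using hap⟩
    · exact ⟨0, fun h => absurd h hp⟩
  choose pos hpos using hex
  have hmem' : ∀ {x p}, (f x).2.2 = some p → p ∈ tags L :=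
    fun {x p} hx => List.mem_filterMap.2 ⟨f x, hfL x, hx⟩
  have hflip : ∀ {h i}, (h, i) ∈ tags L → (flip h, i) ∈ tags L := fun {h i} hh => by
    rw [hmem] at hh ⊢; exact hh
  set rot : Equiv.Perm (ZMod m) := Equiv.addRight 1 with hrot
  have hrotk : ∀ (k : ℕ) x, (rot ^ k) x = x + k := by
    intro k x
    induction k with
    | zero => simp
    | succ k ih => rw [pow_succ', Equiv.Perm.mul_apply, ih, hrot]; simp [add_assoc]
  have hdist : ∀ x, D (f x).1 (f (rot x)).1 + (f (rot x)).2.1 ≤ (f x).2.1 + u :=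
    fun x => (hlink x).1
  have hloc : ∀ {x p}, (f x).2.2 = some p → (f x).1 = src p.1 ∧ (f x).2.1 = 0 :=
    fun {x p} hx => (hvalid _ (hfL x)).2 p.1 p.2 hx
  have hfar : ∀ {x y h i i'} (k : ℕ), (f x).2.2 = some (h, i) → (f y).2.2 = some (flip h, i') →
      y = x + k → k ≤ (q + 1) * 2 ^ cl h.1 → False := by
    intro x y h i i' k hx hy hxy hk
    have h1 := hD.dist_pow_le (loc := fun x => (f x).1) (off := fun x => (f x).2.1) hdist x k
    rw [hrotk, ← hxy] at h1
    have hx' := hloc hx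
    have hy' := hloc hy
    rw [hx'.1, hx'.2, hy'.1, hy'.2] at h1
    simp only [src_flip] at h1
    have hhS := ((hmem _ _).1 (hmem' hx)).1
    have h2 := hS.lt_dist hD hhS
    have h3 := hcl' _ hhS
    have hk' : (k : ℝ) ≤ (q + 1) * 2 ^ cl h.1 := by exact_mod_cast hk
    have h4 : (k : ℝ) * u ≤ (q + 1) * 2 ^ cl h.1 * u := by gcongr
    have h5 : (q + 1) * (2 ^ cl h.1 * u) ≤ (q + 1) * c h.1 := by gcongr
    have h6 : (0 : ℝ) ≤ c h.1 := le_trans (by positivity) h3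
    have h7 : (q + 1) * c h.1 ≤ t * c h.1 := by gcongr
    linarith
  have hrun : ∀ h i, (h, i) ∈ tags L → pos (h, i) = pos (h, 0) + i := by
    intro h i
    induction i with
    | zero => simp
    | succ i ih =>
      intro hi
      have hi' : (h, i) ∈ tags L := by
        rw [hmem] at hi ⊢
        exact ⟨hi.1, by omega⟩
      have h1 := (hlink (pos (h, i))).2 h i (hpos _ hi') ((hmem _ _).1 hi).2
      have h2 := huniq _ _ _ (hpos _ hi) h1
      rw [h2, ih hi']
      push_cast
      ring
  have hperiod : ∀ {x h i} (k : ℕ), (f x).2.2 = some (h, i) → 0 < k →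
      k ≤ (q + 1) * 2 ^ cl h.1 → (k : ZMod m) ≠ 0 := by
    intro x h i k hx hk hkq h0
    have hmk := Nat.le_of_dvd hk ((ZMod.natCast_eq_zero_iff _ _).1 h0)
    refine hfar (pos (flip h, i) - x).val hx (hpos _ (hflip (hmem' hx))) ?_ ?_
    · rw [ZMod.natCast_zmod_val]; ring
    · exact (ZMod.val_lt _).le.trans (hmk.trans hkq)
  let tag : ZMod m → Option ((V × V) × Bool) := fun x => (f x).2.2.map Prod.fst
  have htag : ∀ {x h}, tag x = some h → ∃ i, (f x).2.2 = some (h, i) := by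
    intro x h hx
    obtain ⟨p, hp, rfl⟩ := Option.map_eq_some_iff.1 hx
    exact ⟨p.2, hp⟩
  let swap : ZMod m → ZMod m := fun x => ((f x).2.2.map fun p => pos (flip p.1, p.2)).getD x
  have hswap : ∀ {x p}, (f x).2.2 = some p → swap x = pos (flip p.1, p.2) := by
    intro x p hx
    simp [swap, hx]
  refine ⟨⟨rot, swap, fun x => (f x).1, fun x => (f x).2.1, tag, ?_, hdist,
    fun x => (hvalid _ (hfL x)).1, ?_, ?_, ?_, ?_, ?_⟩, ?_⟩
  · intro x
    rcases hx : (f x).2.2 with _ | p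
    · simp [swap, hx]
    · have h1 := hpos _ (hflip (hmem' hx))
      rw [hswap hx, hswap h1]
      simp only [flip_flip]
      exact huniq _ _ _ (hpos _ (hmem' hx)) hx
  · intro x h hx
    obtain ⟨i, hi⟩ := htag hx
    exact ((hmem _ _).1 (hmem' hi)).1
  · intro x h hx
    obtain ⟨i, hi⟩ := htag hx
    exact (hloc hi).1
  · intro x h hx
    obtain ⟨i, hi⟩ := htag hx
    exact (hloc hi).2
  · intro x h hx
    obtain ⟨i, hi⟩ := htag hx
    rw [hswap hi]
    simp only [tag, hpos _ (hflip (hmem' hi)), Option.map_some]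
  · intro x h h' k hx hk hkq hx' hne
    obtain ⟨i, hi⟩ := htag hx
    obtain ⟨i', hi'⟩ := htag hx'
    rw [hrotk] at hi'
    have hpow : 0 < 2 ^ cl h.1 := by positivity
    rcases eq_or_eq_flip hne with rfl | rfl
    · have h1 := huniq _ _ _ hi (hpos _ (hmem' hi))
      have h2 := huniq _ _ _ hi' (hpos _ (hmem' hi'))
      rw [hrun _ _ (hmem' hi)] at h1
      rw [hrun _ _ (hmem' hi'), h1] at h2
      have hlt := ((hmem _ _).1 (hmem' hi)).2
      have hlt' := ((hmem _ _).1 (hmem' hi')).2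
      have hle : 2 ^ cl h.1 ≤ k * 2 ^ cl h.1 := Nat.le_mul_of_pos_left _ hk
      have hle' : k * 2 ^ cl h.1 ≤ q * 2 ^ cl h.1 := Nat.mul_le_mul_right _ hkq
      refine hperiod (i + k * 2 ^ cl h.1 - i') hi (by omega) (by rw [add_mul]; omega) ?_
      rw [Nat.cast_sub (by omega), Nat.cast_add]
      linear_combination h2
    · exact hfar _ hi hi' rfl (by gcongr; omega)
  · have : Function.Bijective
        (fun x : {x // (tag x).isSome} => (⟨(f x.1).2.2.get (by simpa [tag] using x.2),
          hmem' (Option.some_get _).symm⟩ : {p // p ∈ tags L})) := by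
      constructor
      · intro x y hxy
        simp only [Subtype.mk.injEq] at hxy
        have hx : (f x.1).2.2.isSome := by simpa [tag] using x.2
        have hy : (f y.1).2.2.isSome := by simpa [tag] using y.2
        refine Subtype.ext (huniq x.1 y.1 _ (Option.some_get hx).symm ?_)
        rw [show (f x.1).2.2.get hx = (f y.1).2.2.get hy from hxy]
        exact (Option.some_get hy).symm
      · intro p
        refine ⟨⟨pos p.1, by simp [tag, hpos _ p.2]⟩, ?_⟩
        simp [hpos _ p.2]
    rw [Nat.card_congr (Equiv.ofBijective _ this), ← List.toFinset_card_of_nodup hnd]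
    exact Nat.subtype_card _ (by simp)

section Tour

variable {D : V → V → ℝ} {u : ℝ} {cl : V × V → ℕ}

/-- The list `Z` of sites may follow any untagged site at `y` with offset `0`. -/
def Entry (D : V → V → ℝ) (u : ℝ) (cl : V × V → ℕ) (y : V) (Z : List (Site V)) : Prop :=
  Z.IsChain (Linked D u cl) ∧ ∀ z ∈ Z.head?, D y z.1 + z.2.1 ≤ u

/-- The untagged site at `y` with offset `0`. -/
def marker (y : V) : Site V := (y, 0, none)

/-- The sites on the way from `x` along an edge of weight at most `N * u`. -/
def way (u : ℝ) (x : V) (N : ℕ) : List (Site V) :=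
  (List.range (N + 1)).map fun k : ℕ => (x, (k : ℝ) * u, none)

/-- The tags at `y`, each with all its indices in order. -/
noncomputable def tagsAt [DecidableEq V] (cl : V × V → ℕ) (S : Finset (V × V)) (y : V) :
    List (((V × V) × Bool) × ℕ) :=
  ((S ×ˢ Finset.univ).filter fun h => src h = y).toList.flatMap fun h =>
    (List.range (2 ^ cl h.1)).map fun i => (h, i)

/-- The tagged sites at `y`. -/
noncomputable def stay [DecidableEq V] (cl : V × V → ℕ) (S : Finset (V × V)) (y : V) :
    List (Site V) :=
  (tagsAt cl S y).map fun p => (y, 0, some p)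

lemma entry_marker (hD : IsPseudoDist D) (hu : 0 ≤ u) {y : V} {Z : List (Site V)}
    (hZ : Entry D u cl y Z) : Entry D u cl y (marker y :: Z) := by
  refine ⟨List.isChain_cons.2 ⟨fun z hz => ⟨?_, by simp [marker]⟩, hZ.1⟩, ?_⟩
  · simpa [marker] using hZ.2 z hz
  · simp [marker, hD.self, hu]

lemma entry_way (hD : IsPseudoDist D) (hu : 0 ≤ u) {x y : V} {N : ℕ} (hxy : D x y ≤ N * u)
    {Z : List (Site V)} (hZ : Entry D u cl y Z) : Entry D u cl x (way u x N ++ Z) := by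
  refine ⟨List.isChain_append.2 ⟨?_, hZ.1, ?_⟩, ?_⟩
  · rw [way, List.isChain_map, List.isChain_range]
    intro k _
    refine ⟨?_, by simp⟩
    simp only [hD.self, Nat.cast_succ]
    linarith
  · intro a ha z hz
    simp only [way, List.range_succ, List.map_append, List.map_cons, List.map_nil,
      List.getLast?_concat, Option.mem_def, Option.some.injEq] at ha
    subst ha
    refine ⟨?_, by simp⟩
    have := hZ.2 z hz
    have := hD.triangle x y z.1
    simp only
    linarith
  · simp [way, List.range_succ_eq_map, hD.self, hu]

lemma entry_stay [DecidableEq V] (hD : IsPseudoDist D) (hu : 0 ≤ u) (S : Finset (V × V)) {y : V}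
    {Z : List (Site V)} (hZ : Entry D u cl y Z) : Entry D u cl y (stay cl S y ++ Z) := by
  rw [stay, tagsAt]
  generalize Finset.toList _ = M
  induction M with
  | nil => simpa using hZ
  | cons h M ih =>
    rw [List.flatMap_cons, List.map_append, List.append_assoc, List.map_map]
    obtain ⟨n, hn⟩ : ∃ n, 2 ^ cl h.1 = n + 1 := ⟨_, (Nat.succ_pred_eq_of_pos (by positivity)).symm⟩
    refine ⟨List.isChain_append.2 ⟨?_, ih.1, ?_⟩, ?_⟩
    · rw [List.isChain_map, List.isChain_range]
      intro k _
      refine ⟨by simp [hD.self, hu], ?_⟩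
      simp only [Function.comp_apply, Option.some.injEq, Prod.mk.injEq]
      rintro _ _ ⟨rfl, rfl⟩ _
      simp
    · intro a ha z hz
      rw [hn] at ha
      simp only [List.range_succ, List.map_append, List.map_cons, List.map_nil,
        List.getLast?_concat, Option.mem_def, Option.some.injEq] at ha
      subst ha
      refine ⟨by simpa using ih.2 z hz, ?_⟩
      simp only [Function.comp_apply, Option.some.injEq, Prod.mk.injEq]
      rintro _ _ ⟨rfl, rfl⟩ hlt
      omega
    · rw [hn]
      simp [List.range_succ_eq_map, hD.self, hu]

lemma mem_tagsAt [DecidableEq V] {S : Finset (V × V)} {y : V} {h : (V × V) × Bool} {i : ℕ} :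
    (h, i) ∈ tagsAt cl S y ↔ (h.1 ∈ S ∧ i < 2 ^ cl h.1) ∧ src h = y := by
  simp only [tagsAt, List.mem_flatMap, Finset.mem_toList, Finset.mem_filter, Finset.mem_product,
    Finset.mem_univ, and_true, List.mem_map, List.mem_range, Prod.mk.injEq]
  constructor
  · rintro ⟨_, ⟨hS, hy⟩, _, hi, rfl, rfl⟩
    exact ⟨⟨hS, hi⟩, hy⟩
  · rintro ⟨⟨hS, hi⟩, hy⟩
    exact ⟨h, ⟨hS, hy⟩, i, hi, rfl, rfl⟩

lemma nodup_tagsAt [DecidableEq V] (S : Finset (V × V)) (y : V) : (tagsAt cl S y).Nodup := by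
  rw [tagsAt, List.nodup_flatMap]
  refine ⟨fun h _ => List.nodup_range.map fun i j hij => (Prod.mk.inj hij).2, ?_⟩
  refine (Finset.nodup_toList _).imp fun {a b} hab => ?_
  rw [Function.onFun, List.disjoint_left]
  rintro p hp hp'
  obtain ⟨i, -, rfl⟩ := List.mem_map.1 hp
  obtain ⟨j, -, hj⟩ := List.mem_map.1 hp'
  exact hab (Prod.mk.inj hj).1.symm

lemma tags_stay [DecidableEq V] (S : Finset (V × V)) (y : V) :
    tags (stay cl S y) = tagsAt cl S y := by
  simp [tags, stay, List.filterMap_map]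

lemma tags_way (x : V) (N : ℕ) : tags (way u x N) = [] := by
  simp [tags, way]

lemma tags_append (L M : List (Site V)) : tags (L ++ M) = tags L ++ tags M :=
  List.filterMap_append

lemma tags_marker_cons (y : V) (L : List (Site V)) : tags (marker y :: L) = tags L := by
  simp [tags, marker]

/-- A tour of the vertices in `s` whose untagged part is short. -/
structure IsTour [DecidableEq V] (D : V → V → ℝ) (u : ℝ) (cl : V × V → ℕ) (S : Finset (V × V))
    (T : SimpleGraph V) (w : Sym2 V → NNReal) (r : V) (s : Finset V) (L : List (Site V))
    (F : Finset (Sym2 V)) : Prop where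
  head : L.head? = some (marker r)
  chain : (L ++ [marker r]).IsChain (Linked D u cl)
  marker_mem : ∀ x ∈ s, marker x ∈ L
  valid : ∀ a ∈ L, a.Valid
  nodup : (tags L).Nodup
  mem_tags : ∀ h i, (h, i) ∈ tags L ↔ (h.1 ∈ S ∧ i < 2 ^ cl h.1) ∧ src h ∈ s
  edges : ∀ e ∈ F, e ∈ T.edgeSet
  within : ∀ e ∈ F, ∀ x ∈ e, x ∈ s
  length_le : (L.length : ℝ) ≤ 6 * s.card + 2 * (∑ e ∈ F, (w e : ℝ)) / u + (tags L).length

lemma valid_marker (y : V) : (marker y).Valid := by simp [marker, Site.Valid]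

lemma valid_of_mem_way (hu : 0 ≤ u) {x : V} {N : ℕ} {a : Site V} (ha : a ∈ way u x N) :
    a.Valid := by
  obtain ⟨k, -, rfl⟩ := List.mem_map.1 ha
  refine ⟨?_, by simp⟩
  simp only
  positivity

lemma valid_of_mem_stay [DecidableEq V] {S : Finset (V × V)} {y : V} {a : Site V}
    (ha : a ∈ stay cl S y) : a.Valid := by
  obtain ⟨⟨h, i⟩, hp, rfl⟩ := List.mem_map.1 ha
  refine ⟨le_rfl, fun h' i' he => ?_⟩
  simp only [Option.some.injEq, Prod.mk.injEq] at he
  rw [← he.1]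
  exact ⟨(mem_tagsAt.1 hp).2.symm, rfl⟩

lemma isTour_singleton [DecidableEq V] (hD : IsPseudoDist D) (hu : 0 < u) (S : Finset (V × V))
    (T : SimpleGraph V) (w : Sym2 V → NNReal) (r : V) :
    IsTour D u cl S T w r {r} (marker r :: stay cl S r) ∅ := by
  have h0 : Entry D u cl r [marker r] := by simp [Entry, marker, hD.self, hu.le]
  have h1 := (entry_marker hD hu.le (entry_stay hD hu.le S h0)).1
  refine ⟨rfl, by simpa using h1, by simp, ?_, ?_, ?_, by simp, by simp, ?_⟩
  · intro a ha
    rcases List.mem_cons.1 ha with rfl | ha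
    · exact valid_marker _
    · exact valid_of_mem_stay ha
  · rw [tags_marker_cons, tags_stay]
    exact nodup_tagsAt S r
  · intro h i
    rw [tags_marker_cons, tags_stay, mem_tagsAt, Finset.mem_singleton]
  · rw [tags_marker_cons, tags_stay]
    simp only [stay, List.length_cons, List.length_map, Finset.card_singleton, Finset.sum_empty]
    push_cast
    norm_num
    linarith

lemma IsTour.insert [DecidableEq V] (hD : IsPseudoDist D) (hu : 0 < u) {S : Finset (V × V)}
    {T : SimpleGraph V} {w : Sym2 V → NNReal} (hw : ∀ a b, T.Adj a b → D a b ≤ w s(a, b)) {r : V}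
    {s : Finset V} {L : List (Site V)} {F : Finset (Sym2 V)} (h : IsTour D u cl S T w r s L F)
    {x y : V} (hx : x ∈ s) (hy : y ∉ s) (hxy : T.Adj x y) :
    ∃ L' F', IsTour D u cl S T w r (insert y s) L' F' := by
  obtain ⟨l₁, l₂, rfl⟩ := List.append_of_mem (h.marker_mem x hx)
  set N := ⌈(w s(x, y) : ℝ) / u⌉₊ with hN
  have hwN : (w s(x, y) : ℝ) ≤ N * u := by
    rw [← div_le_iff₀ hu]; exact Nat.le_ceil _
  have hNw : (N : ℝ) ≤ w s(x, y) / u + 1 := (Nat.ceil_lt_add_one (by positivity)).le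
  set I := way u x N ++ (marker y :: (stay cl S y ++ way u y N)) with hI
  have htags : tags (l₁ ++ marker x :: (I ++ marker x :: l₂)) =
      tags l₁ ++ (tagsAt cl S y ++ tags l₂) := by
    simp only [hI, tags_append, tags_marker_cons, tags_way, tags_stay, List.nil_append,
      List.append_nil]
  have htags₀ : tags (l₁ ++ marker x :: l₂) = tags l₁ ++ tags l₂ := by
    simp only [tags_append, tags_marker_cons]
  have hperm : (tags (l₁ ++ marker x :: (I ++ marker x :: l₂))).Perm
      (tagsAt cl S y ++ tags (l₁ ++ marker x :: l₂)) := by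
    rw [htags, htags₀, ← List.append_assoc, ← List.append_assoc]
    exact List.perm_append_comm.append_right _
  have he : s(x, y) ∉ F := fun he => hy (h.within _ he y (by simp))
  refine ⟨l₁ ++ marker x :: (I ++ marker x :: l₂), Insert.insert s(x, y) F, ?_, ?_, ?_, ?_, ?_, ?_,
    ?_, ?_, ?_⟩
  · have := h.head
    cases l₁ <;> simpa using this
  · have hch := h.chain
    rw [List.append_assoc, List.cons_append, List.isChain_split] at hch ⊢
    refine ⟨hch.1, ?_⟩
    have h0 : Entry D u cl x (marker x :: (l₂ ++ [marker r])) :=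
      ⟨hch.2, by simp [marker, hD.self, hu.le]⟩
    have h1 := entry_way hD hu.le ((hD.symm y x).le.trans ((hw x y hxy).trans hwN)) h0
    have h2 := entry_way hD hu.le ((hw x y hxy).trans hwN)
      (entry_marker hD hu.le (entry_stay hD hu.le S h1))
    have h3 := (entry_marker hD hu.le h2).1
    simpa [hI] using h3
  · intro z hz
    rcases Finset.mem_insert.1 hz with rfl | hz
    · simp [hI]
    · have := h.marker_mem z hz
      simp only [List.mem_append, List.mem_cons] at this ⊢
      tauto
  · intro a ha
    simp only [hI, List.mem_append, List.mem_cons] at ha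
    have hv := h.valid a
    simp only [List.mem_append, List.mem_cons] at hv
    rcases ha with ha | ha | ((ha | ha | ha | ha) | ha | ha)
    · exact hv (Or.inl ha)
    · exact hv (Or.inr (Or.inl ha))
    · exact valid_of_mem_way hu.le ha
    · exact ha ▸ valid_marker y
    · exact valid_of_mem_stay ha
    · exact valid_of_mem_way hu.le ha
    · exact hv (Or.inr (Or.inl ha))
    · exact hv (Or.inr (Or.inr ha))
  · rw [hperm.nodup_iff, List.nodup_append]
    refine ⟨nodup_tagsAt S y, h.nodup, ?_⟩
    rintro ⟨g, i⟩ hp _ hp' rfl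
    exact hy ((mem_tagsAt.1 hp).2 ▸ ((h.mem_tags _ _).1 hp').2)
  · intro g i
    rw [hperm.mem_iff, List.mem_append, mem_tagsAt, h.mem_tags, Finset.mem_insert]
    tauto
  · intro e hF
    rcases Finset.mem_insert.1 hF with rfl | hF
    · exact hxy
    · exact h.edges e hF
  · intro e hF z hz
    rcases Finset.mem_insert.1 hF with rfl | hF
    · rcases Sym2.mem_iff.1 hz with rfl | rfl
      · exact Finset.mem_insert_of_mem hx
      · exact Finset.mem_insert_self _ _
    · exact Finset.mem_insert_of_mem (h.within e hF z hz)
  · have hlen := h.length_le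
    rw [hperm.length_eq, List.length_append]
    rw [Finset.card_insert_of_notMem hy, Finset.sum_insert he, mul_add, add_div]
    simp only [hI, way, stay, List.length_append, List.length_cons, List.length_map,
      List.length_range] at hlen ⊢
    push_cast at hlen ⊢
    have : 2 * (w s(x, y) : ℝ) / u = 2 * (w s(x, y) / u) := by ring
    linarith

/-- Every connected graph has a tour of all its vertices. -/
lemma exists_isTour [Fintype V] [DecidableEq V] (hD : IsPseudoDist D) (hu : 0 < u)
    (S : Finset (V × V)) {T : SimpleGraph V} (hT : T.Connected) {w : Sym2 V → NNReal}
    (hw : ∀ a b, T.Adj a b → D a b ≤ w s(a, b)) (r : V) :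
    ∃ L F, IsTour D u cl S T w r Finset.univ L F := by
  have key : ∀ k, k < Fintype.card V → ∃ s L F, s.card = k + 1 ∧ r ∈ s ∧
      IsTour D u cl S T w r s L F := by
    intro k
    induction k with
    | zero => exact fun _ => ⟨{r}, _, _, by simp, by simp, isTour_singleton hD hu S T w r⟩
    | succ k ih =>
      intro hk
      obtain ⟨s, L, F, hs, hr, h⟩ := ih (by omega)
      obtain ⟨z, hz⟩ : ∃ z, z ∉ s := by
        by_contra! hall
        rw [Finset.eq_univ_iff_forall.2 hall, Finset.card_univ] at hs
        omega
      obtain ⟨p⟩ := hT.preconnected r z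
      obtain ⟨d, -, hd₁, hd₂⟩ := p.exists_boundary_dart (s : Set V) hr hz
      obtain ⟨L', F', h'⟩ := h.insert hD hu hw hd₁ hd₂ d.adj
      exact ⟨_, L', F', by rw [Finset.card_insert_of_notMem hd₂, hs],
        Finset.mem_insert_of_mem hr, h'⟩
  have hpos : 0 < Fintype.card V := Fintype.card_pos_iff.2 ⟨r⟩
  obtain ⟨s, L, F, hs, -, h⟩ := key (Fintype.card V - 1) (by omega)
  have : s = Finset.univ := by
    rw [← Finset.card_eq_iff_eq_univ]; omega
  exact ⟨L, F, this ▸ h⟩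

end Tour

lemma length_tags {cl : V × V → ℕ} {S : Finset (V × V)} {M : List (((V × V) × Bool) × ℕ)}
    (hnd : M.Nodup) (hmem : ∀ h i, (h, i) ∈ M ↔ h.1 ∈ S ∧ i < 2 ^ cl h.1) :
    M.length = ∑ e ∈ S, 2 * 2 ^ cl e := by
  classical
  have : M.toFinset = ((S ×ˢ Finset.univ).sigma fun h => Finset.range (2 ^ cl h.1)).map
      (Equiv.sigmaEquivProd _ _).toEmbedding := by
    ext ⟨h, i⟩
    simp [hmem]
  rw [← List.toFinset_card_of_nodup hnd, this, Finset.card_map, Finset.card_sigma,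
    Finset.sum_product]
  simp

section Lightness

variable [Fintype V] {D : V → V → ℝ} {c : V × V → ℝ} {T : SimpleGraph V} {w : Sym2 V → NNReal}
  {S : Finset (V × V)} {q : ℕ} {t : ℝ}

lemma IsSparse.sum_le_of_heavy (hD : IsPseudoDist D) (hT : T.Connected)
    (hw : ∀ a b, T.Adj a b → D a b ≤ w s(a, b)) (hW : 0 < totalWeight T w)
    (hDW : ∀ a b, D a b ≤ totalWeight T w) (hn : 16 ≤ Fintype.card V)
    (hq : 10 * Real.logb 2 (Fintype.card V) ≤ q) (ht : 12 * q + 2 ≤ t) (hS : IsSparse D c t S)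
    (hc : ∀ e ∈ S, totalWeight T w / Fintype.card V ^ 2 ≤ c e) :
    ∑ e ∈ S, c e ≤ 3 * totalWeight T w := by
  classical
  set W := totalWeight T w with hWdef
  set n : ℝ := (Fintype.card V : ℝ) with hndef
  have hn' : 16 ≤ n := by rw [hndef]; exact_mod_cast hn
  set u := W / n ^ 2 with hu_def
  have hu : 0 < u := by positivity
  have hWu : W = u * n ^ 2 := by rw [hu_def]; field_simp
  have hq1 : (0 : ℝ) < q := by
    have : 0 < Real.logb 2 n := Real.logb_pos (by norm_num) (by linarith)
    linarith
  let cl : V × V → ℕ := fun e => Nat.log 2 ⌊c e / u⌋₊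
  have hone : ∀ e ∈ S, 1 ≤ c e / u := fun e he => (one_le_div hu).2 (hc e he)
  have hcl' : ∀ e ∈ S, 2 ^ cl e * u ≤ c e := by
    intro e he
    rw [← le_div_iff₀ hu]
    have h1 : 2 ^ cl e ≤ ⌊c e / u⌋₊ :=
      Nat.pow_log_le_self 2 (Nat.floor_pos.2 (hone e he)).ne'
    calc (2 : ℝ) ^ cl e ≤ (⌊c e / u⌋₊ : ℝ) := by exact_mod_cast h1
      _ ≤ _ := Nat.floor_le (by linarith [hone e he])
  have hcl : ∀ e ∈ S, c e < 2 * (2 ^ cl e * u) := by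
    intro e he
    have h1 : ⌊c e / u⌋₊ + 1 ≤ 2 ^ (cl e + 1) := Nat.lt_pow_succ_log_self (by norm_num) _
    have h2 : c e / u < 2 ^ (cl e + 1) :=
      (Nat.lt_floor_add_one _).trans_le (by exact_mod_cast h1)
    rw [div_lt_iff₀ hu] at h2
    rw [pow_succ] at h2
    linarith
  have hV : 0 < Fintype.card V := by omega
  obtain ⟨r₀⟩ : Nonempty V := Fintype.card_pos_iff.1 hV
  obtain ⟨L, F, hL⟩ := exists_isTour (cl := cl) hD hu S hT hw r₀
  have hne : NeZero L.length := ⟨fun h => by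
    have := hL.head
    rw [List.length_eq_zero_iff.1 h] at this
    simp at this⟩
  have hmem : ∀ h i, (h, i) ∈ tags L ↔ h.1 ∈ S ∧ i < 2 ^ cl h.1 := by
    intro h i
    rw [hL.mem_tags, and_iff_left (Finset.mem_univ _)]
  obtain ⟨r, hr⟩ := exists_rotation_of_tour (q := q) hD hcl' hu hS (by linarith) hL.head hL.chain
    hL.valid hL.nodup hmem
  have hent := r.mul_card_tag_le hD hcl hcl' hu hS ht
  rw [hr, ZMod.card] at hent
  have hlen := hL.length_le
  have hN : ((tags L).length : ℝ) = ∑ e ∈ S, 2 * 2 ^ cl e := by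
    rw [length_tags hL.nodup hmem]; push_cast; rfl
  set N : ℝ := ((tags L).length : ℝ) with hNdef
  set m : ℝ := (L.length : ℝ) with hmdef
  have hN0 : 0 ≤ N := by positivity
  have hm0 : 0 < m := by
    rw [hmdef]; exact_mod_cast Nat.pos_of_ne_zero hne.out
  have hF : ∑ e ∈ F, (w e : ℝ) ≤ W :=
    Finset.sum_le_sum_of_subset_of_nonneg (fun e he => by simpa using hL.edges e he)
      fun _ _ _ => NNReal.coe_nonneg _
  have hmle : m ≤ 6 * n + 2 * n ^ 2 + N := by
    have h1 : 2 * (∑ e ∈ F, (w e : ℝ)) / u ≤ 2 * n ^ 2 := by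
      rw [div_le_iff₀ hu]; nlinarith
    rw [Finset.card_univ] at hlen
    linarith
  have hcrude : N ≤ 2 * n ^ 4 := by
    rw [hN]
    calc ∑ e ∈ S, (2 : ℝ) * 2 ^ cl e ≤ ∑ e ∈ S, 2 * n ^ 2 := by
          refine Finset.sum_le_sum fun e he => ?_
          have h1 := hS.lt_dist hD (h := (e, true)) he
          have h2 := hDW (src (e, true)) (tgt (e, true))
          have h3 := hcl' e he
          have h4 := hc e he
          have h5 : c e ≤ t * c e := le_mul_of_one_le_left (by linarith) (by linarith)
          have h6 : (2 : ℝ) ^ cl e * u ≤ n ^ 2 * u := by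
            simp only at h1
            linarith
          linarith [le_of_mul_le_mul_right h6 hu]
      _ = S.card * (2 * n ^ 2) := by simp
      _ ≤ n ^ 2 * (2 * n ^ 2) := by
          gcongr
          have := S.card_le_univ
          rw [Fintype.card_prod] at this
          rw [hndef, sq]
          exact_mod_cast this
      _ = _ := by ring
  have hm5 : m ≤ n ^ 5 := by
    have h2 : 16 * n ≤ n ^ 2 := by nlinarith
    have h4 : 16 * n ^ 2 ≤ n ^ 4 := by nlinarith [sq_nonneg n]
    have h5 : 16 * n ^ 4 ≤ n ^ 5 := by nlinarith [pow_pos (show 0 < n by linarith) 4]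
    linarith
  have hlog : Real.logb 2 m ≤ q / 2 := by
    have h1 : Real.logb 2 m ≤ Real.logb 2 (n ^ 5) :=
      Real.logb_le_logb_of_le (by norm_num) hm0 hm5
    rw [Real.logb_pow] at h1
    push_cast at h1
    linarith
  have hNm : N ≤ m / 2 := by
    have : q * N ≤ q * (m / 2) := by
      calc q * N ≤ m * Real.logb 2 m := hent
        _ ≤ m * (q / 2) := by gcongr
        _ = _ := by ring
    exact le_of_mul_le_mul_left this hq1
  have hN3 : N ≤ 3 * n ^ 2 := by nlinarith
  calc ∑ e ∈ S, c e ≤ ∑ e ∈ S, 2 * 2 ^ cl e * u :=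
        Finset.sum_le_sum fun e he => by linarith [hcl e he]
    _ = N * u := by rw [hN, Finset.sum_mul]
    _ ≤ 3 * n ^ 2 * u := by gcongr
    _ = 3 * W := by rw [hWu]; ring

/-- A sparse set of sufficiently large stretch is light. -/
lemma IsSparse.sum_le (hD : IsPseudoDist D) (hT : T.Connected)
    (hw : ∀ a b, T.Adj a b → D a b ≤ w s(a, b)) (hW : 0 < totalWeight T w)
    (hDW : ∀ a b, D a b ≤ totalWeight T w) (hn : 16 ≤ Fintype.card V)
    (hq : 10 * Real.logb 2 (Fintype.card V) ≤ q) (ht : 12 * q + 2 ≤ t) (hS : IsSparse D c t S) :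
    ∑ e ∈ S, c e ≤ 4 * totalWeight T w := by
  classical
  set u := totalWeight T w / (Fintype.card V : ℝ) ^ 2 with hu_def
  have hV : (0 : ℝ) < Fintype.card V := by exact_mod_cast (show 0 < Fintype.card V by omega)
  have hu : 0 < u := by positivity
  have hheavy := (hS.mono (Finset.filter_subset (fun e => u ≤ c e) S)).sum_le_of_heavy hD hT hw hW
    hDW hn hq ht fun e he => (Finset.mem_filter.1 he).2
  have hlight : ∑ e ∈ S with ¬ u ≤ c e, c e ≤ totalWeight T w := by
    have hcard : ((S.filter fun e => ¬ u ≤ c e).card : ℝ) ≤ (Fintype.card V : ℝ) ^ 2 := by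
      have := (S.filter fun e => ¬ u ≤ c e).card_le_univ
      rw [Fintype.card_prod] at this
      rw [sq]
      exact_mod_cast this
    calc ∑ e ∈ S with ¬ u ≤ c e, c e ≤ ∑ e ∈ S with ¬ u ≤ c e, u :=
          Finset.sum_le_sum fun e he => (not_le.1 (Finset.mem_filter.1 he).2).le
      _ = (S.filter fun e => ¬ u ≤ c e).card * u := by simp
      _ ≤ (Fintype.card V : ℝ) ^ 2 * u := by gcongr
      _ = _ := by rw [hu_def]; field_simp
  rw [← Finset.sum_filter_add_sum_filter_not S fun e => u ≤ c e]
  linarith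

end Lightness

section Weighted

variable {G H T : SimpleGraph V} {w : Sym2 V → NNReal}

lemma wdist_self (G : SimpleGraph V) (w : Sym2 V → NNReal) (u : V) : wdist G w u u = 0 :=
  nonpos_iff_eq_zero.1 <| iInf_le_of_le Walk.nil (by simp [walkWeight])

lemma wdist_comm_le (G : SimpleGraph V) (w : Sym2 V → NNReal) (u v : V) :
    wdist G w u v ≤ wdist G w v u :=
  le_iInf fun p => iInf_le_of_le p.reverse (by simp [walkWeight, List.sum_reverse])

lemma wdist_comm (G : SimpleGraph V) (w : Sym2 V → NNReal) (u v : V) :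
    wdist G w u v = wdist G w v u :=
  (wdist_comm_le G w u v).antisymm (wdist_comm_le G w v u)

lemma wdist_triangle (G : SimpleGraph V) (w : Sym2 V → NNReal) (u v x : V) :
    wdist G w u x ≤ wdist G w u v + wdist G w v x := by
  simp only [wdist, ENNReal.iInf_add, ENNReal.add_iInf]
  exact le_iInf fun p => le_iInf fun p' => iInf_le_of_le (p'.append p) (by simp [walkWeight])

lemma wdist_le_of_adj {a b : V} (h : G.Adj a b) : wdist G w a b ≤ w s(a, b) :=
  iInf_le_of_le h.toWalk (by simp [walkWeight])

lemma wdist_anti (h : G ≤ H) (u v : V) : wdist H w u v ≤ wdist G w u v :=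
  le_iInf fun p => iInf_le_of_le (p.mapLe h) (by simp [walkWeight])

lemma walkWeight_ne_top {u v : V} (p : G.Walk u v) : walkWeight w p ≠ ⊤ := by
  induction p with
  | nil => simp [walkWeight]
  | cons h p ih => simpa [walkWeight] using ih

lemma wdist_ne_top (h : G.Connected) (u v : V) : wdist G w u v ≠ ⊤ := by
  obtain ⟨p⟩ := h.preconnected u v
  exact ((iInf_le _ p).trans_lt (walkWeight_ne_top p).lt_top).ne

lemma isPseudoDist_toReal_wdist (h : G.Connected) (w : Sym2 V → NNReal) :
    IsPseudoDist fun u v => (wdist G w u v).toReal where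
  self u := by simp [wdist_self]
  symm u v := by rw [wdist_comm]
  triangle u v x := by
    rw [← ENNReal.toReal_add (wdist_ne_top h _ _) (wdist_ne_top h _ _)]
    exact ENNReal.toReal_mono (ENNReal.add_ne_top.2 ⟨wdist_ne_top h _ _, wdist_ne_top h _ _⟩)
      (wdist_triangle G w u v x)

lemma wdist_le_totalWeight [Fintype V] (h : G.Connected) (w : Sym2 V → NNReal) (u v : V) :
    wdist G w u v ≤ ENNReal.ofReal (totalWeight G w) := by
  classical
  obtain ⟨p, hp⟩ := h.exists_isPath u v
  refine iInf_le_of_le p ?_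
  rw [walkWeight, ← List.sum_toFinset _ hp.isTrail.edges_nodup, totalWeight,
    ENNReal.ofReal_sum_of_nonneg fun _ _ => NNReal.coe_nonneg _]
  simp only [ENNReal.ofReal_coe_nnreal]
  refine Finset.sum_le_sum_of_subset fun e he => ?_
  simpa using p.edges_subset_edgeSet (List.mem_toFinset.1 he)

lemma wdist_le_mul_of_adj {K : ENNReal} (hK : K ≠ ⊤)
    (h : ∀ a b, G.Adj a b → wdist H w a b ≤ K * w s(a, b)) (hG : G.Connected) (u v : V) :
    wdist H w u v ≤ K * wdist G w u v := by
  have hwalk : ∀ {a b : V} (p : G.Walk a b), wdist H w a b ≤ K * walkWeight w p := by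
    intro a b p
    induction p with
    | nil => simp [wdist_self]
    | cons hab p ih =>
      refine (wdist_triangle H w _ _ _).trans ((add_le_add (h _ _ hab) ih).trans_eq ?_)
      simp [walkWeight, mul_add]
  rw [wdist.eq_def G, ENNReal.mul_iInf' (by simp [hK]) fun _ => hG.preconnected u v]
  exact le_iInf hwalk

lemma wdist_le_routeLen (hT : T.Connected) (hTH : T ≤ H) {l : List ((V × V) × Bool)}
    (hl : ∀ h ∈ l, H.Adj h.1.1 h.1.2) (u v : V) :
    wdist H w u v ≤ ENNReal.ofReal
      (routeLen (fun a b => (wdist T w a b).toReal) (fun e => w s(e.1, e.2)) u l v) := by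
  have hD := isPseudoDist_toReal_wdist hT w
  have hle : ∀ a b, wdist H w a b ≤ ENNReal.ofReal (wdist T w a b).toReal := fun a b => by
    rw [ENNReal.ofReal_toReal (wdist_ne_top hT a b)]
    exact wdist_anti hTH a b
  induction l generalizing u with
  | nil => exact hle u v
  | cons h l ih =>
    have hadj : wdist H w (src h) (tgt h) ≤ w s(h.1.1, h.1.2) := by
      have := hl h (by simp)
      rcases h with ⟨e, _ | _⟩
      · exact (wdist_comm H w _ _).trans_le (wdist_le_of_adj this)
      · exact wdist_le_of_adj this
    have hnn := routeLen_nonneg (c := fun e => (w s(e.1, e.2) : ℝ)) hD (tgt h) l v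
      fun _ _ => NNReal.coe_nonneg _
    simp only [routeLen]
    rw [ENNReal.ofReal_add (add_nonneg (hD.nonneg _ _) (NNReal.coe_nonneg _)) hnn,
      ENNReal.ofReal_add (hD.nonneg _ _) (NNReal.coe_nonneg _), ENNReal.ofReal_coe_nnreal]
    exact (wdist_triangle H w _ (tgt h) _).trans (add_le_add ((wdist_triangle H w _ (src h) _).trans
      (add_le_add (hle _ _) hadj)) (ih (fun h' hh => hl h' (by simp [hh])) _))

lemma totalWeight_pos [Fintype V] [Nontrivial V] (hT : T.Connected)
    (hw : ∀ e ∈ T.edgeSet, 0 < w e) : 0 < totalWeight T w := by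
  obtain ⟨a⟩ := hT.nonempty
  obtain ⟨b, hab⟩ := hT.preconnected.exists_adj_of_nontrivial a
  refine Finset.sum_pos (fun e he => by simpa using hw e (by simpa using he)) ⟨s(a, b), ?_⟩
  simpa using hab

lemma exists_isTree_totalWeight_eq [Fintype V] (hG : G.Connected) (w : Sym2 V → NNReal) :
    ∃ T ≤ G, T.IsTree ∧ totalWeight T w = mstWeight G w := by
  have hfin : {x | ∃ T : SimpleGraph V, T ≤ G ∧ T.IsTree ∧ x = totalWeight T w}.Finite :=
    (Set.finite_range fun T : SimpleGraph V => totalWeight T w).subset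
      fun x ⟨T, _, _, h⟩ => ⟨T, h.symm⟩
  obtain ⟨T, hTG, hT⟩ := hG.exists_isTree_le
  have hne : {x | ∃ T : SimpleGraph V, T ≤ G ∧ T.IsTree ∧ x = totalWeight T w}.Nonempty :=
    ⟨totalWeight T w, T, hTG, hT, rfl⟩
  obtain ⟨T', hTG', hT', h⟩ := hne.csInf_mem hfin
  exact ⟨T', hTG', hT', h.symm⟩

/-- The graph `T` together with the pairs in `S`. -/
def addPairs (T : SimpleGraph V) (S : Finset (V × V)) : SimpleGraph V :=
  T ⊔ SimpleGraph.fromEdgeSet {e | ∃ p ∈ S, s(p.1, p.2) = e}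

lemma totalWeight_addPairs_le [Fintype V] (T : SimpleGraph V) (w : Sym2 V → NNReal)
    (S : Finset (V × V)) :
    totalWeight (addPairs T S) w ≤ totalWeight T w + ∑ e ∈ S, (w s(e.1, e.2) : ℝ) := by
  classical
  calc totalWeight (addPairs T S) w
      ≤ ∑ e ∈ T.edgeSet.toFinite.toFinset ∪ S.image fun p => s(p.1, p.2), (w e : ℝ) := by
        refine Finset.sum_le_sum_of_subset_of_nonneg (fun e he => ?_)
          fun _ _ _ => NNReal.coe_nonneg _
        simp only [addPairs, Set.Finite.mem_toFinset, SimpleGraph.edgeSet_sup, Set.mem_union,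
          SimpleGraph.edgeSet_fromEdgeSet, Set.mem_sdiff, Set.mem_ofPred_eq] at he
        simp only [Finset.mem_union, Set.Finite.mem_toFinset, Finset.mem_image]
        exact he.imp id And.left
    _ ≤ totalWeight T w + ∑ e ∈ S.image fun p => s(p.1, p.2), (w e : ℝ) := by
        rw [totalWeight, ← Finset.sum_union_inter]
        exact le_add_of_nonneg_right (Finset.sum_nonneg fun _ _ => NNReal.coe_nonneg _)
    _ ≤ _ := by
        gcongr
        exact Finset.sum_image_le_of_nonneg fun _ _ => NNReal.coe_nonneg _

/-- Every connected graph has a subgraph of constant lightness whose stretch is of the order of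
the logarithm of the number of vertices. -/
lemma exists_light_spanner [Fintype V] (hG : G.Connected) (hw : ∀ e ∈ G.edgeSet, 0 < w e)
    (hn : 16 ≤ Fintype.card V) {q : ℕ} (hq : 10 * Real.logb 2 (Fintype.card V) ≤ q) {t : ℝ}
    (ht : 12 * q + 2 ≤ t) :
    ∃ H ≤ G, IsTSpanner G H w t ∧ totalWeight H w ≤ 5 * mstWeight G w := by
  classical
  obtain ⟨T, hTG, hT, hTw⟩ := exists_isTree_totalWeight_eq hG w
  have hTc := hT.connected
  have : Nontrivial V := Fintype.one_lt_card_iff_nontrivial.1 (by omega)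
  have hW := totalWeight_pos hTc fun e he => hw e (SimpleGraph.edgeSet_mono hTG he)
  obtain ⟨S, hSP, hS, hspan⟩ := exists_isSparse_spanning (fun a b => (wdist T w a b).toReal)
    (fun e => (w s(e.1, e.2) : ℝ)) t (Finset.univ.filter fun p => G.Adj p.1 p.2)
  have hSG : ∀ p ∈ S, G.Adj p.1 p.2 := fun p hp => (Finset.mem_filter.1 (hSP hp)).2
  have hSH : ∀ p ∈ S, (addPairs T S).Adj p.1 p.2 := fun p hp =>
    Or.inr ((SimpleGraph.fromEdgeSet_adj _).2 ⟨⟨p, hp, rfl⟩, (hSG p hp).ne⟩)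
  have hTH : T ≤ addPairs T S := le_sup_left
  have hsum := hS.sum_le (isPseudoDist_toReal_wdist hTc w) hTc
    (fun a b hab => by simpa using ENNReal.toReal_mono (by simp) (wdist_le_of_adj (w := w) hab)) hW
    (fun a b => ENNReal.toReal_le_of_le_ofReal hW.le (wdist_le_totalWeight hTc w a b)) hn hq ht
  have ht1 : 1 ≤ t := by
    have : (0 : ℝ) ≤ q := q.cast_nonneg
    linarith
  refine ⟨addPairs T S, sup_le hTG ?_, fun u v => ?_, ?_⟩
  · rintro a b hab
    obtain ⟨⟨p, hp, he⟩, -⟩ := (SimpleGraph.fromEdgeSet_adj _).1 hab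
    have := hSG p hp
    rwa [← SimpleGraph.mem_edgeSet, he, SimpleGraph.mem_edgeSet] at this
  · refine wdist_le_mul_of_adj ENNReal.ofReal_ne_top (fun a b hab => ?_) hG u v
    rcases hspan (a, b) (by simpa using hab) with hab | ⟨l, hl, hle⟩
    · refine (wdist_le_of_adj (hSH _ hab)).trans (le_mul_of_one_le_left' ?_)
      simpa using ht1
    · rw [wdist_comm]
      refine (wdist_le_routeLen hTc hTH (fun h hh => hSH _ (hl h hh)) b a).trans ?_
      rw [← ENNReal.ofReal_coe_nnreal, ← ENNReal.ofReal_mul (by linarith)]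
      exact ENNReal.ofReal_le_ofReal hle
  · have := totalWeight_addPairs_le T w S
    linarith

lemma IsTSpanner.mono {t t' : ℝ} (h : IsTSpanner G H w t) (ht : t ≤ t') : IsTSpanner G H w t' :=
  fun u v => (h u v).trans (by gcongr)

end Weighted

end LightSpanner

/-- There is a universal constant `C > 0` such that every connected weighted graph `G` on
`n ≥ 16` vertices admits a subgraph `H` that is a `(C·(log n)²/log log n)`-spanner of `G`
with `w(H) ≤ C · w(MST(G))`. -/
theorem spanner_log_sq_stretch_constant_lightness :
    ∃ C : ℝ, 0 < C ∧
      ∀ (V : Type) [Fintype V] (G : SimpleGraph V) (w : Sym2 V → NNReal),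
        16 ≤ Fintype.card V → G.Connected → (∀ e ∈ G.edgeSet, 0 < w e) →
        ∃ H : SimpleGraph V, H ≤ G ∧
          IsTSpanner G H w
            (C * (Real.logb 2 (Fintype.card V)) ^ 2 /
              Real.logb 2 (Real.logb 2 (Fintype.card V))) ∧
          totalWeight H w ≤ C * mstWeight G w := by
  refine ⟨300, by norm_num, fun V _ G w hn hG hw => ?_⟩
  set ℓ := Real.logb 2 (Fintype.card V) with hℓ
  have hℓ4 : 4 ≤ ℓ := by
    rw [hℓ, Real.le_logb_iff_rpow_le (by norm_num) (by positivity)]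
    norm_num
    exact_mod_cast hn
  have hq : 10 * ℓ ≤ ⌈10 * ℓ⌉₊ := Nat.le_ceil _
  have hq' : (⌈10 * ℓ⌉₊ : ℝ) < 10 * ℓ + 1 := Nat.ceil_lt_add_one (by linarith)
  obtain ⟨H, hHG, hH, hHw⟩ := LightSpanner.exists_light_spanner hG hw hn hq le_rfl
  have hm : 0 ≤ mstWeight G w := Real.sInf_nonneg <| by
    rintro _ ⟨T, -, -, rfl⟩
    exact Finset.sum_nonneg fun _ _ => NNReal.coe_nonneg _
  refine ⟨H, hHG, LightSpanner.IsTSpanner.mono hH ?_, by linarith⟩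
  have hlog : 0 < Real.logb 2 ℓ := Real.logb_pos (by norm_num) (by linarith)
  have hlog' : Real.logb 2 ℓ ≤ 2 * ℓ := by
    rw [Real.logb, div_le_iff₀ (by positivity)]
    have := Real.log_two_gt_d9
    have := Real.log_le_sub_one_of_pos (show 0 < ℓ by linarith)
    nlinarith
  rw [le_div_iff₀ hlog]
  nlinarith
end

section
/- There exists a universal constant C > 0 such that every connected weighted graph G on n ≥ 2^{16} vertices admits a subgraph H that is a (C·log n / log log log n)-spanner of G and satisfies w(H) ≤ C · (log n / log log log n) · w(MST(G)); that is, both the stretch and the lightness of H are bounded by C·log n / log log log n. -/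
open SimpleGraph

theorem walkWeight_append {V : Type} {G : SimpleGraph V} (w : Sym2 V → NNReal)
    {u v x : V} (p : G.Walk u v) (q : G.Walk v x) :
    walkWeight w (p.append q) = walkWeight w p + walkWeight w q := by
  simp [walkWeight, Walk.edges_append]

theorem wdist_self {V : Type} (G : SimpleGraph V) (w : Sym2 V → NNReal) (u : V) :
    wdist G w u u = 0 := by
  refine le_antisymm (iInf_le_of_le (Walk.nil : G.Walk u u) ?_) bot_le
  simp [walkWeight]

theorem wdist_comm {V : Type} (G : SimpleGraph V) (w : Sym2 V → NNReal) (u v : V) :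
    wdist G w u v = wdist G w v u := by
  have key : ∀ a b : V, wdist G w a b ≤ wdist G w b a := fun a b => by
    refine le_iInf fun p => iInf_le_of_le p.reverse ?_
    simp [walkWeight, Walk.edges_reverse, List.sum_reverse]
  exact le_antisymm (key u v) (key v u)

theorem wdist_triangle {V : Type} (G : SimpleGraph V) (w : Sym2 V → NNReal) (u x v : V) :
    wdist G w u v ≤ wdist G w u x + wdist G w x v := by
  unfold wdist
  rw [ENNReal.iInf_add]
  refine le_iInf fun p => ?_
  rw [ENNReal.add_iInf]
  refine le_iInf fun q => iInf_le_of_le (p.append q) ?_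
  rw [walkWeight_append]

theorem wdist_anti {V : Type} {G H : SimpleGraph V} (h : G ≤ H) (w : Sym2 V → NNReal)
    (u v : V) : wdist H w u v ≤ wdist G w u v := by
  refine le_iInf fun p => iInf_le_of_le (p.mapLe h) ?_
  simp [walkWeight]

theorem wdist_le_of_adj {V : Type} {G : SimpleGraph V} (w : Sym2 V → NNReal) {u v : V}
    (h : G.Adj u v) : wdist G w u v ≤ w s(u, v) :=
  iInf_le_of_le h.toWalk (by simp [walkWeight])

/-- Distance bounds by real numbers add up along concatenations. -/
theorem wdist_trans_le {V : Type} {G : SimpleGraph V} {w : Sym2 V → NNReal} {u x v : V}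
    {a b c : ℝ} (ha : 0 ≤ a) (hb : 0 ≤ b) (hux : wdist G w u x ≤ ENNReal.ofReal a)
    (hxv : wdist G w x v ≤ ENNReal.ofReal b) (hc : a + b ≤ c) :
    wdist G w u v ≤ ENNReal.ofReal c :=
  (wdist_triangle G w u x v).trans <| (add_le_add hux hxv).trans <| by
    rw [← ENNReal.ofReal_add ha hb]
    exact ENNReal.ofReal_le_ofReal hc

/-- A subgraph is a spanner as soon as it approximates the edges of the ambient graph. -/
theorem isTSpanner_of_edges {V : Type} {G H : SimpleGraph V} {w : Sym2 V → NNReal} {t : ℝ}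
    (ht : 0 < t)
    (h : ∀ u v, G.Adj u v → wdist H w u v ≤ ENNReal.ofReal (t * w s(u, v))) :
    IsTSpanner G H w t := by
  have hw : ∀ {u v : V} (p : G.Walk u v),
      wdist H w u v ≤ ENNReal.ofReal t * walkWeight w p := by
    intro u v p
    induction p with
    | nil => simp [wdist_self]
    | @cons a b c hab p ih =>
      refine (wdist_triangle H w a b c).trans ((add_le_add (h a b hab) ih).trans ?_)
      rw [ENNReal.ofReal_mul ht.le]
      simp [walkWeight, mul_add]
  intro u v
  unfold wdist
  rw [ENNReal.mul_iInf_of_ne (by simpa using ht) ENNReal.ofReal_ne_top]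
  exact le_iInf fun p => hw p

open Classical in
/-- A connected weighted graph embeds into a real interval of length twice its weight without
shrinking any distance. -/
theorem exists_line_embedding {V : Type} [Fintype V] {T : SimpleGraph V} (hT : T.Connected)
    (w : Sym2 V → NNReal) :
    ∃ p : V → ℝ, (∀ v, 0 ≤ p v ∧ p v ≤ 2 * totalWeight T w) ∧
      ∀ u v, wdist T w u v ≤ ENNReal.ofReal |p u - p v| := by
  have grow : ∀ m, 1 ≤ m → m ≤ Fintype.card V → ∃ (S : Finset V) (E : Finset (Sym2 V))
      (p : V → ℝ), S.card = m ∧ (E : Set (Sym2 V)) ⊆ T.edgeSet ∧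
      (∀ e ∈ E, ∀ x ∈ e, x ∈ S) ∧
      (∀ v ∈ S, 0 ≤ p v ∧ p v ≤ 2 * ∑ e ∈ E, (w e : ℝ)) ∧
      ∀ u ∈ S, ∀ v ∈ S, wdist T w u v ≤ ENNReal.ofReal |p u - p v| := by
    intro m hm
    induction m, hm using Nat.le_induction with
    | base =>
      intro _
      obtain ⟨v⟩ := hT.nonempty
      exact ⟨{v}, ∅, fun _ => 0, by simp, by simp, by simp, by simp,
        by simp [wdist_self]⟩
    | succ m hm ih =>
      intro hcard
      obtain ⟨S, E, p, hS, hET, hES, hp, hd⟩ := ih (by omega)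
      obtain ⟨a, ha⟩ : S.Nonempty := Finset.card_pos.1 (by omega)
      obtain ⟨b, hb⟩ : ∃ b, b ∉ S := by
        by_contra! hall
        have : S = Finset.univ := Finset.eq_univ_iff_forall.2 hall
        rw [this, Finset.card_univ] at hS
        omega
      obtain ⟨P⟩ := hT.preconnected a b
      obtain ⟨d, -, hd1, hd2⟩ := P.exists_boundary_dart (S : Set V) ha hb
      obtain ⟨⟨u, x⟩, hux⟩ := d
      simp only [Finset.mem_coe] at hd1 hd2 hux
      set ω : ℝ := (w s(u, x) : ℝ) with hω
      have hω0 : 0 ≤ ω := (w s(u, x)).coe_nonneg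
      have hnot : s(u, x) ∉ E := fun h => hd2 (hES _ h x (by simp))
      have hedge : wdist T w x u ≤ ENNReal.ofReal ω := by
        rw [wdist_comm]
        simpa [hω] using wdist_le_of_adj w hux
      let p' : V → ℝ := fun v =>
        if v = x then p u + ω else if p v ≤ p u then p v else p v + 2 * ω
      have hpx : p' x = p u + ω := by simp [p']
      have hpv : ∀ v ∈ S, p' v = if p v ≤ p u then p v else p v + 2 * ω := by
        intro v hv
        have : v ≠ x := fun h => hd2 (h ▸ hv)
        simp [p', this]
      have hx : ∀ v ∈ S, wdist T w x v ≤ ENNReal.ofReal |p' x - p' v| := by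
        intro v hv
        refine wdist_trans_le hω0 (abs_nonneg _) hedge (hd u hd1 v hv) ?_
        rw [hpx, hpv v hv]
        split_ifs with h
        · rw [abs_of_nonneg (by linarith), abs_of_nonneg (by linarith)]
          linarith
        · rw [abs_of_nonpos (by linarith), abs_of_nonpos (by linarith)]
          linarith
      refine ⟨insert x S, insert s(u, x) E, p', ?_, ?_, ?_, ?_, ?_⟩
      · rw [Finset.card_insert_of_notMem hd2, hS]
      · rw [Finset.coe_insert]
        exact Set.insert_subset hux hET
      · intro e he y hy
        rcases Finset.mem_insert.1 he with rfl | he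
        · rcases Sym2.mem_iff.1 hy with rfl | rfl <;> simp [hd1]
        · exact Finset.mem_insert_of_mem (hES e he y hy)
      · intro v hv
        rw [Finset.sum_insert hnot, ← hω]
        have hu := hp u hd1
        rcases Finset.mem_insert.1 hv with rfl | hv
        · rw [hpx]
          constructor <;> linarith
        · rw [hpv v hv]
          have := hp v hv
          split_ifs <;> constructor <;> linarith
      · intro y hy z hz
        rcases Finset.mem_insert.1 hy with rfl | hyS
        · rcases Finset.mem_insert.1 hz with rfl | hzS
          · simp [wdist_self]
          · exact hx z hzS
        · rcases Finset.mem_insert.1 hz with rfl | hzS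
          · rw [wdist_comm, abs_sub_comm]
            exact hx y hyS
          · refine (hd y hyS z hzS).trans (ENNReal.ofReal_le_ofReal ?_)
            rw [hpv y hyS, hpv z hzS]
            split_ifs with h1 h2 h2
            · exact le_rfl
            · rw [abs_of_nonpos (by linarith), abs_of_nonpos (by linarith)]
              linarith
            · rw [abs_of_nonneg (by linarith), abs_of_nonneg (by linarith)]
              linarith
            · exact le_of_eq (by congr 1; ring)
  obtain ⟨v⟩ := hT.nonempty
  obtain ⟨S, E, p, hS, hET, -, hp, hd⟩ :=
    grow (Fintype.card V) (Fintype.card_pos_iff.2 ⟨v⟩) le_rfl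
  have hSu : ∀ v, v ∈ S := by
    rw [← Finset.eq_univ_iff_forall]
    exact Finset.eq_univ_of_card S hS
  have hE : ∑ e ∈ E, (w e : ℝ) ≤ totalWeight T w :=
    Finset.sum_le_sum_of_subset_of_nonneg (fun e he => by simpa using hET he)
      fun e _ _ => (w e).coe_nonneg
  refine ⟨p, fun v => ⟨(hp v (hSu v)).1, (hp v (hSu v)).2.trans (by linarith)⟩,
    fun u v => hd u (hSu u) v (hSu v)⟩

/-- `u` and `v` are joined by at most `m` of the edges in `F`. -/
def Hop {ι : Type*} (F : Finset (Sym2 ι)) (m : ℕ) (u v : ι) : Prop :=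
  ∃ p : (fromEdgeSet (F : Set (Sym2 ι))).Walk u v, p.length ≤ m

theorem Hop.refl {ι : Type*} (F : Finset (Sym2 ι)) (m : ℕ) (u : ι) : Hop F m u u :=
  ⟨Walk.nil, by simp⟩

theorem Hop.symm {ι : Type*} {F : Finset (Sym2 ι)} {m : ℕ} {u v : ι} (h : Hop F m u v) :
    Hop F m v u := by
  obtain ⟨p, hp⟩ := h
  exact ⟨p.reverse, by simpa using hp⟩

theorem Hop.trans {ι : Type*} {F : Finset (Sym2 ι)} {a b : ℕ} {u v x : ι} (h : Hop F a u v)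
    (h' : Hop F b v x) : Hop F (a + b) u x := by
  obtain ⟨p, hp⟩ := h
  obtain ⟨q, hq⟩ := h'
  exact ⟨p.append q, by rw [Walk.length_append]; omega⟩

theorem Hop.mono {ι : Type*} {F F' : Finset (Sym2 ι)} {a b : ℕ} {u v : ι} (h : Hop F a u v)
    (hF : F ⊆ F') (hab : a ≤ b) : Hop F' b u v := by
  obtain ⟨p, hp⟩ := h
  exact ⟨p.mapLe (fromEdgeSet_mono (Finset.coe_subset.2 hF)), by simpa using hp.trans hab⟩

theorem Hop.of_mem {ι : Type*} {F : Finset (Sym2 ι)} {u v : ι} (h : s(u, v) ∈ F)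
    (hne : u ≠ v) : Hop F 1 u v :=
  ⟨Walk.cons ((fromEdgeSet_adj _).2 ⟨h, hne⟩) Walk.nil, by simp⟩

open Classical in
/-- The vertices within `j` hops of `v` in the subgraph of `K` induced on `S`. -/
noncomputable def ballIn {ι : Type*} (K : SimpleGraph ι) (S : Finset ι) (v : ι) :
    ℕ → Finset ι
  | 0 => {v}
  | j + 1 => ballIn K S v j ∪ S.filter (fun u => ∃ x ∈ ballIn K S v j, K.Adj x u)

section Ball

variable {ι : Type*} {K : SimpleGraph ι} {S : Finset ι} {v : ι}

theorem ballIn_subset_succ (j : ℕ) : ballIn K S v j ⊆ ballIn K S v (j + 1) := by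
  classical
  rw [ballIn]
  exact Finset.subset_union_left

theorem ballIn_subset (hv : v ∈ S) (j : ℕ) : ballIn K S v j ⊆ S := by
  classical
  induction j with
  | zero => simpa [ballIn] using hv
  | succ j ih =>
    rw [ballIn]
    exact Finset.union_subset ih (Finset.filter_subset _ _)

theorem mem_ballIn (j : ℕ) : v ∈ ballIn K S v j := by
  induction j with
  | zero => simp [ballIn]
  | succ j ih => exact ballIn_subset_succ j ih

theorem mem_ballIn_succ {j : ℕ} {x u : ι} (hx : x ∈ ballIn K S v j) (hu : u ∈ S)
    (h : K.Adj x u) : u ∈ ballIn K S v (j + 1) := by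
  classical
  rw [ballIn]
  exact Finset.mem_union_right _ (Finset.mem_filter.2 ⟨hu, x, hx, h⟩)

/-- A ball has a spanning tree of small depth. -/
theorem exists_ball_tree (K : SimpleGraph ι) (S : Finset ι) (v : ι) (j : ℕ) :
    ∃ F : Finset (Sym2 ι), (F : Set (Sym2 ι)) ⊆ K.edgeSet ∧
      F.card ≤ (ballIn K S v j).card ∧ ∀ u ∈ ballIn K S v j, Hop F j v u := by
  classical
  induction j with
  | zero =>
    refine ⟨∅, by simp, by simp, fun u hu => ?_⟩
    have : u = v := by simpa [ballIn] using hu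
    exact this ▸ Hop.refl _ _ _
  | succ j ih =>
    obtain ⟨F, hFK, hF, hh⟩ := ih
    have hpar : ∀ u, ∃ x, u ∈ ballIn K S v (j + 1) \ ballIn K S v j →
        x ∈ ballIn K S v j ∧ K.Adj x u := by
      intro u
      by_cases hu : u ∈ ballIn K S v (j + 1) \ ballIn K S v j
      · rw [Finset.mem_sdiff, ballIn, Finset.mem_union] at hu
        obtain ⟨h1 | h1, h2⟩ := hu
        · exact absurd h1 h2
        · obtain ⟨-, x, hx, hxu⟩ := Finset.mem_filter.1 h1
          exact ⟨x, fun _ => ⟨hx, hxu⟩⟩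
      · exact ⟨u, fun h => absurd h hu⟩
    choose f hf using hpar
    refine ⟨F ∪ (ballIn K S v (j + 1) \ ballIn K S v j).image (fun u => s(f u, u)), ?_, ?_, ?_⟩
    · intro e he
      rcases Finset.mem_union.1 (Finset.mem_coe.1 he) with he | he
      · exact hFK he
      · obtain ⟨u, hu, rfl⟩ := Finset.mem_image.1 he
        exact (hf u hu).2
    · refine (Finset.card_union_le _ _).trans ?_
      rw [← Finset.card_sdiff_add_card_eq_card (ballIn_subset_succ (K := K) (S := S) (v := v) j),
        add_comm]
      exact add_le_add Finset.card_image_le hF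
    · intro u hu
      by_cases huj : u ∈ ballIn K S v j
      · exact (hh u huj).mono Finset.subset_union_left (Nat.le_succ j)
      · have hu' := Finset.mem_sdiff.2 ⟨hu, huj⟩
        refine ((hh (f u) (hf u hu').1).mono Finset.subset_union_left le_rfl).trans
          (Hop.of_mem (Finset.mem_union_right _ (Finset.mem_image_of_mem _ hu')) ?_)
        exact (hf u hu').2.ne

/-- Repeated growth by a factor `b` makes balls exponentially large. -/
theorem pow_le_card_ballIn {b i m : ℕ}
    (h : ∀ j, i ≤ j → j < i + m →
      b * (ballIn K S v j).card ≤ (ballIn K S v (j + 1)).card) :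
    b ^ m ≤ (ballIn K S v (i + m)).card := by
  induction m with
  | zero => simpa using Finset.card_pos.2 ⟨v, mem_ballIn (K := K) (S := S) i⟩
  | succ m ih =>
    have h1 := ih fun j hj hj' => h j hj (by omega)
    have h2 := h (i + m) (by omega) (by omega)
    rw [← add_assoc, pow_succ, mul_comm]
    exact (Nat.mul_le_mul_left b h1).trans h2

end Ball

open Classical in
/-- Ball carving. All edges of `K` inside `S` are spanned in few hops by a set `F` of edges, of
which there are at most two per vertex, up to `β` further ones for each vertex of a set `B` that
clusters around very few centers. -/
theorem exists_carving {ι : Type*} [DecidableEq ι] (K : SimpleGraph ι) {ρ β : ℕ} (hρ : 0 < ρ)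
    (S : Finset ι) (hS : S.card ≤ β ^ ρ) :
    ∃ (F : Finset (Sym2 ι)) (B : Finset ι) (c : ι → ι),
      (F : Set (Sym2 ι)) ⊆ K.edgeSet ∧ B ⊆ S ∧
      (∀ u ∈ S, ∀ v ∈ S, K.Adj u v → Hop F (4 * ρ) u v) ∧
      F.card ≤ 2 * S.card + β * B.card ∧
      (∀ u ∈ B, c u ∈ S ∧ Hop F (2 * ρ) u (c u)) ∧
      (B.image c).card * 2 ^ ρ ≤ B.card := by
  induction S using Finset.strongInduction with
  | H S ih =>
  rcases S.eq_empty_or_nonempty with rfl | ⟨v, hv⟩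
  · exact ⟨∅, ∅, id, by simp, by simp, by simp, by simp, by simp, by simp⟩
  have hcarve : ∃ j, j < 2 * ρ ∧ ((ballIn K S v (j + 1)).card ≤ 2 * (ballIn K S v j).card ∨
      (2 ^ ρ ≤ (ballIn K S v j).card ∧
        (ballIn K S v (j + 1)).card ≤ β * (ballIn K S v j).card)) := by
    by_contra! hcon
    have h1 : 2 ^ ρ ≤ (ballIn K S v (0 + ρ)).card :=
      pow_le_card_ballIn fun j _ hj => (hcon j (by omega)).1.le
    rw [zero_add] at h1
    have h2 : ∀ j, ρ ≤ j → j < 2 * ρ →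
        β * (ballIn K S v j).card < (ballIn K S v (j + 1)).card := by
      intro j hj hj'
      refine (hcon j hj').2 (h1.trans (Finset.card_le_card ?_))
      exact monotone_nat_of_le_succ (fun i => ballIn_subset_succ (K := K) (S := S) (v := v) i) hj
    have h3 : β ^ (ρ - 1) ≤ (ballIn K S v (ρ + (ρ - 1))).card :=
      pow_le_card_ballIn fun j hj hj' => (h2 j hj (by omega)).le
    have h4 := h2 (ρ + (ρ - 1)) (by omega) (by omega)
    have h5 := Finset.card_le_card (ballIn_subset (K := K) hv (ρ + (ρ - 1) + 1))
    have h6 : β ^ ρ = β * β ^ (ρ - 1) := by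
      rw [← pow_succ', Nat.sub_add_cancel hρ]
    have h7 := Nat.mul_le_mul_left β h3
    omega
  obtain ⟨j, hj, hgrow⟩ := hcarve
  set Q := ballIn K S v j with hQ
  have hvQ : v ∈ Q := mem_ballIn j
  have hQS : Q ⊆ S := ballIn_subset hv j
  have hlt : S \ Q ⊂ S := Finset.sdiff_ssubset hQS ⟨v, hvQ⟩
  obtain ⟨F', B', c', hFK', hBS', hadj', hF', hc', hcard'⟩ :=
    ih (S \ Q) hlt ((Finset.card_le_card hlt.1).trans hS)
  obtain ⟨F₀, hFK₀, hF₀, hh₀⟩ := exists_ball_tree K S v (j + 1)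
  have hSQ : (S \ Q).card + Q.card = S.card := Finset.card_sdiff_add_card_eq_card hQS
  have hBQ : ∀ u ∈ B', u ∉ Q := fun u hu => (Finset.mem_sdiff.1 (hBS' hu)).2
  have hsub : ((F₀ ∪ F' : Finset (Sym2 ι)) : Set (Sym2 ι)) ⊆ K.edgeSet := by
    rw [Finset.coe_union]
    exact Set.union_subset hFK₀ hFK'
  have hball : ∀ x ∈ Q, ∀ y ∈ S, K.Adj x y → Hop (F₀ ∪ F') (4 * ρ) x y := by
    intro x hx y hy hxy
    exact ((hh₀ x (ballIn_subset_succ j hx)).symm.trans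
      (hh₀ y (mem_ballIn_succ hx hy hxy))).mono Finset.subset_union_left (by omega)
  have hadj : ∀ x ∈ S, ∀ y ∈ S, K.Adj x y → Hop (F₀ ∪ F') (4 * ρ) x y := by
    intro x hx y hy hxy
    by_cases hxQ : x ∈ Q
    · exact hball x hxQ y hy hxy
    by_cases hyQ : y ∈ Q
    · exact (hball y hyQ x hx hxy.symm).symm
    exact (hadj' x (Finset.mem_sdiff.2 ⟨hx, hxQ⟩) y (Finset.mem_sdiff.2 ⟨hy, hyQ⟩) hxy).mono
      Finset.subset_union_right le_rfl
  have hFcard : (F₀ ∪ F').card ≤ (ballIn K S v (j + 1)).card + F'.card :=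
    (Finset.card_union_le _ _).trans (by omega)
  rcases hgrow with hgrow | ⟨hbig, hgrow⟩
  · refine ⟨F₀ ∪ F', B', c', hsub, hBS'.trans hlt.1, hadj, by omega, ?_, hcard'⟩
    exact fun u hu => ⟨(Finset.mem_sdiff.1 (hc' u hu).1).1,
      (hc' u hu).2.mono Finset.subset_union_right le_rfl⟩
  · have hdisj : Disjoint Q B' := Finset.disjoint_left.2 fun u hu hu' => hBQ u hu' hu
    refine ⟨F₀ ∪ F', Q ∪ B', fun u => if u ∈ Q then v else c' u, hsub,
      Finset.union_subset hQS (hBS'.trans hlt.1), hadj, ?_, ?_, ?_⟩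
    · rw [Finset.card_union_of_disjoint hdisj, mul_add]
      omega
    · intro u hu
      by_cases huQ : u ∈ Q
      · simp only [huQ, if_true]
        exact ⟨hv, (hh₀ u (ballIn_subset_succ j huQ)).symm.mono Finset.subset_union_left
          (by omega)⟩
      · have hu' := (Finset.mem_union.1 hu).resolve_left huQ
        simp only [huQ, if_false]
        exact ⟨(Finset.mem_sdiff.1 (hc' u hu').1).1,
          (hc' u hu').2.mono Finset.subset_union_right le_rfl⟩
    · have himg : (Q ∪ B').image (fun u => if u ∈ Q then v else c' u) ⊆
          {v} ∪ B'.image c' := by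
        intro y hy
        obtain ⟨u, hu, rfl⟩ := Finset.mem_image.1 hy
        by_cases huQ : u ∈ Q
        · simp [huQ]
        · simp only [huQ, if_false]
          exact Finset.mem_union_right _
            (Finset.mem_image_of_mem _ ((Finset.mem_union.1 hu).resolve_left huQ))
      have hle : ((Q ∪ B').image (fun u => if u ∈ Q then v else c' u)).card ≤
          1 + (B'.image c').card :=
        (Finset.card_le_card himg).trans ((Finset.card_union_le _ _).trans (by simp))
      rw [Finset.card_union_of_disjoint hdisj]
      calc _ ≤ (1 + (B'.image c').card) * 2 ^ ρ := Nat.mul_le_mul_right _ hle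
        _ = 2 ^ ρ + (B'.image c').card * 2 ^ ρ := by ring
        _ ≤ _ := add_le_add hbig hcard'

open Classical in
/-- Carving applied to the graph of clusters `key ⁻¹' {a}`, which have diameter at most `Δ` in `H`,
with the edges of `G` of weight at most `2 * m`. -/
theorem exists_scale_spanner {V ι : Type} [Fintype V] [Nonempty V] [DecidableEq ι] (G H : SimpleGraph V)
    (w : Sym2 V → NNReal) (key : V → ι) {ρ β : ℕ} (hρ : 0 < ρ)
    (hcard : Fintype.card V ≤ β ^ ρ) {m Δ : ℝ} (hm : 0 ≤ m) (hΔ : 0 ≤ Δ)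
    (hdiam : ∀ u v, key u = key v → wdist H w u v ≤ ENNReal.ofReal Δ) :
    ∃ (E : Finset (Sym2 V)) (B : Finset ι) (c : ι → V),
      (E : Set (Sym2 V)) ⊆ G.edgeSet ∧ B ⊆ Finset.univ.image key ∧
      ∑ e ∈ E, (w e : ℝ) ≤ 2 * m * (2 * (Finset.univ.image key).card + β * B.card) ∧
      (∀ u v, G.Adj u v → (w s(u, v) : ℝ) ≤ 2 * m →
        wdist (H ⊔ fromEdgeSet (E : Set (Sym2 V))) w u v ≤
          ENNReal.ofReal (Δ + 4 * ρ * (2 * m + Δ))) ∧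
      (∀ u, key u ∈ B → wdist (H ⊔ fromEdgeSet (E : Set (Sym2 V))) w u (c (key u)) ≤
          ENNReal.ofReal (Δ + 2 * ρ * (2 * m + Δ))) ∧
      (B.image c).card * 2 ^ ρ ≤ B.card := by
  let K : SimpleGraph ι :=
    { Adj := fun a b => a ≠ b ∧
        ∃ u v, G.Adj u v ∧ (w s(u, v) : ℝ) ≤ 2 * m ∧ key u = a ∧ key v = b
      symm := by
        constructor
        rintro a b ⟨hab, u, v, huv, hw, hu, hv⟩
        exact ⟨hab.symm, v, u, huv.symm, by rwa [Sym2.eq_swap], hv, hu⟩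
      loopless := ⟨fun a h => h.1 rfl⟩ }
  set S : Finset ι := Finset.univ.image key with hSdef
  obtain ⟨F, B, c, hFK, hBS, hadj, hF, hc, hB⟩ :=
    exists_carving K hρ S (Finset.card_image_le.trans (by simpa using hcard))
  have hlift : ∀ f, ∃ e, f ∈ K.edgeSet →
      e ∈ G.edgeSet ∧ (w e : ℝ) ≤ 2 * m ∧ e.map key = f := by
    intro f
    by_cases hf : f ∈ K.edgeSet
    · induction f with
      | h a b =>
        obtain ⟨-, u, v, huv, hw, rfl, rfl⟩ := hf
        exact ⟨s(u, v), fun _ => ⟨huv, hw, by simp⟩⟩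
    · exact ⟨s(Classical.arbitrary V, Classical.arbitrary V), fun h => absurd h hf⟩
  choose lift hliftspec using hlift
  have hrep : ∀ a, ∃ x : V, a ∈ S → key x = a := by
    intro a
    by_cases ha : a ∈ S
    · obtain ⟨x, -, hx⟩ := Finset.mem_image.1 ha
      exact ⟨x, fun _ => hx⟩
    · exact ⟨Classical.arbitrary V, fun h => absurd h ha⟩
  choose rep hrepspec using hrep
  set E : Finset (Sym2 V) := F.image lift with hE
  have hEG : (E : Set (Sym2 V)) ⊆ G.edgeSet := by
    intro e he
    obtain ⟨f, hf, rfl⟩ := Finset.mem_image.1 he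
    exact (hliftspec f (hFK hf)).1
  have hwalk : ∀ {a b : ι} (p : (fromEdgeSet (F : Set (Sym2 ι))).Walk a b) (x y : V),
      key x = a → key y = b → wdist (H ⊔ fromEdgeSet (E : Set (Sym2 V))) w x y ≤
        ENNReal.ofReal (Δ + p.length * (2 * m + Δ)) := by
    intro a b p
    induction p with
    | nil =>
      intro x y hx hy
      refine (wdist_anti le_sup_left w x y).trans ((hdiam x y (hx.trans hy.symm)).trans ?_)
      simp
    | @cons a b d hab p ih =>
      intro x y hx hy
      have habF : s(a, b) ∈ F := ((fromEdgeSet_adj _).1 hab).1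
      obtain ⟨u, v, huv, hu, hv⟩ : ∃ u v, s(u, v) = lift s(a, b) ∧ key u = a ∧ key v = b := by
        obtain ⟨-, -, hmap⟩ := hliftspec s(a, b) (hFK habF)
        generalize lift s(a, b) = e at hmap
        induction e with
        | h u v =>
          rw [Sym2.map_mk, Sym2.eq_iff] at hmap
          rcases hmap with ⟨h1, h2⟩ | ⟨h1, h2⟩
          · exact ⟨u, v, rfl, h1, h2⟩
          · exact ⟨v, u, Sym2.eq_swap, h2, h1⟩
      have huvE : s(u, v) ∈ E := huv ▸ Finset.mem_image_of_mem _ habF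
      have huvG : G.Adj u v := hEG huvE
      have huvw : (w s(u, v) : ℝ) ≤ 2 * m := huv ▸ (hliftspec _ (hFK habF)).2.1
      have h1 : wdist (H ⊔ fromEdgeSet (E : Set (Sym2 V))) w x u ≤ ENNReal.ofReal Δ :=
        (wdist_anti le_sup_left w x u).trans (hdiam x u (hx.trans hu.symm))
      have h2 : wdist (H ⊔ fromEdgeSet (E : Set (Sym2 V))) w u v ≤ ENNReal.ofReal (2 * m) := by
        refine (wdist_le_of_adj w ?_).trans ?_
        · exact Or.inr ((fromEdgeSet_adj _).2 ⟨huvE, huvG.ne⟩)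
        · rw [← ENNReal.ofReal_coe_nnreal]
          exact ENNReal.ofReal_le_ofReal huvw
      have h3 := ih v y hv hy
      refine wdist_trans_le (add_nonneg hΔ (by positivity)) (by positivity)
        (wdist_trans_le hΔ (by positivity) h1 h2 le_rfl) h3 (le_of_eq ?_)
      rw [Walk.length_cons]
      push_cast
      ring
  have hhop : ∀ (n : ℕ) (x y : V), Hop F n (key x) (key y) →
      wdist (H ⊔ fromEdgeSet (E : Set (Sym2 V))) w x y ≤
        ENNReal.ofReal (Δ + n * (2 * m + Δ)) := by
    rintro n x y ⟨p, hp⟩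
    refine (hwalk p x y rfl rfl).trans (ENNReal.ofReal_le_ofReal ?_)
    have : (p.length : ℝ) ≤ n := by exact_mod_cast hp
    gcongr
  have hkeyS : ∀ u, key u ∈ S := fun u => Finset.mem_image_of_mem _ (Finset.mem_univ u)
  refine ⟨E, B, fun a => rep (c a), hEG, hBS, ?_, ?_, ?_, ?_⟩
  · calc ∑ e ∈ E, (w e : ℝ) ≤ E.card • (2 * m) := by
          refine Finset.sum_le_card_nsmul _ _ _ fun e he => ?_
          obtain ⟨f, hf, rfl⟩ := Finset.mem_image.1 he
          exact (hliftspec f (hFK hf)).2.1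
      _ = 2 * m * E.card := by rw [nsmul_eq_mul]; ring
      _ ≤ _ := by
          have : (E.card : ℝ) ≤ 2 * S.card + β * B.card := by
            exact_mod_cast Finset.card_image_le.trans hF
          gcongr
  · intro u v huv hw
    have h : Hop F (4 * ρ) (key u) (key v) := by
      by_cases hne : key u = key v
      · exact hne ▸ Hop.refl _ _ _
      · exact hadj _ (hkeyS u) _ (hkeyS v) ⟨hne, u, v, huv, hw, rfl, rfl⟩
    simpa using hhop _ u v h
  · intro u hu
    have hcu := hc (key u) hu
    have h := hhop (2 * ρ) u (rep (c (key u))) (by rw [hrepspec _ hcu.1]; exact hcu.2)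
    simpa using h
  · refine (Nat.mul_le_mul_right _ ?_).trans hB
    rw [← Function.comp_def, ← Finset.image_image]
    exact Finset.card_image_le

open Classical in
/-- The state of the construction before scale `i`: the edges `E` chosen so far span all edges of
`G` of the lower scales; the vertices in `D` have been absorbed by a center `c v`, of which there
are few; the intervals in `A` are used up, each by a vertex of `D`. -/
structure ScaleInvariant {V : Type} (G T : SimpleGraph V) (w : Sym2 V → NNReal)
    (cell : V → ℕ) (κ ρ N top : ℕ) (M σ : ℝ) (i : ℕ) (E : Finset (Sym2 V)) (D : Finset V)
    (c : V → V) (A : Finset ℕ) : Prop where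
  edges_mem : (E : Set (Sym2 V)) ⊆ G.edgeSet
  spanned : ∀ j < i, ∀ u v, G.Adj u v → (w s(u, v) : ℝ) ≤ 2 * (M * κ ^ j) →
    wdist (T ⊔ fromEdgeSet (E : Set (Sym2 V))) w u v ≤ ENNReal.ofReal (σ * (M * κ ^ j))
  near : ∀ v ∈ D, wdist (T ⊔ fromEdgeSet (E : Set (Sym2 V))) w v (c v) ≤
    ENNReal.ofReal (M * κ ^ i)
  centers : (D.image c).card * 2 ^ ρ ≤ i * N
  used : ∀ a ∈ A, a < top ∧ ∃ v ∈ D, cell v / κ ^ i = a / κ ^ i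

open Classical in
theorem ScaleInvariant.step {V : Type} [Fintype V] [Nonempty V] {G T : SimpleGraph V}
    {w : Sym2 V → NNReal} {cell : V → ℕ} {κ ρ N top i β : ℕ} {M r : ℝ}
    {E : Finset (Sym2 V)} {D : Finset V} {c : V → V} {A : Finset ℕ}
    (h : ScaleInvariant G T w cell κ ρ N top M (28 * ρ * r) i E D c A)
    (hM : 0 ≤ M) (hr : 1 ≤ r) (hρ : 0 < ρ) (hcard : Fintype.card V ≤ β ^ ρ)
    (hκ1 : 1 ≤ κ) (hκ : 28 * ρ * r ≤ κ) (hcell : ∀ v, cell v < N) (htop : N + κ ^ i ≤ top + 1)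
    (hdist : ∀ u v, cell u / κ ^ i = cell v / κ ^ i →
      wdist T w u v ≤ ENNReal.ofReal (r * (M * κ ^ i))) :
    ∃ E' D' c' A', ScaleInvariant G T w cell κ ρ N top M (28 * ρ * r) (i + 1) E' D' c' A' ∧
      ∑ e ∈ E', (w e : ℝ) ≤ ∑ e ∈ E, (w e : ℝ) +
        2 * (M * κ ^ i) * (2 * ((N - 1) / κ ^ i + 1 : ℕ) + β * (D.image c).card) +
        2 * β * M * (A'.card - A.card) := by
  set m : ℝ := M * κ ^ i with hmdef
  have hm : 0 ≤ m := by positivity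
  have hκpos : 0 < κ ^ i := by positivity
  set H := T ⊔ fromEdgeSet (E : Set (Sym2 V)) with hH
  let cellKey : ℕ → ℕ ⊕ V := fun z =>
    if hz : ∃ u ∈ D, cell u / κ ^ i = z then Sum.inr (c hz.choose) else Sum.inl z
  let key : V → ℕ ⊕ V := fun v => cellKey (cell v / κ ^ i)
  have hinl : ∀ {u z}, key u = Sum.inl z →
      cell u / κ ^ i = z ∧ ¬ ∃ v ∈ D, cell v / κ ^ i = z := by
    intro u z hu
    by_cases hz : ∃ v ∈ D, cell v / κ ^ i = cell u / κ ^ i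
    · simp [key, cellKey, hz] at hu
    · simp only [key, cellKey, hz, dite_false, Sum.inl.injEq] at hu
      exact ⟨hu, hu ▸ hz⟩
  have hinr : ∀ {u x}, key u = Sum.inr x →
      ∃ v ∈ D, cell v / κ ^ i = cell u / κ ^ i ∧ c v = x := by
    intro u x hu
    by_cases hz : ∃ v ∈ D, cell v / κ ^ i = cell u / κ ^ i
    · simp only [key, cellKey, hz, dite_true, Sum.inr.injEq] at hu
      exact ⟨hz.choose, hz.choose_spec.1, hz.choose_spec.2, hu⟩
    · simp [key, cellKey, hz] at hu
  have hcellH : ∀ u v, cell u / κ ^ i = cell v / κ ^ i →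
      wdist H w u v ≤ ENNReal.ofReal (r * m) :=
    fun u v huv => (wdist_anti le_sup_left w u v).trans (hdist u v huv)
  have hrm : 0 ≤ r * m := by positivity
  have hmr : m ≤ r * m := le_mul_of_one_le_left hm hr
  have hdiam : ∀ u v, key u = key v → wdist H w u v ≤ ENNReal.ofReal (4 * r * m) := by
    intro u v huv
    rcases hku : key u with z | x
    · refine (hcellH u v ?_).trans (ENNReal.ofReal_le_ofReal (by linarith))
      rw [(hinl hku).1, (hinl (huv ▸ hku)).1]
    · have hx : ∀ y, key y = Sum.inr x → wdist H w y x ≤ ENNReal.ofReal (2 * r * m) := by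
        intro y hy
        obtain ⟨a, haD, hay, rfl⟩ := hinr hy
        exact wdist_trans_le hrm hm (hcellH y a hay.symm) (h.near a haD) (by linarith)
      refine wdist_trans_le (by positivity) (by positivity) (hx u hku)
        (wdist_comm H w x v ▸ hx v (huv ▸ hku)) (by linarith)
  obtain ⟨E₁, B, b, hE₁G, hBS, hE₁, hspan, hnear, hB⟩ :=
    exists_scale_spanner G H w key hρ hcard hm (by positivity) hdiam
  have hρ1 : (1 : ℝ) ≤ ρ := by exact_mod_cast hρ
  have hρr : r * m ≤ ρ * (r * m) := le_mul_of_one_le_left hrm hρ1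
  have hbound : 4 * r * m + 4 * ρ * (2 * m + 4 * r * m) ≤ 28 * ρ * r * m := by
    have : (ρ : ℝ) * m ≤ ρ * (r * m) := by gcongr
    nlinarith
  have hbound' : 4 * r * m + 2 * ρ * (2 * m + 4 * r * m) ≤ 28 * ρ * r * m := by
    have : 0 ≤ (ρ : ℝ) * (2 * m + 4 * r * m) := by positivity
    linarith
  have hHE : T ⊔ fromEdgeSet ((E ∪ E₁ : Finset (Sym2 V)) : Set (Sym2 V)) =
      H ⊔ fromEdgeSet (E₁ : Set (Sym2 V)) := by
    rw [Finset.coe_union, hH, sup_assoc, fromEdgeSet_union]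
  have hnext : m ≤ M * κ ^ (i + 1) := by
    rw [hmdef]
    gcongr
    · exact_mod_cast hκ1
    · omega
  have hkeyS : (Finset.univ.image key).card ≤ (N - 1) / κ ^ i + 1 := by
    have hsub : Finset.univ.image key ⊆ (Finset.range ((N - 1) / κ ^ i + 1)).image cellKey := by
      intro a ha
      obtain ⟨u, -, rfl⟩ := Finset.mem_image.1 ha
      refine Finset.mem_image_of_mem _ (Finset.mem_range.2 (Nat.lt_succ_of_le ?_))
      exact Nat.div_le_div_right (by have := hcell u; omega)
    refine (Finset.card_le_card hsub).trans (Finset.card_image_le.trans ?_)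
    simp
  have hBmem : ∀ a ∈ B, ∃ u, key u = a := fun a ha => by
    obtain ⟨u, -, hu⟩ := Finset.mem_image.1 (hBS ha)
    exact ⟨u, hu⟩
  let fresh : Finset ℕ := B.toLeft.biUnion fun z => Finset.Ico (z * κ ^ i) ((z + 1) * κ ^ i)
  have hfresh : ∀ {a}, a ∈ fresh ↔ Sum.inl (a / κ ^ i) ∈ B := by
    intro a
    have : ∀ z, a ∈ Finset.Ico (z * κ ^ i) ((z + 1) * κ ^ i) ↔ a / κ ^ i = z := by
      intro z
      rw [Finset.mem_Ico, Nat.div_eq_iff hκpos, add_mul, one_mul]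
      omega
    simp only [fresh, Finset.mem_biUnion, Finset.mem_toLeft, this]
    simp
  have hfreshcard : fresh.card = B.toLeft.card * κ ^ i := by
    rw [Finset.card_biUnion]
    · simp [add_mul]
    · intro y _ z _ hyz
      refine Finset.disjoint_left.2 fun a hay haz => hyz ?_
      rw [Finset.mem_Ico] at hay haz
      rw [← Nat.div_eq_of_lt_le hay.1 hay.2, Nat.div_eq_of_lt_le haz.1 haz.2]
  have hdisj : Disjoint A fresh := by
    refine Finset.disjoint_left.2 fun a haA haf => ?_
    obtain ⟨u, hu⟩ := hBmem _ (hfresh.1 haf)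
    obtain ⟨-, v, hvD, hv⟩ := h.used a haA
    exact (hinl hu).2 ⟨v, hvD, hv⟩
  have hright : B.toRight ⊆ D.image c := by
    intro x hx
    obtain ⟨u, hu⟩ := hBmem _ (Finset.mem_toRight.1 hx)
    obtain ⟨v, hvD, -, rfl⟩ := hinr hu
    exact Finset.mem_image_of_mem _ hvD
  refine ⟨E ∪ E₁, D ∪ Finset.univ.filter (fun v => key v ∈ B),
    fun v => if key v ∈ B then b (key v) else c v, A ∪ fresh, ⟨?_, ?_, ?_, ?_, ?_⟩, ?_⟩
  · rw [Finset.coe_union]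
    exact Set.union_subset h.edges_mem hE₁G
  · intro j hj u v huv hw
    rw [hHE]
    rcases Nat.lt_succ_iff_lt_or_eq.1 hj with hj | rfl
    · exact (wdist_anti le_sup_left w u v).trans (h.spanned j hj u v huv hw)
    · exact (hspan u v huv hw).trans (ENNReal.ofReal_le_ofReal hbound)
  · intro v hv
    rw [hHE]
    by_cases hvB : key v ∈ B
    · simp only [hvB, if_true]
      refine (hnear v hvB).trans (ENNReal.ofReal_le_ofReal (hbound'.trans ?_))
      rw [pow_succ', mul_left_comm]
      gcongr
    · simp only [hvB, if_false]
      have hvD : v ∈ D := by simpa [hvB] using hv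
      exact (wdist_anti le_sup_left w v _).trans
        ((h.near v hvD).trans (ENNReal.ofReal_le_ofReal hnext))
  · have hsub : (D ∪ Finset.univ.filter (fun v => key v ∈ B)).image
        (fun v => if key v ∈ B then b (key v) else c v) ⊆ D.image c ∪ B.image b := by
      intro x hx
      obtain ⟨v, hv, rfl⟩ := Finset.mem_image.1 hx
      by_cases hvB : key v ∈ B
      · simp only [hvB, if_true]
        exact Finset.mem_union_right _ (Finset.mem_image_of_mem _ hvB)
      · simp only [hvB, if_false]
        exact Finset.mem_union_left _ (Finset.mem_image_of_mem _ (by simpa [hvB] using hv))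
    have hBN : B.card ≤ N := by
      refine (Finset.card_le_card hBS).trans (hkeyS.trans ?_)
      have hN : 0 < N := (Nat.zero_le _).trans_lt (hcell (Classical.arbitrary V))
      have := Nat.div_le_self (N - 1) (κ ^ i)
      omega
    calc _ ≤ ((D.image c).card + (B.image b).card) * 2 ^ ρ :=
          Nat.mul_le_mul_right _ ((Finset.card_le_card hsub).trans (Finset.card_union_le _ _))
      _ = (D.image c).card * 2 ^ ρ + (B.image b).card * 2 ^ ρ := add_mul _ _ _
      _ ≤ i * N + N := add_le_add h.centers (hB.trans hBN)
      _ = (i + 1) * N := by ring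
  · intro a ha
    rcases Finset.mem_union.1 ha with ha | ha
    · obtain ⟨h1, v, hvD, hv⟩ := h.used a ha
      refine ⟨h1, v, Finset.mem_union_left _ hvD, ?_⟩
      rw [pow_succ, ← Nat.div_div_eq_div_mul, hv, Nat.div_div_eq_div_mul]
    · obtain ⟨u, hu⟩ := hBmem _ (hfresh.1 ha)
      have hua := (hinl hu).1
      refine ⟨?_, u, Finset.mem_union_right _ ?_, ?_⟩
      · have h1 : cell u / κ ^ i * κ ^ i ≤ cell u := Nat.div_mul_le_self _ _
        have h2 : a < a / κ ^ i * κ ^ i + κ ^ i := Nat.lt_div_mul_add hκpos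
        rw [hua] at h1
        have := hcell u
        omega
      · exact Finset.mem_filter.2 ⟨Finset.mem_univ _, hu ▸ hfresh.1 ha⟩
      · rw [pow_succ, ← Nat.div_div_eq_div_mul, hua, Nat.div_div_eq_div_mul]
  · have h1 : ∑ e ∈ E ∪ E₁, (w e : ℝ) ≤ ∑ e ∈ E, (w e : ℝ) + ∑ e ∈ E₁, (w e : ℝ) := by
      rw [← Finset.sum_union_inter]
      exact le_add_of_nonneg_right (Finset.sum_nonneg fun e _ => (w e).coe_nonneg)
    have h2 : (B.card : ℝ) ≤ B.toLeft.card + (D.image c).card := by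
      rw [← Finset.card_toLeft_add_card_toRight]
      exact_mod_cast Nat.add_le_add_left (Finset.card_le_card hright) _
    have h3 : ((A ∪ fresh).card : ℝ) - A.card = B.toLeft.card * κ ^ i := by
      rw [Finset.card_union_of_disjoint hdisj, hfreshcard]
      push_cast
      ring
    have h4 : ((Finset.univ.image key).card : ℝ) ≤ ((N - 1) / κ ^ i + 1 : ℕ) := by
      exact_mod_cast hkeyS
    have h5 : 2 * m * (2 * (Finset.univ.image key).card + β * B.card) ≤
        2 * m * (2 * ((N - 1) / κ ^ i + 1 : ℕ) +
          β * (B.toLeft.card + (D.image c).card)) := by gcongr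
    rw [h3]
    have h6 : 2 * β * M * (B.toLeft.card * (κ : ℝ) ^ i) = 2 * m * (β * B.toLeft.card) := by
      rw [hmdef]
      ring
    rw [h6]
    linarith

theorem sum_range_pow_le_two_mul {κ : ℝ} (hκ : 2 ≤ κ) (n : ℕ) :
    ∑ j ∈ Finset.range (n + 1), κ ^ j ≤ 2 * κ ^ n := by
  induction n with
  | zero => simp
  | succ n ih =>
    rw [Finset.sum_range_succ, pow_succ]
    have : 0 ≤ κ ^ n := by positivity
    nlinarith

/-- The edges of `J` scales, each `κ` times coarser than the preceding one, can be spanned at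
small cost, provided that `J` is small compared with `ρ`. -/
theorem exists_block_spanner {V : Type} [Fintype V] [Nonempty V] {G T : SimpleGraph V}
    {w : Sym2 V → NNReal} {p : V → ℝ} {W r M : ℝ} {κ ρ β J : ℕ}
    (hp : ∀ v, 0 ≤ p v ∧ p v ≤ 2 * W)
    (hd : ∀ u v, wdist T w u v ≤ ENNReal.ofReal |p u - p v|) (hM : 0 < M) (hr : 1 ≤ r)
    (hρ : 0 < ρ) (hcard : Fintype.card V ≤ β ^ ρ) (hκ2 : 2 ≤ κ) (hκ : 28 * ρ * r ≤ κ)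
    (hJ0 : 0 < J) (hJ : κ ^ (2 * J) ≤ 2 ^ ρ) (hMW : M * κ ^ (J - 1) ≤ W) :
    ∃ E : Finset (Sym2 V), (E : Set (Sym2 V)) ⊆ G.edgeSet ∧
      ∑ e ∈ E, (w e : ℝ) ≤ W * (8 * J / r + 8 + 14 * β) ∧
      ∀ i < J, ∀ u v, G.Adj u v → (w s(u, v) : ℝ) ≤ 2 * (M * κ ^ i) →
        wdist (T ⊔ fromEdgeSet (E : Set (Sym2 V))) w u v ≤
          ENNReal.ofReal (28 * ρ * r * (M * κ ^ i)) := by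
  classical
  have hκ2' : (2 : ℝ) ≤ κ := by exact_mod_cast hκ2
  have hr0 : 0 < r := by linarith
  have hrM : 0 < r * M := by positivity
  have hMle : M ≤ M * κ ^ (J - 1) :=
    le_mul_of_one_le_right hM.le (one_le_pow₀ (by linarith))
  have hW : 0 < W := by linarith
  let cell : V → ℕ := fun v => ⌊p v / (r * M)⌋₊
  set N : ℕ := ⌊2 * W / (r * M)⌋₊ + 1 with hN
  have hcell : ∀ v, cell v < N := fun v => by
    refine Nat.lt_succ_of_le (Nat.floor_le_floor ?_)
    gcongr
    exact (hp v).2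
  have hMN : M * (N - 1 : ℕ) ≤ 2 * W / r := by
    have h1 : ((N - 1 : ℕ) : ℝ) ≤ 2 * W / (r * M) := by
      rw [hN, Nat.add_sub_cancel]
      exact Nat.floor_le (by positivity)
    calc M * ((N - 1 : ℕ) : ℝ) ≤ M * (2 * W / (r * M)) := by gcongr
      _ = 2 * W / r := by field_simp
  have hWr : 2 * W / r ≤ 2 * W := div_le_self (by positivity) hr
  have hNcast : (N : ℝ) = (N - 1 : ℕ) + 1 := by rw [hN]; push_cast; simp
  have hMN3 : M * N ≤ 3 * W := by
    rw [hNcast]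
    linarith
  have hdist : ∀ i u v, cell u / κ ^ i = cell v / κ ^ i →
      wdist T w u v ≤ ENNReal.ofReal (r * (M * κ ^ i)) := by
    intro i u v huv
    refine (hd u v).trans (ENNReal.ofReal_le_ofReal ?_)
    have hκpos : 0 < κ ^ i := by positivity
    have key : ∀ x : V, ((cell x / κ ^ i : ℕ) : ℝ) * κ ^ i * (r * M) ≤ p x ∧
        p x ≤ (((cell x / κ ^ i : ℕ) : ℝ) * κ ^ i + κ ^ i) * (r * M) := by
      intro x
      have h1 : cell x / κ ^ i * κ ^ i ≤ cell x := Nat.div_mul_le_self _ _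
      have h2 : cell x + 1 ≤ cell x / κ ^ i * κ ^ i + κ ^ i := Nat.lt_div_mul_add hκpos
      have h1' : ((cell x / κ ^ i : ℕ) : ℝ) * κ ^ i ≤ cell x := by exact_mod_cast h1
      have h2' : (cell x : ℝ) + 1 ≤ ((cell x / κ ^ i : ℕ) : ℝ) * κ ^ i + κ ^ i := by
        exact_mod_cast h2
      have h3 : (cell x : ℝ) ≤ p x / (r * M) :=
        Nat.floor_le (div_nonneg (hp x).1 hrM.le)
      have h4 : p x / (r * M) < cell x + 1 := Nat.lt_floor_add_one _
      constructor
      · exact (le_div_iff₀ hrM).1 (h1'.trans h3)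
      · exact (div_le_iff₀ hrM).1 (h4.le.trans h2')
    have hu := key u
    have hv := key v
    rw [← huv] at hv
    rw [abs_le]
    constructor <;> nlinarith [hu.1, hu.2, hv.1, hv.2]
  set g : ℕ → ℝ := fun i => ∑ j ∈ Finset.range i, (κ : ℝ) ^ j with hg
  have hind : ∀ i ≤ J, ∃ E D c A,
      ScaleInvariant G T w cell κ ρ N (N + κ ^ (J - 1)) M (28 * ρ * r) i E D c A ∧
      ∑ e ∈ E, (w e : ℝ) ≤ i * (8 * W / r) + 4 * M * g i + 2 * β * M * A.card +
        6 * β * W * (g i / κ ^ J) := by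
    intro i
    induction i with
    | zero =>
      intro _
      exact ⟨∅, ∅, id, ∅, ⟨by simp, by simp, by simp, by simp, by simp⟩, by simp [hg]⟩
    | succ i ih =>
      intro hi
      obtain ⟨E, D, c, A, hinv, hcost⟩ := ih (by omega)
      obtain ⟨E', D', c', A', hinv', hcost'⟩ := hinv.step (β := β) hM.le hr hρ hcard (by omega) hκ
        hcell (by have := Nat.pow_le_pow_right (by omega : 0 < κ) (by omega : i ≤ J - 1); omega)
        (hdist i)
      refine ⟨E', D', c', A', hinv', hcost'.trans ?_⟩
      set X := (D.image c).card
      have hX : X * κ ^ J ≤ N := by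
        have h1 : X * κ ^ (2 * J) ≤ κ ^ J * N :=
          calc X * κ ^ (2 * J) ≤ X * 2 ^ ρ := Nat.mul_le_mul_left _ hJ
            _ ≤ i * N := hinv.centers
            _ ≤ κ ^ J * N := Nat.mul_le_mul_right _
                ((by omega : i ≤ J).trans (Nat.lt_pow_self (by omega)).le)
        refine le_of_mul_le_mul_left (a := κ ^ J) ?_ (by positivity)
        calc _ = X * κ ^ (2 * J) := by ring
          _ ≤ _ := h1
      have hXR : (X : ℝ) ≤ N / κ ^ J := by
        rw [le_div_iff₀ (by positivity)]
        exact_mod_cast hX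
      have hmX : M * κ ^ i * X ≤ 3 * W * (κ ^ i / κ ^ J) :=
        calc M * κ ^ i * X ≤ M * κ ^ i * (N / κ ^ J) := by gcongr
          _ = M * N * (κ ^ i / κ ^ J) := by ring
          _ ≤ _ := by gcongr
      have hmN : M * κ ^ i * ((N - 1) / κ ^ i + 1 : ℕ) ≤ 2 * W / r + M * κ ^ i := by
        have h1 : (((N - 1) / κ ^ i : ℕ) : ℝ) ≤ (N - 1 : ℕ) / (κ : ℝ) ^ i := by
          refine Nat.cast_div_le.trans (le_of_eq ?_)
          push_cast
          rfl
        calc M * κ ^ i * ((N - 1) / κ ^ i + 1 : ℕ)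
            ≤ M * κ ^ i * ((N - 1 : ℕ) / (κ : ℝ) ^ i + 1) := by
              push_cast at h1 ⊢
              gcongr
          _ = M * (N - 1 : ℕ) + M * κ ^ i := by field_simp
          _ ≤ _ := by gcongr
      have hgs : g (i + 1) = g i + κ ^ i := Finset.sum_range_succ _ _
      have hβX : β * (M * κ ^ i * X) ≤ β * (3 * W * (κ ^ i / κ ^ J)) := by gcongr
      have e1 : 6 * β * W * (g (i + 1) / κ ^ J) =
          6 * β * W * (g i / κ ^ J) + 2 * (β * (3 * W * (κ ^ i / κ ^ J))) := by
        rw [hgs]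
        ring
      have e2 : 2 * (M * κ ^ i) * (2 * ((N - 1) / κ ^ i + 1 : ℕ) + β * X) =
          4 * (M * κ ^ i * ((N - 1) / κ ^ i + 1 : ℕ)) + 2 * (β * (M * κ ^ i * X)) := by
        ring
      have e3 : ((i + 1 : ℕ) : ℝ) * (8 * W / r) = i * (8 * W / r) + 4 * (2 * W / r) := by
        push_cast
        ring
      rw [e1, e2, e3, hgs]
      linarith
  obtain ⟨E, D, c, A, hinv, hcost⟩ := hind J le_rfl
  refine ⟨E, hinv.edges_mem, hcost.trans ?_, hinv.spanned⟩
  have hgJ : g J ≤ 2 * κ ^ (J - 1) := by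
    obtain ⟨n, rfl⟩ : ∃ n, J = n + 1 := ⟨J - 1, by omega⟩
    exact sum_range_pow_le_two_mul hκ2' n
  have hgJ' : g J / κ ^ J ≤ 1 := by
    rw [div_le_one (by positivity)]
    refine hgJ.trans ?_
    conv_rhs => rw [← Nat.sub_add_cancel hJ0, pow_succ']
    gcongr
  have hA : A.card ≤ N + κ ^ (J - 1) := by
    have : A ⊆ Finset.range (N + κ ^ (J - 1)) :=
      fun a ha => Finset.mem_range.2 (hinv.used a ha).1
    simpa using Finset.card_le_card this
  have hA' : M * A.card ≤ 4 * W :=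
    calc M * A.card ≤ M * (N + κ ^ (J - 1)) := by gcongr; exact_mod_cast hA
      _ = M * N + M * κ ^ (J - 1) := by ring
      _ ≤ _ := by linarith
  have h1 : M * g J ≤ 2 * W := by
    have : M * g J ≤ M * (2 * κ ^ (J - 1)) := by gcongr
    linarith
  have h2 : β * (M * A.card) ≤ β * (4 * W) := by gcongr
  have h3 : β * W * (g J / κ ^ J) ≤ β * W * 1 := by gcongr
  have h4 : W * (8 * J / r + 8 + 14 * β) =
      J * (8 * W / r) + 8 * W + 8 * (β * W) + 6 * (β * W * 1) := by ring
  rw [h4]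
  linarith

theorem exists_dyadic_level {W x : ℝ} (hxW : x ≤ W) {B : ℕ} (hB : W / 2 ^ B < x) :
    ∃ b < B, W / 2 ^ (b + 1) < x ∧ x ≤ W / 2 ^ b := by
  induction B with
  | zero => simp at hB; linarith
  | succ B ih =>
    by_cases h : W / 2 ^ B < x
    · obtain ⟨b, hb, h1⟩ := ih h
      exact ⟨b, by omega, h1⟩
    · exact ⟨B, by omega, hB, not_lt.1 h⟩

theorem sum_biUnion_le_card_mul {ι α : Type*} [DecidableEq α] {s : Finset ι} {t : ι → Finset α}
    {f : α → ℝ} (hf : ∀ a, 0 ≤ f a) {c : ℝ} (h : ∀ i ∈ s, ∑ a ∈ t i, f a ≤ c) :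
    ∑ a ∈ s.biUnion t, f a ≤ s.card * c := by
  classical
  induction s using Finset.induction_on with
  | empty => simp
  | insert i s hi ih =>
    rw [Finset.biUnion_insert, Finset.card_insert_of_notMem hi]
    have h1 := ih fun j hj => h j (Finset.mem_insert_of_mem hj)
    have h2 := h i (Finset.mem_insert_self i s)
    have h3 := Finset.sum_union_inter (s₁ := t i) (s₂ := s.biUnion t) (f := f)
    have h4 : 0 ≤ ∑ a ∈ t i ∩ s.biUnion t, f a := Finset.sum_nonneg fun a _ => hf a
    push_cast
    linarith

theorem totalWeight_sup_fromEdgeSet_le {V : Type} [Fintype V] (T : SimpleGraph V)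
    (w : Sym2 V → NNReal) (F : Finset (Sym2 V)) :
    totalWeight (T ⊔ fromEdgeSet (F : Set (Sym2 V))) w ≤ totalWeight T w + ∑ e ∈ F, (w e : ℝ) := by
  classical
  unfold totalWeight
  have hsub : (T ⊔ fromEdgeSet (F : Set (Sym2 V))).edgeSet.toFinite.toFinset ⊆
      T.edgeSet.toFinite.toFinset ∪ F := by
    intro e he
    simp only [Set.Finite.mem_toFinset, edgeSet_sup, edgeSet_fromEdgeSet, Finset.mem_union,
      Set.mem_union, Set.mem_sdiff, Finset.mem_coe] at he ⊢
    tauto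
  refine (Finset.sum_le_sum_of_subset_of_nonneg hsub fun e _ _ => (w e).coe_nonneg).trans ?_
  rw [← Finset.sum_union_inter]
  exact le_add_of_nonneg_right (Finset.sum_nonneg fun e _ => (w e).coe_nonneg)

/-- All edges that are neither very light nor very heavy are distributed over `q * m` blocks of
`J` scales. -/
theorem exists_spanner_of_parameters {V : Type} [Fintype V] [Nonempty V] {G T : SimpleGraph V}
    {w : Sym2 V → NNReal} {p : V → ℝ} {W r : ℝ} {q ρ β J m : ℕ} (hTG : T ≤ G)
    (hW : 0 < W) (hp : ∀ v, 0 ≤ p v ∧ p v ≤ 2 * W)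
    (hd : ∀ u v, wdist T w u v ≤ ENNReal.ofReal |p u - p v|) (hr : 1 ≤ r)
    (hρ : 0 < ρ) (hcard : Fintype.card V ≤ β ^ ρ) (hq : 0 < q) (hκ : 28 * ρ * r ≤ 2 ^ q)
    (hJ0 : 0 < J) (hJ : 2 * q * J ≤ ρ) (hm : Fintype.card V ^ 2 ≤ 2 ^ (q * J * m)) :
    ∃ H ≤ G,
      (∀ u v, G.Adj u v → wdist H w u v ≤ ENNReal.ofReal (56 * ρ * r * w s(u, v))) ∧
      totalWeight H w ≤ totalWeight T w + W * (1 + q * m * (8 * J / r + 8 + 14 * β)) := by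
  classical
  have hρ1 : (1 : ℝ) ≤ ρ := by exact_mod_cast hρ
  have hρr : 1 ≤ ρ * r := one_le_mul_of_one_le_of_one_le hρ1 hr
  let κ : ℕ := 2 ^ q
  have hκcast : (κ : ℝ) = 2 ^ q := by simp [κ]
  have hκ0 : (κ : ℝ) ≠ 0 := by positivity
  let M : ℕ × ℕ → ℝ := fun x => W / (2 ^ (x.1 + q * J * x.2) * κ ^ (J - 1))
  have hM : ∀ x, 0 < M x := fun x => by positivity
  have hblock : ∀ x : ℕ × ℕ, ∃ E : Finset (Sym2 V), (E : Set (Sym2 V)) ⊆ G.edgeSet ∧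
      ∑ e ∈ E, (w e : ℝ) ≤ W * (8 * J / r + 8 + 14 * β) ∧
      ∀ i < J, ∀ u v, G.Adj u v → (w s(u, v) : ℝ) ≤ 2 * (M x * κ ^ i) →
        wdist (T ⊔ fromEdgeSet (E : Set (Sym2 V))) w u v ≤
          ENNReal.ofReal (28 * ρ * r * (M x * κ ^ i)) := by
    intro x
    refine exists_block_spanner hp hd (hM x) hr hρ hcard (Nat.le_self_pow hq.ne' 2)
      (by rwa [hκcast]) hJ0 ?_ ?_
    · rw [← pow_mul]
      exact Nat.pow_le_pow_right (by norm_num) (by linarith)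
    · have : M x * κ ^ (J - 1) = W / 2 ^ (x.1 + q * J * x.2) := by
        simp only [M]
        field_simp
      rw [this]
      exact div_le_self hW.le (one_le_pow₀ (by norm_num))
  choose E hEG hEw hE using hblock
  let light : Finset (Sym2 V) :=
    {e | e ∈ G.edgeSet ∧ (w e : ℝ) ≤ W / 2 ^ (q * J * m)}
  let F : Finset (Sym2 V) := light ∪ (Finset.range q ×ˢ Finset.range m).biUnion E
  have hlight : ∑ e ∈ light, (w e : ℝ) ≤ W := by
    have hc : light.card ≤ Fintype.card V ^ 2 := by
      refine (Finset.card_le_univ _).trans ?_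
      rw [Sym2.card, Nat.choose_two_right, pow_two]
      have : 0 < Fintype.card V := Fintype.card_pos
      apply Nat.div_le_of_le_mul
      simp only [Nat.add_sub_cancel]
      nlinarith
    have hc' : (light.card : ℝ) ≤ 2 ^ (q * J * m) := by exact_mod_cast hc.trans hm
    calc ∑ e ∈ light, (w e : ℝ) ≤ light.card • (W / 2 ^ (q * J * m)) :=
          Finset.sum_le_card_nsmul _ _ _ fun e he => (Finset.mem_filter.1 he).2.2
      _ = light.card * (W / 2 ^ (q * J * m)) := nsmul_eq_mul _ _
      _ ≤ 2 ^ (q * J * m) * (W / 2 ^ (q * J * m)) := by gcongr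
      _ = W := by field_simp
  have hFG : (F : Set (Sym2 V)) ⊆ G.edgeSet := by
    intro e he
    rcases Finset.mem_union.1 (Finset.mem_coe.1 he) with h | h
    · exact (Finset.mem_filter.1 h).2.1
    · obtain ⟨x, -, hx⟩ := Finset.mem_biUnion.1 h
      exact hEG x hx
  refine ⟨T ⊔ fromEdgeSet (F : Set (Sym2 V)), sup_le hTG ?_, ?_, ?_⟩
  · rw [← fromEdgeSet_edgeSet G]
    exact fromEdgeSet_mono hFG
  · intro u v huv
    have hw0 : (0 : ℝ) ≤ w s(u, v) := (w s(u, v)).coe_nonneg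
    by_cases h1 : W < w s(u, v)
    · refine (wdist_anti le_sup_left w u v).trans ((hd u v).trans (ENNReal.ofReal_le_ofReal ?_))
      have : |p u - p v| ≤ 2 * W := by
        rw [abs_le]
        constructor <;> linarith [hp u, hp v]
      nlinarith
    · by_cases h2 : (w s(u, v) : ℝ) ≤ W / 2 ^ (q * J * m)
      · have hadj : (T ⊔ fromEdgeSet (F : Set (Sym2 V))).Adj u v := by
          refine Or.inr ((fromEdgeSet_adj _).2 ⟨?_, huv.ne⟩)
          refine Finset.mem_coe.2 (Finset.mem_union_left _ ?_)
          exact Finset.mem_filter.2 ⟨Finset.mem_univ _, huv, h2⟩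
        refine (wdist_le_of_adj w hadj).trans ?_
        rw [← ENNReal.ofReal_coe_nnreal]
        exact ENNReal.ofReal_le_ofReal (by nlinarith)
      · obtain ⟨b, hb, hb1, hb2⟩ := exists_dyadic_level (not_lt.1 h1) (not_le.1 h2)
        let x : ℕ × ℕ := (b % q, b / (q * J))
        let j := b / q % J
        have hbeq : b = b % q + q * J * (b / (q * J)) + q * j := by
          conv_lhs => rw [← Nat.mod_add_div b q, ← Nat.mod_add_div (b / q) J, Nat.div_div_eq_div_mul]
          ring
        have hj : j < J := Nat.mod_lt _ hJ0
        have hscale : M x * κ ^ (J - 1 - j) = W / 2 ^ b := by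
          have e1 : (κ : ℝ) ^ (J - 1) = κ ^ (J - 1 - j) * 2 ^ (q * j) := by
            rw [pow_mul, ← hκcast, ← pow_add]
            congr 1
            omega
          have e2 : (2 : ℝ) ^ b = 2 ^ (x.1 + q * J * x.2) * 2 ^ (q * j) := by
            rw [← pow_add]
            exact congrArg _ hbeq
          simp only [M]
          rw [e1, e2]
          field_simp
        have hx : x ∈ Finset.range q ×ˢ Finset.range m := by
          refine Finset.mem_product.2 ⟨Finset.mem_range.2 (Nat.mod_lt _ hq), Finset.mem_range.2 ?_⟩
          exact Nat.div_lt_of_lt_mul hb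
        have hsub : T ⊔ fromEdgeSet (E x : Set (Sym2 V)) ≤ T ⊔ fromEdgeSet (F : Set (Sym2 V)) := by
          refine sup_le_sup_left (fromEdgeSet_mono (Finset.coe_subset.2 ?_)) T
          exact (Finset.subset_biUnion_of_mem E hx).trans Finset.subset_union_right
        refine (wdist_anti hsub w u v).trans ((hE x (J - 1 - j) (by omega) u v huv ?_).trans ?_)
        · rw [hscale]
          have : 0 ≤ W / 2 ^ b := by positivity
          linarith
        · refine ENNReal.ofReal_le_ofReal ?_
          rw [hscale]
          have h3 : W / 2 ^ b ≤ 2 * w s(u, v) := by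
            rw [pow_succ, ← div_div] at hb1
            linarith
          calc 28 * ρ * r * (W / 2 ^ b) ≤ 28 * ρ * r * (2 * w s(u, v)) := by gcongr
            _ = _ := by ring
  · refine (totalWeight_sup_fromEdgeSet_le T w F).trans ?_
    have h1 := Finset.sum_union_inter (s₁ := light)
      (s₂ := (Finset.range q ×ˢ Finset.range m).biUnion E) (f := fun e => (w e : ℝ))
    have h2 : 0 ≤ ∑ e ∈ light ∩ (Finset.range q ×ˢ Finset.range m).biUnion E, (w e : ℝ) :=
      Finset.sum_nonneg fun e _ => (w e).coe_nonneg
    have h3 := sum_biUnion_le_card_mul (s := Finset.range q ×ˢ Finset.range m) (t := E)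
      (f := fun e => (w e : ℝ)) (fun e => (w e).coe_nonneg) fun x _ => hEw x
    rw [Finset.card_product, Finset.card_range, Finset.card_range] at h3
    push_cast at h3
    have h4 : W * (1 + q * m * (8 * J / r + 8 + 14 * β)) =
      W + q * m * (W * (8 * J / r + 8 + 14 * β)) := by ring
    rw [h4]
    linarith

theorem sq_le_five_mul_two_rpow {x : ℝ} (hx : 0 ≤ x) : x ^ 2 ≤ 5 * (2 : ℝ) ^ x := by
  have h := Real.pow_div_factorial_le_exp (x := Real.log 2 * x) (by positivity) 2
  rw [← Real.rpow_def_of_pos two_pos, mul_pow, Nat.factorial_two, Nat.cast_two] at h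
  have hl := Real.log_two_gt_d9
  have : (0.4 : ℝ) ≤ Real.log 2 ^ 2 := by nlinarith
  nlinarith [sq_nonneg x]

theorem pow_four_le_two_rpow_half {x : ℝ} (hx : 0 ≤ x) :
    x ^ 4 ≤ 2000 * (2 : ℝ) ^ (x / 2) := by
  have h := Real.pow_div_factorial_le_exp (x := Real.log 2 * (x / 2)) (by positivity) 4
  rw [← Real.rpow_def_of_pos two_pos, mul_pow, div_pow] at h
  have hl := Real.log_two_gt_d9
  have h2 : (0.47 : ℝ) ≤ Real.log 2 ^ 2 := by nlinarith
  have h4 : (0.22 : ℝ) ≤ Real.log 2 ^ 4 := by nlinarith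
  have hx4 : 0 ≤ x ^ 4 := by positivity
  norm_num [Nat.factorial] at h
  nlinarith

/-- A choice of the parameters of `exists_spanner_of_parameters` for graphs on `n` vertices. -/
theorem exists_parameters {n : ℕ} (hn : 2 ^ 16 ≤ n) :
    ∃ (r : ℝ) (q ρ β J m : ℕ), 1 ≤ r ∧ 0 < ρ ∧ n ≤ β ^ ρ ∧ 0 < q ∧ 28 * ρ * r ≤ 2 ^ q ∧ 0 < J ∧
      2 * q * J ≤ ρ ∧ n ^ 2 ≤ 2 ^ (q * J * m) ∧
      56 * ρ * r ≤
        1000000 * (Real.logb 2 n / Real.logb 2 (Real.logb 2 (Real.logb 2 n))) ∧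
      2 + q * m * (8 * J / r + 8 + 14 * β) ≤
        1000000 * (Real.logb 2 n / Real.logb 2 (Real.logb 2 (Real.logb 2 n))) := by
  have hn' : (2 : ℝ) ^ (16 : ℝ) ≤ n := by
    rw [show (16 : ℝ) = (16 : ℕ) by norm_num, Real.rpow_natCast]
    exact_mod_cast hn
  have hn0 : (0 : ℝ) < n := lt_of_lt_of_le (by positivity) hn'
  set L := Real.logb 2 n with hL
  set y := Real.logb 2 L with hy
  set c := Real.logb 2 y with hc
  have hL16 : 16 ≤ L := (Real.le_logb_iff_rpow_le one_lt_two hn0).2 hn'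
  have hy4 : 4 ≤ y := by
    refine (Real.le_logb_iff_rpow_le one_lt_two (by linarith)).2 (le_trans ?_ hL16)
    norm_num
  have hc2 : 2 ≤ c := by
    refine (Real.le_logb_iff_rpow_le one_lt_two (by linarith)).2 (le_trans ?_ hy4)
    norm_num
  have hLn : (2 : ℝ) ^ L = n := Real.rpow_logb two_pos (by norm_num) hn0
  have hyL : (2 : ℝ) ^ y = L := Real.rpow_logb two_pos (by norm_num) (by linarith)
  have hcy : (2 : ℝ) ^ c = y := Real.rpow_logb two_pos (by norm_num) (by linarith)
  have hc0 : 0 < c := by linarith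
  have hc_sq : c ^ 2 ≤ 5 * y := hcy ▸ sq_le_five_mul_two_rpow hc0.le
  have hy_sq : y ^ 2 ≤ 5 * L := hyL ▸ sq_le_five_mul_two_rpow (by linarith)
  have hc4 : 4 ≤ c ^ 2 := by nlinarith
  have hc_le_y : c ≤ y := by
    rw [← hcy]
    have := one_add_mul_self_le_rpow_one_add (s := 1) (by norm_num) (p := c) (by linarith)
    norm_num at this
    linarith
  have hy_le_L : y ≤ L := by nlinarith
  set s := (2 : ℝ) ^ (y / 2) with hs
  have hss : s * s = L := by
    rw [hs, ← Real.rpow_add two_pos, add_halves, hyL]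
  have hs1 : 1 ≤ s := Real.one_le_rpow one_le_two (by linarith)
  have hy_four : y ^ 4 ≤ 2000 * s := pow_four_le_two_rpow_half (by linarith)
  clear_value s c y L
  have hceil : ∀ x : ℝ, 0 ≤ x → ∃ k : ℕ, x ≤ k ∧ k ≤ x + 1 := fun x hx =>
    ⟨⌈x⌉₊, Nat.le_ceil x, (Nat.ceil_lt_add_one hx).le⟩
  obtain ⟨ρ, hρ_ge, hρ_le⟩ := hceil (1000 * L / c ^ 2) (by positivity)
  obtain ⟨q', hq'_ge, hq'_le⟩ := hceil y (by linarith)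
  obtain ⟨β, hβ_ge, hβ_le⟩ := hceil ((2 : ℝ) ^ (c ^ 2 / 1000)) (by positivity)
  obtain ⟨q, hq⟩ : ∃ q, q = q' + 15 := ⟨_, rfl⟩
  obtain ⟨J, hJ⟩ : ∃ J, J = ρ / (2 * q) := ⟨_, rfl⟩
  have hq5 : (q : ℝ) ≤ 5 * y := by
    rw [hq]
    push_cast
    linarith
  have hq0 : 0 < q := by omega
  have hLc2 : 1000 * L ≤ ρ * c ^ 2 := (div_le_iff₀ (by positivity)).1 hρ_ge
  have hρ0 : 0 < ρ := by
    have : (0 : ℝ) < ρ := lt_of_lt_of_le (by positivity) hρ_ge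
    exact_mod_cast this
  have hρc : ρ * c ≤ 1005 * (L / c) := by
    have h1 : c ≤ 5 * (L / c) := by
      rw [← mul_div_assoc, le_div_iff₀ hc0, ← pow_two]
      linarith
    calc ρ * c ≤ (1000 * L / c ^ 2 + 1) * c := by gcongr
      _ = 1000 * (L / c) + c := by field_simp
      _ ≤ _ := by linarith
  have hqρ : 2 * q ≤ ρ := by
    have h1 : 2 * (5 * y) * c ^ 2 ≤ 1000 * L := by
      have : y * c ^ 2 ≤ y * (5 * y) := by gcongr
      linarith
    have h2 : 2 * (5 * y) ≤ (ρ : ℝ) := le_of_mul_le_mul_right (h1.trans hLc2) (by positivity)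
    have h3 : (2 * q : ℝ) ≤ ρ := by linarith
    exact_mod_cast h3
  have hJ0 : 0 < J := hJ ▸ Nat.div_pos hqρ (by omega)
  have hJ_le : 2 * q * J ≤ ρ := hJ ▸ Nat.mul_div_le _ _
  have hJ_ge : ρ ≤ 4 * (q * J) := by
    have h1 : ρ < ρ / (2 * q) * (2 * q) + 2 * q := Nat.lt_div_mul_add (by omega)
    have h2 : q * 1 ≤ q * J := Nat.mul_le_mul_left _ hJ0
    rw [← hJ] at h1
    linarith
  have hqJ0 : (0 : ℝ) < (q * J : ℕ) := by positivity
  obtain ⟨m, hm_ge, hm_le⟩ := hceil (2 * L / (q * J : ℕ)) (by positivity)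
  rw [div_le_iff₀ hqJ0] at hm_ge
  have hm_c : (m : ℝ) ≤ 2 * c ^ 2 := by
    have h1 : (ρ : ℝ) ≤ 4 * (q * J : ℕ) := by exact_mod_cast hJ_ge
    have h2 : 2 * L / (q * J : ℕ) ≤ c ^ 2 := by
      rw [div_le_iff₀ hqJ0]
      linarith [mul_le_mul_of_nonneg_right h1 (sq_nonneg c)]
    linarith
  have hmJ : (q * J : ℕ) * (m : ℝ) ≤ 505 * L := by
    have h1 : (2 : ℝ) * (q * J : ℕ) ≤ ρ := by
      have : 2 * (q * J) ≤ ρ := by linarith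
      exact_mod_cast this
    have h2 : 1000 * L / c ^ 2 ≤ 1000 * L := div_le_self (by positivity) (by linarith)
    calc (q * J : ℕ) * (m : ℝ) ≤ (q * J : ℕ) * (2 * L / (q * J : ℕ) + 1) := by gcongr
      _ = 2 * L + (q * J : ℕ) := by field_simp
      _ ≤ _ := by linarith
  have hβs : (β : ℝ) ≤ 2 * s := by
    have h1 : (2 : ℝ) ^ (c ^ 2 / 1000) ≤ s := by
      rw [hs]
      exact Real.rpow_le_rpow_of_exponent_le one_le_two (by linarith)
    linarith
  refine ⟨c, q, ρ, β, J, m, by linarith, hρ0, ?_, hq0, ?_, hJ0, hJ_le, ?_, ?_, ?_⟩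
  · have h1 : (n : ℝ) ≤ (β : ℝ) ^ ρ :=
      calc (n : ℝ) = 2 ^ L := hLn.symm
        _ ≤ 2 ^ (c ^ 2 / 1000 * ρ) :=
          Real.rpow_le_rpow_of_exponent_le one_le_two (by linarith)
        _ = ((2 : ℝ) ^ (c ^ 2 / 1000)) ^ ρ := Real.rpow_mul_natCast two_pos.le _ _
        _ ≤ (β : ℝ) ^ ρ := by gcongr
    exact_mod_cast h1
  · have h1 : L / c ≤ L / 2 := by gcongr
    calc 28 * ρ * c = 28 * (ρ * c) := by ring
      _ ≤ L * 2 ^ 15 := by linarith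
      _ = 2 ^ y * 2 ^ 15 := by rw [hyL]
      _ ≤ 2 ^ (q' : ℝ) * 2 ^ 15 := by
        gcongr
        norm_num
      _ = 2 ^ q := by rw [hq, Real.rpow_natCast, ← pow_add]
  · have h1 : (n : ℝ) ^ 2 ≤ 2 ^ (q * J * m) :=
      calc (n : ℝ) ^ 2 = (2 ^ L) ^ 2 := by rw [hLn]
        _ = 2 ^ (L * (2 : ℕ)) := (Real.rpow_mul_natCast two_pos.le _ _).symm
        _ ≤ 2 ^ ((q * J * m : ℕ) : ℝ) :=
          Real.rpow_le_rpow_of_exponent_le one_le_two (by push_cast at hm_ge ⊢; linarith)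
        _ = _ := Real.rpow_natCast _ _
    exact_mod_cast h1
  · have : 0 ≤ L / c := by positivity
    linarith
  · have h1 : q * m * (8 * J / c) ≤ 4040 * (L / c) :=
      calc q * m * (8 * J / c) = 8 * ((q * J : ℕ) * m) / c := by push_cast; ring
        _ ≤ 8 * (505 * L) / c := by gcongr
        _ = _ := by ring
    have h2 : q * m * (8 + 14 * β : ℝ) ≤ 720000 * (L / c) := by
      rw [← mul_div_assoc, le_div_iff₀ hc0]
      calc q * m * (8 + 14 * β) * c ≤ 5 * y * (2 * c ^ 2) * (8 * s + 14 * (2 * s)) * c := by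
            gcongr
            linarith
        _ = 360 * s * (y * c ^ 3) := by ring
        _ ≤ 360 * s * (y * y ^ 3) := by gcongr
        _ = 360 * s * y ^ 4 := by ring
        _ ≤ 360 * s * (2000 * s) := by gcongr
        _ = 720000 * (s * s) := by ring
        _ = _ := by rw [hss]
    have h3 : 1 ≤ L / c := (one_le_div hc0).2 (hc_le_y.trans hy_le_L)
    calc 2 + q * m * (8 * J / c + 8 + 14 * β)
        = 2 + q * m * (8 * J / c) + q * m * (8 + 14 * β) := by ring
      _ ≤ _ := by linarith

theorem exists_isTree_totalWeight_eq_mstWeight {V : Type} [Fintype V] {G : SimpleGraph V}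
    (hG : G.Connected) (w : Sym2 V → NNReal) :
    ∃ T ≤ G, T.IsTree ∧ totalWeight T w = mstWeight G w := by
  classical
  have hfin : {x | ∃ T : SimpleGraph V, T ≤ G ∧ T.IsTree ∧ x = totalWeight T w}.Finite :=
    (Set.finite_range fun T : SimpleGraph V => totalWeight T w).subset <| by
      rintro x ⟨T, -, -, rfl⟩
      exact ⟨T, rfl⟩
  obtain ⟨T₀, hT₀, hT₀'⟩ := hG.exists_isTree_le
  have hne : {x | ∃ T : SimpleGraph V, T ≤ G ∧ T.IsTree ∧ x = totalWeight T w}.Nonempty :=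
    ⟨_, T₀, hT₀, hT₀', rfl⟩
  obtain ⟨T, hT, hT', h⟩ := hne.csInf_mem hfin
  exact ⟨T, hT, hT', h.symm⟩

theorem totalWeight_pos {V : Type} [Fintype V] [Nontrivial V] {T : SimpleGraph V}
    (hT : T.Connected) {w : Sym2 V → NNReal} (hw : ∀ e ∈ T.edgeSet, 0 < w e) :
    0 < totalWeight T w := by
  obtain ⟨v⟩ := hT.nonempty
  obtain ⟨u, hu⟩ := hT.preconnected.exists_adj_of_nontrivial v
  have hmem : s(v, u) ∈ T.edgeSet.toFinite.toFinset := by simpa using hu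
  refine Finset.sum_pos (fun e he => ?_) ⟨_, hmem⟩
  exact NNReal.coe_pos.2 (hw e (by simpa using he))

/-- There is a universal constant `C > 0` such that every connected weighted graph `G` on
`n ≥ 2^16` vertices admits a subgraph `H` whose stretch and lightness are both bounded by
`C · log n / log log log n`. -/
theorem spanner_equal_stretch_and_lightness :
    ∃ C : ℝ, 0 < C ∧
      ∀ (V : Type) [Fintype V] (G : SimpleGraph V) (w : Sym2 V → NNReal),
        2 ^ 16 ≤ Fintype.card V → G.Connected → (∀ e ∈ G.edgeSet, 0 < w e) →
        ∃ H : SimpleGraph V, H ≤ G ∧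
          IsTSpanner G H w
            (C * Real.logb 2 (Fintype.card V) /
              Real.logb 2 (Real.logb 2 (Real.logb 2 (Fintype.card V)))) ∧
          totalWeight H w ≤
            C * (Real.logb 2 (Fintype.card V) /
                Real.logb 2 (Real.logb 2 (Real.logb 2 (Fintype.card V)))) *
              mstWeight G w := by
  refine ⟨1000000, by norm_num, fun V _ G w hn hG hw => ?_⟩
  have : Nontrivial V := Fintype.one_lt_card_iff_nontrivial.1 (lt_of_lt_of_le (by norm_num) hn)
  obtain ⟨T, hTG, hT, hTw⟩ := exists_isTree_totalWeight_eq_mstWeight hG w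
  have hW : 0 < totalWeight T w :=
    totalWeight_pos hT.connected fun e he => hw e (edgeSet_mono hTG he)
  obtain ⟨p, hp, hd⟩ := exists_line_embedding hT.connected w
  obtain ⟨r, q, ρ, β, J, m, hr, hρ, hcard, hq, hκ, hJ0, hJ, hm, hstretch, hlight⟩ :=
    exists_parameters hn
  obtain ⟨H, hHG, hspan, hHw⟩ :=
    exists_spanner_of_parameters hTG hW hp hd hr hρ hcard hq hκ hJ0 hJ hm
  rw [mul_div_assoc]
  refine ⟨H, hHG, isTSpanner_of_edges (lt_of_lt_of_le (by positivity) hstretch) ?_, ?_⟩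
  · refine fun u v huv => (hspan u v huv).trans (ENNReal.ofReal_le_ofReal ?_)
    exact mul_le_mul_of_nonneg_right hstretch (w s(u, v)).coe_nonneg
  · rw [← hTw]
    refine hHw.trans ((le_of_eq ?_).trans (mul_le_mul_of_nonneg_right hlight hW.le))
    ring
end

section
/- For every integer t ≥ 2 and every weighted graph H on n vertices in which every cycle C satisfies w(C) > (t+1) · max_{e ∈ C} w(e) (equivalently, whose weighted girth exceeds t+1), the number of edges of H is at most n^{1+1/⌊(t+1)/2⌋} + n. -/
open SimpleGraph

namespace SimpleGraph

variable {V : Type*} {G : SimpleGraph V}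

/-- In a graph without cycles of length at most `2 * k`, two paths of length at most `k` with the
same endpoints coincide. -/
theorem Walk.IsPath.eq_of_length_le_of_girth {k : ℕ}
    (hG : ∀ (v : V) (p : G.Walk v v), p.IsCycle → 2 * k < p.length)
    {u v : V} {p q : G.Walk u v} (hp : p.IsPath) (hq : q.IsPath)
    (hpk : p.length ≤ k) (hqk : q.length ≤ k) : p = q := by
  classical
  set F : SimpleGraph V := fromEdgeSet {e | e ∈ p.edges ∪ q.edges} with hF
  have hFE : ∀ e ∈ F.edgeSet, e ∈ p.edges ∪ q.edges := by
    intro e he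
    rw [hF, edgeSet_fromEdgeSet] at he
    exact he.1
  have hFG : F ≤ G := by
    rw [← edgeSet_subset_edgeSet]
    intro e he
    rcases List.mem_union_iff.1 (hFE e he) with h | h
    · exact p.edges_subset_edgeSet h
    · exact q.edges_subset_edgeSet h
  have hmem : ∀ e ∈ p.edges ∪ q.edges, e ∈ G.edgeSet → e ∈ F.edgeSet := by
    intro e he heG
    rw [hF, edgeSet_fromEdgeSet]
    exact ⟨he, G.not_isDiag_of_mem_edgeSet heG⟩
  have hpF : ∀ e ∈ p.edges, e ∈ F.edgeSet := fun e he =>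
    hmem e (List.mem_union_iff.2 (.inl he)) (p.edges_subset_edgeSet he)
  have hqF : ∀ e ∈ q.edges, e ∈ F.edgeSet := fun e he =>
    hmem e (List.mem_union_iff.2 (.inr he)) (q.edges_subset_edgeSet he)
  have hacyc : F.IsAcyclic := by
    intro x c hc
    have hlt := hG x (c.mapLe hFG) (hc.mapLe hFG)
    have hle : c.edges.length ≤ (p.edges ++ q.edges).length := by
      refine (hc.isTrail.edges_nodup.subperm fun e he => ?_).length_le
      simpa using hFE e (c.edges_subset_edgeSet he)
    simp only [Walk.length_map, Walk.length_edges, List.length_append] at hlt hle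
    omega
  have := hacyc.subsingleton_path u v
  have h : p.transfer F hpF = q.transfer F hqF := congrArg Subtype.val <|
    Subsingleton.elim (α := F.Path u v) ⟨_, hp.transfer hpF⟩ ⟨_, hq.transfer hqF⟩
  apply Walk.ext_support
  simpa using congrArg Walk.support h

/-- The Moore bound, in a weak form: a graph of minimum degree at least `d + 1` without cycles of
length at most `2 * k` has at least `d ^ k` vertices. -/
theorem pow_le_card_of_girth [Fintype V] [Nonempty V] [DecidableRel G.Adj] {k d : ℕ}
    (hG : ∀ (v : V) (p : G.Walk v v), p.IsCycle → 2 * k < p.length)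
    (hd : ∀ v, d + 1 ≤ G.degree v) : d ^ k ≤ Fintype.card V := by
  classical
  obtain ⟨r⟩ := ‹Nonempty V›
  let N : ℕ → Finset V := fun j => {u | ∃ p : G.Walk r u, p.IsPath ∧ p.length = j}
  have hgrow : ∀ j ≤ k, d ^ j ≤ (N j).card := by
    intro j
    induction j with
    | zero =>
      intro _
      rw [pow_zero, Nat.one_le_iff_ne_zero, Finset.card_ne_zero]
      exact ⟨r, by simp [N]⟩
    | succ j ih =>
      intro hj
      let E : V → Finset V := fun u =>
        {x ∈ G.neighborFinset u | ∃ p : G.Walk r u, p.IsPath ∧ p.length = j ∧ x ∉ p.support}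
      have hEcard : ∀ u ∈ N j, d ≤ (E u).card := by
        intro u hu
        obtain ⟨p, hp, hpl⟩ := (Finset.mem_filter.1 hu).2
        have hsub : (G.neighborFinset u).erase p.penultimate ⊆ E u := by
          intro x hx
          rw [Finset.mem_erase, mem_neighborFinset] at hx
          obtain ⟨hne, hadj⟩ := hx
          refine Finset.mem_filter.2
            ⟨(mem_neighborFinset ..).2 hadj, p, hp, hpl, fun hxs => hne ?_⟩
          have hut : u ∉ (p.takeUntil x hxs).support :=
            Walk.endpoint_notMem_support_takeUntil hp hxs hadj.ne
          have hlen := p.length_takeUntil_le_length hxs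
          have heq := ((hp.takeUntil hxs).concat hut hadj.symm).eq_of_length_le_of_girth hG hp
            (by rw [Walk.length_concat]; omega) (by omega)
          rw [← heq, Walk.penultimate_concat]
        have h1 := Finset.card_le_card hsub
        have h2 := Finset.pred_card_le_card_erase (s := G.neighborFinset u) (a := p.penultimate)
        have h3 := hd u
        rw [card_neighborFinset_eq_degree] at h2
        omega
      have hdisj : (N j : Set V).PairwiseDisjoint E := by
        intro u _ u' _ hne
        refine Finset.disjoint_left.2 fun x hx hx' => hne ?_
        obtain ⟨hadj, p, hp, hpl, hxp⟩ := Finset.mem_filter.1 hx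
        obtain ⟨hadj', q, hq, hql, hxq⟩ := Finset.mem_filter.1 hx'
        rw [mem_neighborFinset] at hadj hadj'
        have heq := (hp.concat hxp hadj).eq_of_length_le_of_girth hG (hq.concat hxq hadj')
          (by rw [Walk.length_concat, hpl]; exact hj) (by rw [Walk.length_concat, hql]; exact hj)
        simpa using congrArg Walk.penultimate heq
      have hsub : (N j).biUnion E ⊆ N (j + 1) := by
        intro x hx
        obtain ⟨u, -, hxu⟩ := Finset.mem_biUnion.1 hx
        obtain ⟨hadj, p, hp, hpl, hxp⟩ := Finset.mem_filter.1 hxu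
        rw [mem_neighborFinset] at hadj
        exact Finset.mem_filter.2 ⟨Finset.mem_univ _, p.concat hadj, hp.concat hxp hadj,
          by rw [Walk.length_concat, hpl]⟩
      calc d ^ (j + 1) = d ^ j * d := pow_succ ..
        _ ≤ (N j).card * d := Nat.mul_le_mul_right _ (ih (by omega))
        _ ≤ ∑ u ∈ N j, (E u).card := by
          simpa using Finset.card_nsmul_le_sum (N j) (fun u => (E u).card) d hEcard
        _ = ((N j).biUnion E).card := (Finset.card_biUnion hdisj).symm
        _ ≤ (N (j + 1)).card := Finset.card_le_card hsub
  exact (hgrow k le_rfl).trans (Finset.card_le_univ _)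

/-- A graph with more than `c * n` edges has a nonempty induced subgraph of minimum degree
greater than `c`. -/
theorem exists_nonempty_forall_lt_card_neighborFinset_inter [Fintype V] [DecidableEq V]
    [DecidableRel G.Adj] {c : ℝ} (h : c * Fintype.card V < G.edgeFinset.card) :
    ∃ S : Finset V, S.Nonempty ∧ ∀ v ∈ S, c < (G.neighborFinset v ∩ S).card := by
  let e : Finset V → Finset (Sym2 V) := fun S => {x ∈ G.edgeFinset | ∀ v ∈ x, v ∈ S}
  have hne : ({S | c * S.card < (e S).card} : Finset (Finset V)).Nonempty :=
    ⟨Finset.univ, by simpa [e] using h⟩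
  obtain ⟨S, hS, hmin⟩ := Finset.exists_min_image _ Finset.card hne
  simp only [Finset.mem_filter, Finset.mem_univ, true_and] at hS hmin
  refine ⟨S, Finset.nonempty_iff_ne_empty.2 ?_, fun v hv => ?_⟩
  · rintro rfl
    have h0 : e ∅ = ∅ := by
      refine Finset.filter_eq_empty_iff.2 fun x _ hx => ?_
      induction x with
      | _ a b => exact absurd (hx a (Sym2.mem_mk_left a b)) (Finset.notMem_empty a)
    simp [h0] at hS
  · by_contra! hle
    have hsub : e S ⊆ e (S.erase v) ∪ (G.neighborFinset v ∩ S).image (fun u => s(v, u)) := by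
      intro x hx
      obtain ⟨hxG, hxS⟩ := Finset.mem_filter.1 hx
      by_cases hvx : v ∈ x
      · obtain ⟨u, rfl⟩ := hvx
        refine Finset.mem_union_right _ (Finset.mem_image_of_mem _ (Finset.mem_inter.2 ⟨?_, ?_⟩))
        · simpa using hxG
        · exact hxS u (Sym2.mem_mk_right v u)
      · refine Finset.mem_union_left _ (Finset.mem_filter.2 ⟨hxG, fun a ha => ?_⟩)
        exact Finset.mem_erase.2 ⟨fun hav => hvx (hav ▸ ha), hxS a ha⟩
    have hcard : (e S).card ≤ (e (S.erase v)).card + (G.neighborFinset v ∩ S).card :=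
      (Finset.card_le_card hsub).trans <| (Finset.card_union_le _ _).trans <|
        Nat.add_le_add_left Finset.card_image_le _
    have hSc : (S.erase v).card + 1 = S.card := Finset.card_erase_add_one hv
    have hlt : c * (S.erase v).card < (e (S.erase v)).card := by
      have hcard' : ((e S).card : ℝ) ≤ (e (S.erase v)).card + (G.neighborFinset v ∩ S).card := by
        exact_mod_cast hcard
      have hSc' : ((S.erase v).card : ℝ) + 1 = S.card := by exact_mod_cast hSc
      rw [← hSc'] at hS
      linarith
    have := hmin _ hlt
    omega

/-- A graph on `n` vertices without cycles of length at most `2 * k` has at most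
`n ^ (1 + 1 / k) + n` edges. -/
theorem card_edgeFinset_le_rpow_of_girth [Fintype V] [DecidableRel G.Adj] {k : ℕ} (hk : k ≠ 0)
    (hG : ∀ (v : V) (p : G.Walk v v), p.IsCycle → 2 * k < p.length) :
    (G.edgeFinset.card : ℝ) ≤
      (Fintype.card V : ℝ) ^ ((1 : ℝ) + 1 / (k : ℝ)) + (Fintype.card V : ℝ) := by
  classical
  by_contra! hlt
  set n : ℝ := (Fintype.card V : ℝ) with hn
  have hn0 : 0 ≤ n := Nat.cast_nonneg _
  have hexp : n ^ ((1 : ℝ) + 1 / (k : ℝ)) + n = (n ^ (1 / (k : ℝ)) + 1) * n := by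
    rw [Real.rpow_add' hn0 (by positivity), Real.rpow_one]
    ring
  rw [hexp] at hlt
  obtain ⟨S, ⟨r, hr⟩, hS⟩ := exists_nonempty_forall_lt_card_neighborFinset_inter hlt
  let G' : SimpleGraph S := G.induce (S : Set V)
  have : Nonempty S := ⟨⟨r, hr⟩⟩
  have hG' : ∀ (v : S) (p : G'.Walk v v), p.IsCycle → 2 * k < p.length := by
    intro v p hp
    let f : G' →g G := (Embedding.induce (G := G) (S : Set V)).toHom
    have hf : Function.Injective f := Subtype.val_injective
    simpa using hG _ (p.map f) (hp.map hf)
  have hdeg : ∀ v : S, n ^ (1 / (k : ℝ)) + 1 < G'.degree v := by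
    intro v
    have hcard : (G.neighborFinset v ∩ S).card ≤ G'.degree v := by
      rw [← card_neighborFinset_eq_degree,
        ← Finset.card_map (Function.Embedding.subtype (· ∈ S))]
      refine Finset.card_le_card fun x hx => ?_
      obtain ⟨hadj, hxS⟩ := Finset.mem_inter.1 hx
      refine Finset.mem_map.2 ⟨⟨x, hxS⟩, ?_, rfl⟩
      simpa [G'] using hadj
    exact (hS v v.2).trans_le (by exact_mod_cast hcard)
  obtain ⟨u, hu⟩ := G'.exists_minimal_degree_vertex
  have hpos : 0 ≤ n ^ (1 / (k : ℝ)) := Real.rpow_nonneg hn0 _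
  have hδ := hdeg u
  rw [← hu] at hδ
  obtain ⟨d, hd⟩ : ∃ d, G'.minDegree = d + 1 := by
    refine Nat.exists_eq_succ_of_ne_zero fun h0 => ?_
    rw [h0, Nat.cast_zero] at hδ
    linarith
  have hdn : n ^ (1 / (k : ℝ)) < d := by
    rw [hd, Nat.cast_add_one] at hδ
    linarith
  have hmoore : d ^ k ≤ Fintype.card V :=
    (pow_le_card_of_girth hG' fun v => hd ▸ G'.minDegree_le_degree v).trans
      (Fintype.card_subtype_le _)
  have hmoore' : (d : ℝ) ^ k ≤ n := by rw [hn]; exact_mod_cast hmoore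
  have hpow := pow_lt_pow_left₀ hdn hpos hk
  rw [one_div, Real.rpow_inv_natCast_pow hn0 hk] at hpow
  linarith

/-- A cycle of weighted length greater than `c` times each of its edge weights has more than `c`
edges. -/
theorem Walk.IsCycle.lt_length_of_forall_mul_lt_sum {w : Sym2 V → NNReal} {c : ℝ} {v : V}
    {p : G.Walk v v} (hp : p.IsCycle)
    (h : ∀ e ∈ p.edges, c * (w e : ℝ) < (p.edges.map fun e => (w e : ℝ)).sum) :
    c < p.length := by
  classical
  have hne : p.edges.toFinset.Nonempty := by
    rw [List.toFinset_nonempty_iff]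
    exact fun h0 => hp.not_nil (Walk.edges_eq_nil.1 h0)
  obtain ⟨e, he, hmax⟩ := Finset.exists_max_image p.edges.toFinset w hne
  rw [List.mem_toFinset] at he
  have hsum : (p.edges.map fun e => (w e : ℝ)).sum ≤ p.length * w e := by
    have := List.sum_le_card_nsmul (p.edges.map fun e => (w e : ℝ)) (w e) (by
      intro x hx
      obtain ⟨a, ha, rfl⟩ := List.mem_map.1 hx
      exact_mod_cast hmax a (List.mem_toFinset.2 ha))
    simpa using this
  exact lt_of_mul_lt_mul_right ((h e he).trans_le hsum) (w e).2

end SimpleGraph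

/-- **Edge bound for large weighted girth.** Let `t ≥ 2` be an integer, and let `H` be a
weighted graph on `n` vertices in which every cycle `C` satisfies
`w(C) > (t+1) · max_{e ∈ C} w(e)` (i.e. whose weighted girth exceeds `t+1`; the condition
is stated equivalently as `w(C) > (t+1) · w(e)` for every edge `e` of `C`). Then `H` has
at most `n^{1 + 1/⌊(t+1)/2⌋} + n` edges. -/
theorem edge_bound_of_large_weighted_girth (t : ℕ) (ht : 2 ≤ t) (V : Type) [Fintype V]
    (H : SimpleGraph V) (w : Sym2 V → NNReal) (hw : ∀ e ∈ H.edgeSet, 0 < w e)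
    (hgirth : ∀ (v : V) (p : H.Walk v v), p.IsCycle →
      ∀ e ∈ p.edges, ((t : ℝ) + 1) * (w e : ℝ) < (p.edges.map fun e => (w e : ℝ)).sum) :
    (Nat.card H.edgeSet : ℝ) ≤
      (Fintype.card V : ℝ) ^ ((1 : ℝ) + 1 / (((t + 1) / 2 : ℕ) : ℝ)) +
        (Fintype.card V : ℝ) := by
  classical
  rw [Nat.card_eq_fintype_card, ← edgeFinset_card]
  refine card_edgeFinset_le_rpow_of_girth (by omega) fun v p hp => ?_
  have hlen : t + 1 < p.length := by
    exact_mod_cast hp.lt_length_of_forall_mul_lt_sum (hgirth v p hp)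
  omega
end
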